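/- Let k be a field, G an algebraic group over k, and H ⊂ G a subgroup scheme such that the quotient G/H is finite. Let X be a G-scheme of finite type over k. If X admits an ample H-linearized line bundle, then X admits an ample G-linearized line bundle. -/

import Mathlib

open AlgebraicGeometry CategoryTheory CategoryTheory.Limits Opposite

universe u

noncomputable section

/-- The spectrum of the field `k`, the base of all schemes considered. -/
abbrev Spk (k : Type u) [Field k] : Scheme.{u} := Spec (CommRingCat.of k)

/-- A scheme over the field `k`: a scheme together with a structure morphism to `Spec k`. -/
structure SchemeOver (k : Type u) [Field k] : Type (u + 1) where
  carrier : Scheme.{u}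
  str : carrier ⟶ Spk k

variable (k : Type u) [Field k]

/-- A group scheme over `k`, presented via its functor of points: for every scheme `T`
and every pair of `T`-points lying over the same `T`-point of `Spec k`, a product point,
together with unit and inverse, satisfying the group axioms functorially. -/
structure GroupSchemeOver extends SchemeOver k where
  mul : ∀ {T : Scheme.{u}} (a b : T ⟶ carrier), a ≫ str = b ≫ str → (T ⟶ carrier)
  one : Spk k ⟶ carrier
  inv : ∀ {T : Scheme.{u}}, (T ⟶ carrier) → (T ⟶ carrier)
  mul_str : ∀ {T : Scheme.{u}} (a b : T ⟶ carrier) (h), mul a b h ≫ str = a ≫ str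
  one_str : one ≫ str = 𝟙 (Spk k)
  inv_str : ∀ {T : Scheme.{u}} (a : T ⟶ carrier), inv a ≫ str = a ≫ str
  mul_natural : ∀ {T' T : Scheme.{u}} (g : T' ⟶ T) (a b : T ⟶ carrier) (h h'),
    g ≫ mul a b h = mul (g ≫ a) (g ≫ b) h'
  inv_natural : ∀ {T' T : Scheme.{u}} (g : T' ⟶ T) (a : T ⟶ carrier),
    g ≫ inv a = inv (g ≫ a)
  mul_assoc : ∀ {T : Scheme.{u}} (a b c : T ⟶ carrier) (h₁ h₂ h₃ h₄),
    mul (mul a b h₁) c h₂ = mul a (mul b c h₃) h₄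
  one_mul : ∀ {T : Scheme.{u}} (a : T ⟶ carrier) (h), mul (a ≫ str ≫ one) a h = a
  mul_one : ∀ {T : Scheme.{u}} (a : T ⟶ carrier) (h), mul a (a ≫ str ≫ one) h = a
  inv_mul : ∀ {T : Scheme.{u}} (a : T ⟶ carrier) (h), mul (inv a) a h = a ≫ str ≫ one

variable {k}

theorem GroupSchemeOver.mul_congr (G : GroupSchemeOver k) {T : Scheme.{u}}
    {a a' b b' : T ⟶ G.carrier} (ha : a = a') (hb : b = b') (h h') :
    G.mul a b h = G.mul a' b' h' := by subst ha; subst hb; rfl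

/-- A homomorphism of group schemes over `k`. -/
structure GroupHom (G H : GroupSchemeOver k) where
  hom : G.carrier ⟶ H.carrier
  hom_str : hom ≫ H.str = G.str
  hom_one : G.one ≫ hom = H.one
  hom_mul : ∀ {T : Scheme.{u}} (a b : T ⟶ G.carrier) (h h'),
    G.mul a b h ≫ hom = H.mul (a ≫ hom) (b ≫ hom) h'

/-- An action of a group scheme `G` over `k` on a scheme `X` over `k`, presented via
its functor of points. -/
structure ActionOver (G : GroupSchemeOver k) (X : SchemeOver k) where
  act : ∀ {T : Scheme.{u}} (g : T ⟶ G.carrier) (x : T ⟶ X.carrier),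
    g ≫ G.str = x ≫ X.str → (T ⟶ X.carrier)
  act_str : ∀ {T : Scheme.{u}} (g : T ⟶ G.carrier) (x : T ⟶ X.carrier) (h),
    act g x h ≫ X.str = x ≫ X.str
  act_natural : ∀ {T' T : Scheme.{u}} (f : T' ⟶ T) (g : T ⟶ G.carrier)
    (x : T ⟶ X.carrier) (h h'), f ≫ act g x h = act (f ≫ g) (f ≫ x) h'
  one_act : ∀ {T : Scheme.{u}} (x : T ⟶ X.carrier) (h), act (x ≫ X.str ≫ G.one) x h = x
  mul_act : ∀ {T : Scheme.{u}} (g g' : T ⟶ G.carrier) (x : T ⟶ X.carrier) (h₁ h₂ h₃ h₄),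
    act (G.mul g g' h₁) x h₂ = act g (act g' x h₃) h₄

theorem ActionOver.act_congr {G : GroupSchemeOver k} {X : SchemeOver k}
    (α : ActionOver G X) {T : Scheme.{u}} {g g' : T ⟶ G.carrier} {x x' : T ⟶ X.carrier}
    (hg : g = g') (hx : x = x') (h h') : α.act g x h = α.act g' x' h' := by
  subst hg; subst hx; rfl

/-- The action of a group scheme on itself by left translations. -/
def GroupSchemeOver.selfAction (G : GroupSchemeOver k) : ActionOver G G.toSchemeOver where
  act g x h := G.mul g x h
  act_str g x h := (G.mul_str g x h).trans h
  act_natural f g x h h' := G.mul_natural f g x h h'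
  one_act x h := G.one_mul x h
  mul_act g g' x h₁ h₂ h₃ h₄ := G.mul_assoc g g' x h₁ h₂ h₃ h₄

/-- Restriction of an action along a homomorphism of group schemes. -/
def ActionOver.res {G H : GroupSchemeOver k} {X : SchemeOver k} (φ : GroupHom H G)
    (α : ActionOver G X) : ActionOver H X where
  act g x h := α.act (g ≫ φ.hom) x (by rw [Category.assoc, φ.hom_str, h])
  act_str g x h := α.act_str _ _ _
  act_natural f g x h h' := by
    refine (α.act_natural f (g ≫ φ.hom) x _ ?_).trans (α.act_congr ?_ rfl _ _)
    · simp only [Category.assoc, φ.hom_str, ← h']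
    · simp only [Category.assoc]
  one_act x h := by
    refine (α.act_congr ?_ rfl _ ?_).trans (α.one_act x ?_)
    · simp only [Category.assoc, φ.hom_one]
    · simp only [Category.assoc, G.one_str, Category.comp_id]
    · simp only [Category.assoc, G.one_str, Category.comp_id]
  mul_act g g' x h₁ h₂ h₃ h₄ := by
    have hg : g ≫ H.str = x ≫ X.str := (H.mul_str g g' h₁).symm.trans h₂
    have hg' : g' ≫ H.str = x ≫ X.str := h₁.symm.trans hg
    have p1 : (g ≫ φ.hom) ≫ G.str = (g' ≫ φ.hom) ≫ G.str := by
      simp only [Category.assoc, φ.hom_str]; exact h₁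
    have p3 : (g' ≫ φ.hom) ≫ G.str = x ≫ X.str := by
      simp only [Category.assoc, φ.hom_str]; exact hg'
    refine (α.act_congr (φ.hom_mul g g' h₁ p1) rfl _ ?_).trans
      (α.mul_act (g ≫ φ.hom) (g' ≫ φ.hom) x p1 ?_ p3 ?_)
    · rw [G.mul_str]
      simp only [Category.assoc, φ.hom_str]; exact hg
    · rw [G.mul_str]
      simp only [Category.assoc, φ.hom_str]; exact hg
    · rw [α.act_str]
      simp only [Category.assoc, φ.hom_str]; exact hg
/-! ### Vector bundles and line bundles, geometrically -/

/-- The data underlying a (geometric) vector bundle on a scheme `X`: a total space `π : tot ⟶ X`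
together with a fiberwise `Γ(T, ⊤)`-module structure on the `T`-points of `tot` over a fixed
`T`-point of `X`, functorially in `T`. -/
structure VecBundleData (X : Scheme.{u}) : Type (u + 1) where
  tot : Scheme.{u}
  π : tot ⟶ X
  zero : X ⟶ tot
  zero_π : zero ≫ π = 𝟙 X
  add : ∀ {T : Scheme.{u}} (a b : T ⟶ tot), a ≫ π = b ≫ π → (T ⟶ tot)
  smul : ∀ {T : Scheme.{u}} (f : Γ(T, ⊤)) (a : T ⟶ tot), T ⟶ tot
  add_π : ∀ {T : Scheme.{u}} (a b : T ⟶ tot) (h), add a b h ≫ π = a ≫ π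
  smul_π : ∀ {T : Scheme.{u}} (f : Γ(T, ⊤)) (a : T ⟶ tot), smul f a ≫ π = a ≫ π
  add_natural : ∀ {T' T : Scheme.{u}} (g : T' ⟶ T) (a b : T ⟶ tot) (h h'),
    g ≫ add a b h = add (g ≫ a) (g ≫ b) h'
  smul_natural : ∀ {T' T : Scheme.{u}} (g : T' ⟶ T) (f : Γ(T, ⊤)) (a : T ⟶ tot),
    g ≫ smul f a = smul (g.appTop f) (g ≫ a)
  add_comm : ∀ {T : Scheme.{u}} (a b : T ⟶ tot) (h h'), add a b h = add b a h'
  add_assoc : ∀ {T : Scheme.{u}} (a b c : T ⟶ tot) (h₁ h₂ h₃ h₄),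
    add (add a b h₁) c h₂ = add a (add b c h₃) h₄
  zero_add : ∀ {T : Scheme.{u}} (a : T ⟶ tot) (h), add ((a ≫ π) ≫ zero) a h = a
  one_smul : ∀ {T : Scheme.{u}} (a : T ⟶ tot), smul 1 a = a
  mul_smul : ∀ {T : Scheme.{u}} (f g : Γ(T, ⊤)) (a : T ⟶ tot), smul (f * g) a = smul f (smul g a)
  smul_add : ∀ {T : Scheme.{u}} (f : Γ(T, ⊤)) (a b : T ⟶ tot) (h h'),
    smul f (add a b h) = add (smul f a) (smul f b) h'
  add_smul : ∀ {T : Scheme.{u}} (f g : Γ(T, ⊤)) (a : T ⟶ tot) (h),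
    smul (f + g) a = add (smul f a) (smul g a) h
  zero_smul : ∀ {T : Scheme.{u}} (a : T ⟶ tot), smul 0 a = (a ≫ π) ≫ zero
  smul_zero : ∀ {T : Scheme.{u}} (f : Γ(T, ⊤)) (x : T ⟶ X), smul f (x ≫ zero) = x ≫ zero

namespace VecBundleData

variable {X : Scheme.{u}} (E : VecBundleData X)

theorem add_congr {T : Scheme.{u}} {a a' b b' : T ⟶ E.tot} (ha : a = a') (hb : b = b')
    (h h') : E.add a b h = E.add a' b' h' := by subst ha; subst hb; rfl

/-- The fiber of a vector bundle over a `T`-point of the base. -/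
abbrev Fiber {T : Scheme.{u}} (x : T ⟶ X) : Type u := { a : T ⟶ E.tot // a ≫ E.π = x }

instance fiberZero {T : Scheme.{u}} (x : T ⟶ X) : Zero (E.Fiber x) :=
  ⟨⟨x ≫ E.zero, by rw [Category.assoc, E.zero_π, Category.comp_id]⟩⟩

instance fiberAdd {T : Scheme.{u}} (x : T ⟶ X) : Add (E.Fiber x) :=
  ⟨fun a b => ⟨E.add a.1 b.1 (a.2.trans b.2.symm), (E.add_π _ _ _).trans a.2⟩⟩

instance fiberSMul {T : Scheme.{u}} (x : T ⟶ X) : SMul Γ(T, ⊤) (E.Fiber x) :=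
  ⟨fun f a => ⟨E.smul f a.1, (E.smul_π _ _).trans a.2⟩⟩

@[simp] theorem coe_fiber_zero {T : Scheme.{u}} (x : T ⟶ X) :
    ((0 : E.Fiber x) : T ⟶ E.tot) = x ≫ E.zero := rfl

@[simp] theorem coe_fiber_add {T : Scheme.{u}} (x : T ⟶ X) (a b : E.Fiber x) :
    ((a + b : E.Fiber x) : T ⟶ E.tot) = E.add a.1 b.1 (a.2.trans b.2.symm) := rfl

@[simp] theorem coe_fiber_smul {T : Scheme.{u}} (x : T ⟶ X) (f : Γ(T, ⊤)) (a : E.Fiber x) :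
    ((f • a : E.Fiber x) : T ⟶ E.tot) = E.smul f a.1 := rfl

instance {T : Scheme.{u}} (x : T ⟶ X) : AddCommMonoid (E.Fiber x) where
  add_assoc a b c := Subtype.ext (E.add_assoc _ _ _ _ _ _ _)
  add_comm a b := Subtype.ext (E.add_comm _ _ _ _)
  zero_add a := Subtype.ext (by
    have hz : ((a.1 ≫ E.π) ≫ E.zero) ≫ E.π = a.1 ≫ E.π := by
      rw [Category.assoc, E.zero_π, Category.comp_id]
    show E.add (x ≫ E.zero) a.1 _ = a.1
    exact (E.add_congr (by rw [a.2]) rfl _ hz).trans (E.zero_add a.1 hz))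
  add_zero a := Subtype.ext (by
    have hz : ((a.1 ≫ E.π) ≫ E.zero) ≫ E.π = a.1 ≫ E.π := by
      rw [Category.assoc, E.zero_π, Category.comp_id]
    have hz' : (x ≫ E.zero) ≫ E.π = a.1 ≫ E.π := by
      rw [Category.assoc, E.zero_π, Category.comp_id, a.2]
    show E.add a.1 (x ≫ E.zero) _ = a.1
    exact (E.add_comm _ _ _ hz').trans
      ((E.add_congr (by rw [a.2]) rfl _ hz).trans (E.zero_add a.1 hz)))
  nsmul := nsmulRec
  nsmul_zero _ := rfl
  nsmul_succ _ _ := rfl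

instance {T : Scheme.{u}} (x : T ⟶ X) : Module Γ(T, ⊤) (E.Fiber x) where
  one_smul a := Subtype.ext (E.one_smul a.1)
  mul_smul f g a := Subtype.ext (E.mul_smul f g a.1)
  smul_zero f := Subtype.ext (E.smul_zero f x)
  smul_add f a b := Subtype.ext (E.smul_add f a.1 b.1 _ _)
  add_smul f g a := Subtype.ext (E.add_smul f g a.1 _)
  zero_smul a := Subtype.ext ((E.zero_smul a.1).trans (by rw [a.2]; rfl))

/-- A family of `n` local sections of `E` over an open subset `U` is a frame if every point
of the total space over `U` is, in a unique way, a linear combination of these sections. -/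
def IsFrame {n : ℕ} (U : X.Opens) (s : Fin n → (U.toScheme ⟶ E.tot)) : Prop :=
  ∃ hs : ∀ i, s i ≫ E.π = U.ι,
    ∀ {T : Scheme.{u}} (x : T ⟶ U.toScheme),
      Function.Bijective (fun f : Fin n → Γ(T, ⊤) =>
        (∑ i, f i • (⟨x ≫ s i, by rw [Category.assoc, hs i]⟩ : E.Fiber (x ≫ U.ι))))

/-- A family of `n` global sections of `E` is a global frame if every point of the total
space is, in a unique way, a linear combination of these sections. -/
def IsGlobalFrame {n : ℕ} (s : Fin n → (X ⟶ E.tot)) : Prop :=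
  ∃ hs : ∀ i, s i ≫ E.π = 𝟙 X,
    ∀ {T : Scheme.{u}} (x : T ⟶ X),
      Function.Bijective (fun f : Fin n → Γ(T, ⊤) =>
        (∑ i, f i • (⟨x ≫ s i, by rw [Category.assoc, hs i, Category.comp_id]⟩ : E.Fiber x)))

end VecBundleData

/-- A (geometric) vector bundle of rank `n` on `X`: bundle data which is locally trivial,
i.e. admits local frames around every point of `X`. -/
structure VecBundle (n : ℕ) (X : Scheme.{u}) extends VecBundleData X where
  locTriv : ∀ x : X, ∃ (U : X.Opens) (s : Fin n → (U.toScheme ⟶ tot)),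
    x ∈ U ∧ toVecBundleData.IsFrame U s

/-- A (geometric) line bundle on a scheme. -/
abbrev LineBundle (X : Scheme.{u}) := VecBundle 1 X

/-- A morphism of total spaces of vector bundles over `X` is linear if it commutes with the
projections, the fiberwise additions and the fiberwise scalar multiplications. -/
def IsLinearHom {X : Scheme.{u}} (E F : VecBundleData X) (φ : E.tot ⟶ F.tot) : Prop :=
  (φ ≫ F.π = E.π) ∧
  (∀ {T : Scheme.{u}} (a b : T ⟶ E.tot) (h h'), E.add a b h ≫ φ = F.add (a ≫ φ) (b ≫ φ) h') ∧
  (∀ {T : Scheme.{u}} (f : Γ(T, ⊤)) (a : T ⟶ E.tot), E.smul f a ≫ φ = F.smul f (a ≫ φ))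

/-- Two vector bundles on `X` are isomorphic if there is a linear isomorphism between them. -/
def VBIso {X : Scheme.{u}} {n m : ℕ} (E : VecBundle n X) (F : VecBundle m X) : Prop :=
  ∃ φ : E.tot ⟶ F.tot, IsLinearHom E.toVecBundleData F.toVecBundleData φ ∧ IsIso φ

/-- `F` is a pullback of the vector bundle `E` along `g : Y ⟶ X`. -/
def IsPullbackBundle {Y X : Scheme.{u}} (g : Y ⟶ X) {n : ℕ} (E : VecBundle n X)
    (F : VecBundle n Y) : Prop :=
  ∃ τ : F.tot ⟶ E.tot,
    (τ ≫ E.π = F.π ≫ g) ∧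
    (∀ {T : Scheme.{u}} (a b : T ⟶ F.tot) (h h'), F.add a b h ≫ τ = E.add (a ≫ τ) (b ≫ τ) h') ∧
    (∀ {T : Scheme.{u}} (f : Γ(T, ⊤)) (a : T ⟶ F.tot), F.smul f a ≫ τ = E.smul f (a ≫ τ)) ∧
    (∀ {T : Scheme.{u}} (y : T ⟶ Y) (a : T ⟶ E.tot), a ≫ E.π = y ≫ g →
      ∃! b : T ⟶ F.tot, b ≫ F.π = y ∧ b ≫ τ = a)

/-- A vector bundle is trivial if it admits a global frame. -/
def IsTrivialBundle {X : Scheme.{u}} {n : ℕ} (E : VecBundle n X) : Prop :=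
  ∃ s : Fin n → (X ⟶ E.tot), E.toVecBundleData.IsGlobalFrame s

/-- `N` is a tensor product of the line bundles `L` and `M`: witnessed by a fiberwise
bilinear pairing taking local frames to local frames. -/
def IsTensor {X : Scheme.{u}} (L M N : LineBundle X) : Prop :=
  ∃ β : ∀ {T : Scheme.{u}} (a : T ⟶ L.tot) (b : T ⟶ M.tot), a ≫ L.π = b ≫ M.π → (T ⟶ N.tot),
    (∀ {T : Scheme.{u}} (a : T ⟶ L.tot) (b : T ⟶ M.tot) (h), β a b h ≫ N.π = a ≫ L.π) ∧
    (∀ {T' T : Scheme.{u}} (g : T' ⟶ T) (a : T ⟶ L.tot) (b : T ⟶ M.tot) (h h'),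
      g ≫ β a b h = β (g ≫ a) (g ≫ b) h') ∧
    (∀ {T : Scheme.{u}} (a a' : T ⟶ L.tot) (b : T ⟶ M.tot) (h₁ h₂ h₃ h₄ h₅),
      β (L.add a a' h₁) b h₂ = N.add (β a b h₃) (β a' b h₄) h₅) ∧
    (∀ {T : Scheme.{u}} (a : T ⟶ L.tot) (b b' : T ⟶ M.tot) (h₁ h₂ h₃ h₄ h₅),
      β a (M.add b b' h₁) h₂ = N.add (β a b h₃) (β a b' h₄) h₅) ∧
    (∀ {T : Scheme.{u}} (f : Γ(T, ⊤)) (a : T ⟶ L.tot) (b : T ⟶ M.tot) (h₁ h₂),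
      β (L.smul f a) b h₁ = N.smul f (β a b h₂)) ∧
    (∀ {T : Scheme.{u}} (f : Γ(T, ⊤)) (a : T ⟶ L.tot) (b : T ⟶ M.tot) (h₁ h₂),
      β a (M.smul f b) h₁ = N.smul f (β a b h₂)) ∧
    (∀ (U : X.Opens) (sL : Fin 1 → (U.toScheme ⟶ L.tot)) (sM : Fin 1 → (U.toScheme ⟶ M.tot)),
      L.toVecBundleData.IsFrame U sL → M.toVecBundleData.IsFrame U sM →
      ∀ (h : sL 0 ≫ L.π = sM 0 ≫ M.π),
        N.toVecBundleData.IsFrame (n := 1) U (fun _ => β (sL 0) (sM 0) h))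

/-- `N` is an `m`-th tensor power of the line bundle `L`. -/
def IsTensorPow {X : Scheme.{u}} (L : LineBundle X) : ℕ → LineBundle X → Prop
  | 0, N => IsTrivialBundle N
  | m + 1, N => ∃ M : LineBundle X, IsTensorPow L m M ∧ IsTensor M L N

/-- A line bundle is ample if the base is quasi-compact and quasi-separated and the
non-vanishing loci of global sections of positive tensor powers give an affine open cover. -/
def IsAmple {X : Scheme.{u}} (L : LineBundle X) : Prop :=
  CompactSpace X ∧ QuasiSeparatedSpace X ∧
  ∀ x : X, ∃ (m : ℕ), 0 < m ∧ ∃ (N : LineBundle X), IsTensorPow L m N ∧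
    ∃ (s : X ⟶ N.tot), s ≫ N.π = 𝟙 X ∧
      ∃ U : X.Opens, IsAffineOpen U ∧ x ∈ U ∧
        (U : Set X) = {y : X | s.base y ≠ N.zero.base y}
/-! ### Properties of schemes and group schemes over `k` -/

/-- An algebraic group over `k` is a group scheme of finite type over `k`. -/
def GroupSchemeOver.IsAlgebraic {k : Type u} [Field k] (G : GroupSchemeOver k) : Prop :=
  LocallyOfFiniteType G.str ∧ QuasiCompact G.str

/-- A scheme of finite type over `k`. -/
def SchemeOver.IsFiniteType {k : Type u} [Field k] (X : SchemeOver k) : Prop :=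
  LocallyOfFiniteType X.str ∧ QuasiCompact X.str

/-- A variety over `k`: an integral separated scheme of finite type over `k`. -/
def SchemeOver.IsVariety {k : Type u} [Field k] (X : SchemeOver k) : Prop :=
  IsIntegral X.carrier ∧ AlgebraicGeometry.IsSeparated X.str ∧ X.IsFiniteType

/-- A scheme is normal if all its local rings are integrally closed domains. -/
def IsNormalScheme (X : Scheme.{u}) : Prop :=
  ∀ x : X, IsDomain (X.presheaf.stalk x) ∧ IsIntegrallyClosed (X.presheaf.stalk x)

/-- The base change of a scheme over `k` to the algebraic closure of `k`. -/
def SchemeOver.geomFiber {k : Type u} [Field k] (X : SchemeOver k) : Scheme.{u} :=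
  pullback X.str (Spec.map (CommRingCat.ofHom (algebraMap k (AlgebraicClosure k))))

/-- A scheme over `k` is geometrically integral if its base change to an algebraic
closure of `k` is integral. -/
def SchemeOver.IsGeomIntegral {k : Type u} [Field k] (X : SchemeOver k) : Prop :=
  IsIntegral X.geomFiber

/-- A scheme over `k` is geometrically connected if its base change to an algebraic
closure of `k` is connected. -/
def SchemeOver.IsGeomConnected {k : Type u} [Field k] (X : SchemeOver k) : Prop :=
  ConnectedSpace X.geomFiber

/-- A scheme over `k` is geometrically irreducible if its base change to an algebraic
closure of `k` is irreducible. -/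
def SchemeOver.IsGeomIrreducible {k : Type u} [Field k] (X : SchemeOver k) : Prop :=
  IrreducibleSpace X.geomFiber

/-- An open subscheme of a scheme over `k`, as a scheme over `k`. -/
def SchemeOver.ofOpens {k : Type u} [Field k] (X : SchemeOver k) (U : X.carrier.Opens) :
    SchemeOver k :=
  ⟨U.toScheme, U.ι ≫ X.str⟩

/-- A scheme over `k` is quasi-projective if it is separated, of finite type, and carries
an ample line bundle. -/
def SchemeOver.IsQuasiProjective {k : Type u} [Field k] (X : SchemeOver k) : Prop :=
  AlgebraicGeometry.IsSeparated X.str ∧ X.IsFiniteType ∧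
    ∃ L : LineBundle X.carrier, IsAmple L

/-- An open subset of `X` is stable under an action of `G` if the action preserves its
`T`-points, for all `T`. -/
def ActionOver.Stable {k : Type u} [Field k] {G : GroupSchemeOver k} {X : SchemeOver k}
    (α : ActionOver G X) (U : X.carrier.Opens) : Prop :=
  ∀ {T : Scheme.{u}} (g : T ⟶ G.carrier) (x : T ⟶ X.carrier) (h),
    Set.range x.base ⊆ (U : Set X.carrier) →
      Set.range (α.act g x h).base ⊆ (U : Set X.carrier)

/-- A `G`-linearization of a vector bundle `E` on a `G`-scheme `X`: an action of `G` on the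
total space of `E`, lifting the action on `X` and acting linearly on the fibers (equivalently,
an action of `G × 𝔾ₘ` on `E` for which the projection is equivariant and `𝔾ₘ` acts by
multiplication on the fibers). -/
structure LinearizationData {k : Type u} [Field k] {G : GroupSchemeOver k} {X : SchemeOver k}
    (α : ActionOver G X) {n : ℕ} (E : VecBundle n X.carrier) where
  lact : ∀ {T : Scheme.{u}} (g : T ⟶ G.carrier) (e : T ⟶ E.tot),
    g ≫ G.str = (e ≫ E.π) ≫ X.str → (T ⟶ E.tot)
  lact_π : ∀ {T : Scheme.{u}} (g : T ⟶ G.carrier) (e : T ⟶ E.tot) (h h'),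
    lact g e h ≫ E.π = α.act g (e ≫ E.π) h'
  lact_natural : ∀ {T' T : Scheme.{u}} (f : T' ⟶ T) (g : T ⟶ G.carrier) (e : T ⟶ E.tot) (h h'),
    f ≫ lact g e h = lact (f ≫ g) (f ≫ e) h'
  one_lact : ∀ {T : Scheme.{u}} (e : T ⟶ E.tot) (h), lact (((e ≫ E.π) ≫ X.str) ≫ G.one) e h = e
  mul_lact : ∀ {T : Scheme.{u}} (g g' : T ⟶ G.carrier) (e : T ⟶ E.tot) (h₁ h₂ h₃ h₄),
    lact (G.mul g g' h₁) e h₂ = lact g (lact g' e h₃) h₄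
  lact_add : ∀ {T : Scheme.{u}} (g : T ⟶ G.carrier) (a b : T ⟶ E.tot) (h₁ h₂ h₃ h₄ h₅),
    lact g (E.add a b h₁) h₂ = E.add (lact g a h₃) (lact g b h₄) h₅
  lact_smul : ∀ {T : Scheme.{u}} (g : T ⟶ G.carrier) (f : Γ(T, ⊤)) (a : T ⟶ E.tot) (h₁ h₂),
    lact g (E.smul f a) h₁ = E.smul f (lact g a h₂)

/-- A vector bundle is `G`-linearized (linearizable) if it admits a linearization. -/
def ActionOver.IsLinearized {k : Type u} [Field k] {G : GroupSchemeOver k} {X : SchemeOver k}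
    (α : ActionOver G X) {n : ℕ} (E : VecBundle n X.carrier) : Prop :=
  Nonempty (LinearizationData α E)

/-- Equivariance of a morphism relative to a homomorphism of group schemes. -/
def IsEquivariantRel {k : Type u} [Field k] {G H : GroupSchemeOver k} {X Y : SchemeOver k}
    (φ : GroupHom G H) (α : ActionOver G X) (β : ActionOver H Y)
    (f : X.carrier ⟶ Y.carrier) : Prop :=
  f ≫ Y.str = X.str ∧
  ∀ {T : Scheme.{u}} (g : T ⟶ G.carrier) (x : T ⟶ X.carrier) (h h'),
    α.act g x h ≫ f = β.act (g ≫ φ.hom) (x ≫ f) h'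

/-- Equivariance of a morphism of `G`-schemes. -/
def IsEquivariant {k : Type u} [Field k] {G : GroupSchemeOver k} {X Y : SchemeOver k}
    (α : ActionOver G X) (β : ActionOver G Y) (f : X.carrier ⟶ Y.carrier) : Prop :=
  f ≫ Y.str = X.str ∧
  ∀ {T : Scheme.{u}} (g : T ⟶ G.carrier) (x : T ⟶ X.carrier) (h h'),
    α.act g x h ≫ f = β.act g (x ≫ f) h'

/-- A `T`-point of `G` acts trivially if it acts trivially on all points of `X` over `T`. -/
def ActionOver.ActsTrivially {k : Type u} [Field k] {G : GroupSchemeOver k}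
    {X : SchemeOver k} (α : ActionOver G X) {T : Scheme.{u}} (g : T ⟶ G.carrier) : Prop :=
  ∀ {T' : Scheme.{u}} (t : T' ⟶ T) (x : T' ⟶ X.carrier) (h), α.act (t ≫ g) x h = x

/-- An action is almost faithful if its kernel is finite, i.e. all trivially acting points
factor through a fixed closed subscheme of `G` which is finite over `k`. -/
def ActionOver.IsAlmostFaithful {k : Type u} [Field k] {G : GroupSchemeOver k}
    {X : SchemeOver k} (α : ActionOver G X) : Prop :=
  ∃ (K : Scheme.{u}) (ι : K ⟶ G.carrier), IsClosedImmersion ι ∧ IsFinite (ι ≫ G.str) ∧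
    ∀ {T : Scheme.{u}} (g : T ⟶ G.carrier), α.ActsTrivially g → ∃ g' : T ⟶ K, g' ≫ ι = g

/-- An abelian variety over `k` is a smooth connected proper algebraic group over `k`. -/
def GroupSchemeOver.IsAbelianVariety {k : Type u} [Field k] (G : GroupSchemeOver k) : Prop :=
  G.IsAlgebraic ∧ IsSmooth G.str ∧ ConnectedSpace G.carrier ∧ IsProper G.str

/-- `q : G ⟶ Q` is the quotient of `G` by the subgroup scheme `H` (embedded via the
homomorphism `ι`): it is surjective, over `k`, and identifies exactly the right
`H`-cosets. -/
def IsCosetQuotient {k : Type u} [Field k] (G H : GroupSchemeOver k) (ι : GroupHom H G)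
    (Q : SchemeOver k) (q : G.carrier ⟶ Q.carrier) : Prop :=
  q ≫ Q.str = G.str ∧ AlgebraicGeometry.Surjective q ∧
  ∀ {T : Scheme.{u}} (g g' : T ⟶ G.carrier), g ≫ G.str = g' ≫ G.str →
    (g ≫ q = g' ≫ q ↔ ∃ (h : T ⟶ H.carrier) (hh : g ≫ G.str = (h ≫ ι.hom) ≫ G.str),
      G.mul g (h ≫ ι.hom) hh = g')

end

set_option linter.all false

section
open TensorProduct

section FlatArt

theorem sup_pow_smul_top {A M : Type*} [CommRing A] [AddCommGroup M] [Module A M] (I : Ideal A)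
    (N : Submodule A M) (h : N ⊔ I • ⊤ = ⊤) (n : ℕ) : N ⊔ I ^ n • (⊤ : Submodule A M) = ⊤ := by
  induction n with
  | zero => simp
  | succ n ih =>
    apply le_antisymm le_top
    calc (⊤ : Submodule A M) = N ⊔ I ^ n • (⊤ : Submodule A M) := ih.symm
      _ = N ⊔ I ^ n • (N ⊔ I • (⊤ : Submodule A M)) := by rw [h]
      _ ≤ N ⊔ I ^ (n+1) • (⊤ : Submodule A M) := by
        rw [Submodule.smul_sup, ← mul_smul, ← pow_succ]
        refine sup_le le_sup_left (sup_le (Submodule.smul_le_right.trans le_sup_left) le_sup_right)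

theorem eq_bot_of_smul_nilp {A M : Type*} [CommRing A] [AddCommGroup M] [Module A M] (I : Ideal A)
    (hI : IsNilpotent I) (K : Submodule A M) (h : K ≤ I • K) : K = ⊥ := by
  obtain ⟨n, hn⟩ := hI
  have : ∀ n, K ≤ I ^ n • K := by
    intro n
    induction n with
    | zero => simp
    | succ n ih =>
      refine h.trans ((Submodule.smul_mono le_rfl ih).trans ?_)
      rw [← mul_smul, pow_succ']
  have := this n
  rw [hn] at this
  simpa using this

theorem free_of_flat_injective {A S M : Type*} [CommRing A] [CommRing S] [Algebra A S]
    [AddCommGroup M] [Module A M] [IsLocalRing A]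
    (hm : IsNilpotent (IsLocalRing.maximalIdeal A))
    (hinj : Function.Injective (algebraMap A S)) [Module.Flat S (S ⊗[A] M)] :
    Module.Free A M := by
  classical
  set m := IsLocalRing.maximalIdeal A with hmdef
  let _ : Field (A ⧸ m) := Ideal.Quotient.field m
  obtain ⟨ι, ⟨b⟩⟩ : ∃ ι : Type _, Nonempty (Module.Basis ι (A ⧸ m) (M ⧸ (m • ⊤ : Submodule A M))) :=
    ⟨_, ⟨Module.Basis.ofVectorSpace (A ⧸ m) (M ⧸ (m • ⊤ : Submodule A M))⟩⟩
  choose e he using fun i => Submodule.Quotient.mk_surjective (m • ⊤ : Submodule A M) (b i)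
  have hspan : Submodule.span A (Set.range e) = ⊤ := by
    obtain ⟨n, hn⟩ := hm
    have h1 : Submodule.span A (Set.range e) ⊔ m • ⊤ = ⊤ := by
      rw [sup_comm, ← Submodule.map_mkQ_eq_top, Submodule.map_span, ← Set.range_comp]
      have : (m • ⊤ : Submodule A M).mkQ ∘ e = b := by
        ext i; exact he i
      rw [this]
      have h3 := b.span_eq
      apply_fun Submodule.restrictScalars A at h3
      rw [Submodule.restrictScalars_span _ _ Ideal.Quotient.mk_surjective] at h3
      simpa using h3
    have := sup_pow_smul_top m _ h1 n
    rw [hn] at this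
    simpa using this
  let p : (ι →₀ S) →ₗ[S] S ⊗[A] M := Finsupp.linearCombination S (fun i => (1 : S) ⊗ₜ[A] e i)
  have hp : Function.Surjective p := by
    rw [← LinearMap.range_eq_top]
    apply top_le_iff.1
    rintro x -
    induction x with
    | zero => exact zero_mem _
    | add x y hx hy => exact add_mem hx hy
    | tmul s y =>
      have : y ∈ Submodule.span A (Set.range e) := by rw [hspan]; trivial
      have h1 : (1 : S) ⊗ₜ[A] y ∈ LinearMap.range p := by
        induction this using Submodule.span_induction with
        | mem y hy =>
          obtain ⟨i, rfl⟩ := hy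
          exact ⟨Finsupp.single i 1, by simp [p]⟩
        | zero => simp
        | add y z _ _ hy hz => rw [tmul_add]; exact add_mem hy hz
        | smul a y _ hy =>
          have : (1 : S) ⊗ₜ[A] (a • y) = algebraMap A S a • ((1 : S) ⊗ₜ[A] y) := by
            rw [tmul_smul, algebraMap_smul]
          rw [this]; exact Submodule.smul_mem _ _ hy
      have : s ⊗ₜ[A] y = s • ((1 : S) ⊗ₜ[A] y) := by simp [smul_tmul']
      rw [this]; exact Submodule.smul_mem _ _ h1
  let I := m.map (algebraMap A S)
  have hI : IsNilpotent I := by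
    obtain ⟨n, hn⟩ := hm
    exact ⟨n, by rw [← Ideal.map_pow, hn]; simp⟩
  let K := LinearMap.ker p
  have hKI : ∀ x ∈ K, ∀ i, x i ∈ I := by
    intro x hx i
    -- functional
    let l0 : (A ⧸ m) →ₗ[A] (S ⧸ I) := (Ideal.quotientMapₐ I (Algebra.ofId A S) (by
        intro a ha; exact Ideal.mem_map_of_mem _ ha)).toLinearMap
    let l : M →ₗ[A] (S ⧸ I) := l0 ∘ₗ ((b.coord i).restrictScalars A) ∘ₗ (m • ⊤ : Submodule A M).mkQ
    have hl : ∀ j, l (e j) = if j = i then 1 else 0 := by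
      intro j
      have : l (e j) = l0 (b.coord i (b j)) := by
        rw [← he j]; rfl
      rw [this]
      simp only [Module.Basis.coord_apply, Module.Basis.repr_self, Finsupp.single_apply]
      split_ifs
      · exact map_one (Ideal.quotientMapₐ (I := m) I (Algebra.ofId A S) (by
          intro a ha; exact Ideal.mem_map_of_mem _ ha))
      · simp
    let L : S ⊗[A] M →ₗ[S] (S ⧸ I) := AlgebraTensorModule.lift
      (LinearMap.mk₂' S A (fun s y => s • l y) (by intros; simp only [add_smul])
          (by intros; simp only [smul_eq_mul, mul_smul]) (by intros; simp only [map_add, smul_add])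
          (by intros a s y; rw [map_smul, smul_comm]))
    have hx0 : L (p x) = 0 := by rw [LinearMap.mem_ker.1 hx, map_zero]
    simp only [p, Finsupp.linearCombination_apply, Finsupp.sum, map_sum, map_smul] at hx0
    have h1 : ∀ j, L ((1 : S) ⊗ₜ e j) = if j = i then 1 else 0 := by
      intro j; simp [L, hl]
    simp only [h1] at hx0
    simp only [smul_ite, smul_zero, Finset.sum_ite_eq', Finsupp.mem_support_iff] at hx0
    by_cases hxi : x i = 0
    · rw [hxi]; exact zero_mem _
    · rw [if_pos hxi] at hx0
      rw [← Ideal.Quotient.eq_zero_iff_mem]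
      simpa [Algebra.smul_def] using hx0
  have hK : K = ⊥ := by
    apply eq_bot_of_smul_nilp I hI
    intro x hx
    have hinj2 := LinearMap.lTensor_injective_of_exact_of_flat (M := K) (N := ι →₀ S) p hp K.subtype
      K.injective_subtype (by intro y; simp [K]) (S ⧸ I)
    have hxIF : x ∈ I • (⊤ : Submodule S (ι →₀ S)) := by
      rw [← Finsupp.sum_single x]
      refine Submodule.sum_mem _ fun i _ => ?_
      have : Finsupp.single i (x i) = x i • Finsupp.single i (1 : S) := by simp
      rw [this]
      exact Submodule.smul_mem_smul (hKI x hx i) trivial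
    have h0 : (Ideal.Quotient.mk I 1) ⊗ₜ[S] x = 0 := by
      apply (quotTensorEquivQuotSMul (ι →₀ S) I).injective
      rw [quotTensorEquivQuotSMul_mk_tmul, map_zero, one_smul]
      exact (Submodule.Quotient.mk_eq_zero _).2 hxIF
    have h2 : (Ideal.Quotient.mk I 1) ⊗ₜ[S] (⟨x, hx⟩ : K) = 0 := by
      apply hinj2
      rw [map_zero]; exact h0
    have h3 := congrArg (quotTensorEquivQuotSMul K I) h2
    rw [quotTensorEquivQuotSMul_mk_tmul, map_zero, one_smul] at h3
    have h4 := (Submodule.Quotient.mk_eq_zero _).1 h3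
    have h5 := Submodule.mem_map_of_mem (f := K.subtype) h4
    rw [Submodule.map_smul''] at h5
    simpa using h5
  have hli : LinearIndependent A e := by
    rw [linearIndependent_iff]
    intro l hl
    have : p (l.mapRange (algebraMap A S) (map_zero _)) = 0 := by
      have h1 : p (l.mapRange (algebraMap A S) (map_zero _)) = (1 : S) ⊗ₜ (Finsupp.linearCombination A e l) := by
        simp only [p, Finsupp.linearCombination_apply]
        rw [Finsupp.sum_mapRange_index (by simp)]
        simp only [Finsupp.sum, tmul_sum, tmul_smul, algebraMap_smul]
      rw [h1, hl, tmul_zero]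
    have h2 : l.mapRange (algebraMap A S) (map_zero _) ∈ K := this
    rw [hK] at h2
    ext i
    have h3 := congrArg (fun f : ι →₀ S => f i) ((Submodule.mem_bot S).1 h2)
    simp only [Finsupp.mapRange_apply] at h3
    exact hinj (by simpa using h3)
  exact Module.Free.of_basis (Module.Basis.mk hli hspan.ge)

attribute [local instance] Algebra.TensorProduct.rightAlgebra in
theorem flat_of_flat_injective {A S M : Type*} [CommRing A] [CommRing S] [Algebra A S]
    [AddCommGroup M] [Module A M] [IsArtinianRing A]
    (hinj : Function.Injective (algebraMap A S)) [Module.Flat S (S ⊗[A] M)] :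
    Module.Flat A M := by
  apply Module.flat_of_isLocalized_maximal A M (fun P _ => Localization.AtPrime P ⊗[A] M)
    (fun P _ => (TensorProduct.mk A (Localization.AtPrime P) M 1))
  intro P _
  let B := Localization.AtPrime P
  let S' := S ⊗[A] B
  have : Module.Flat A B := IsLocalization.flat _ P.primeCompl
  have hnil : IsNilpotent (IsLocalRing.maximalIdeal B) := by
    rw [← IsLocalRing.jacobson_eq_maximalIdeal ⊥ bot_ne_top]
    exact IsArtinianRing.isNilpotent_jacobson_bot
  have hi : Function.Injective (algebraMap B S') := by
    have h := Module.Flat.rTensor_preserves_injective_linearMap (M := B) (Algebra.linearMap A S) hinj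
    have h2 := h.comp (TensorProduct.lid A B).symm.injective
    convert h2 using 1
    ext x; simp [S']; rfl
  have hfl : Module.Flat S' (S' ⊗[B] (B ⊗[A] M)) := by
    have e1 := TensorProduct.AlgebraTensorModule.cancelBaseChange A B S' S' M
    have e2 := TensorProduct.AlgebraTensorModule.cancelBaseChange A S S' S' M
    have : Module.Flat S' (S' ⊗[S] (S ⊗[A] M)) := inferInstance
    exact Module.Flat.of_linearEquiv (e1.trans e2.symm)
  have := free_of_flat_injective (A := B) (S := S') (M := B ⊗[A] M) hnil hi
  exact Module.Flat.trans A B (B ⊗[A] M)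
end FlatArt
end

section
open TensorProduct

section LemmaD
variable {A S : Type u} [CommRing A] [CommRing S] [Algebra A S]

/-- evaluation of `θ` at a pair of points -/
def thetaEv (θ : S ⊗[A] S) {B : Type u} [CommRing B] [Algebra A B] (z₁ z₂ : S →ₐ[A] B) : B :=
  Algebra.TensorProduct.lift z₁ z₂ (fun _ _ => Commute.all _ _) θ

/-- A (normalized) multiplicative 1-cocycle. -/
structure IsThetaCocycle (θ : S ⊗[A] S) : Prop where
  one : thetaEv θ (AlgHom.id A S) (AlgHom.id A S) = 1
  mul : ∀ {B : Type u} [CommRing B] [Algebra A B] (z₁ z₂ z₃ : S →ₐ[A] B),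
    thetaEv θ z₁ z₂ * thetaEv θ z₂ z₃ = thetaEv θ z₁ z₃

/-- functions with `f(z₁) = θ(z₁,z₂) f(z₂)` -/
def thetaDelta (θ : S ⊗[A] S) : S →ₗ[A] S ⊗[A] S :=
  Algebra.TensorProduct.includeLeft.toLinearMap -
    (LinearMap.mulLeft A θ) ∘ₗ Algebra.TensorProduct.includeRight.toLinearMap

theorem mem_ker_thetaDelta (θ : S ⊗[A] S) (f : S) :
    f ∈ LinearMap.ker (thetaDelta θ) ↔ f ⊗ₜ[A] 1 = θ * (1 ⊗ₜ[A] f) := by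
  simp [thetaDelta, sub_eq_zero]

theorem thetaEv_ext_comp (θ : S ⊗[A] S) {B C : Type u} [CommRing B] [Algebra A B] [CommRing C]
    [Algebra A C] (z₁ z₂ : S →ₐ[A] B) (φ : B →ₐ[A] C) :
    φ (thetaEv θ z₁ z₂) = thetaEv θ (φ.comp z₁) (φ.comp z₂) := by
  unfold thetaEv
  have : (φ.comp (Algebra.TensorProduct.lift z₁ z₂ (fun _ _ => Commute.all _ _))) =
    Algebra.TensorProduct.lift (φ.comp z₁) (φ.comp z₂) (fun _ _ => Commute.all _ _) := by
    ext <;> simp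
  exact DFunLike.congr_fun this θ

theorem span_ker_thetaDelta [Module.Flat A S] (θ : S ⊗[A] S) (hθ : IsThetaCocycle θ) :
    Ideal.span ((LinearMap.ker (thetaDelta θ) : Submodule A S) : Set S) = ⊤ := by
  let B := (S ⊗[A] S) ⊗[A] S
  let z₁ : S →ₐ[A] B := Algebra.TensorProduct.includeLeft.comp Algebra.TensorProduct.includeLeft
  let z₂ : S →ₐ[A] B := Algebra.TensorProduct.includeLeft.comp Algebra.TensorProduct.includeRight
  let z₃ : S →ₐ[A] B := Algebra.TensorProduct.includeRight
  have key : LinearMap.rTensor S (thetaDelta θ) θ = 0 := by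
    have h : ∀ x : S ⊗[A] S, LinearMap.rTensor S (thetaDelta θ) x =
        thetaEv x z₁ z₃ - thetaEv θ z₁ z₂ * thetaEv x z₂ z₃ := by
      have h12 : thetaEv θ z₁ z₂ = θ ⊗ₜ[A] 1 := by
        have := thetaEv_ext_comp θ Algebra.TensorProduct.includeLeft
          Algebra.TensorProduct.includeRight (Algebra.TensorProduct.includeLeft : S ⊗[A] S →ₐ[A] B)
        rw [← this]
        have h2 : thetaEv θ Algebra.TensorProduct.includeLeft
          Algebra.TensorProduct.includeRight = θ := by
          unfold thetaEv
          have : Algebra.TensorProduct.lift (Algebra.TensorProduct.includeLeft : S →ₐ[A] S ⊗[A] S)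
            Algebra.TensorProduct.includeRight (fun _ _ => Commute.all _ _) = AlgHom.id A _ := by
            ext <;> simp
          exact DFunLike.congr_fun this θ
        rw [h2]; rfl
      intro x
      rw [h12]
      induction x with
      | zero => simp [thetaEv]
      | add x y hx hy =>
        rw [map_add, hx, hy]
        simp only [thetaEv, map_add]; ring
      | tmul a b =>
        have e1 : thetaEv (a ⊗ₜ[A] b) z₁ z₃ = (a ⊗ₜ[A] (1:S)) ⊗ₜ[A] b := by
          have : thetaEv (a ⊗ₜ[A] b) z₁ z₃ = ((a ⊗ₜ[A] (1:S)) ⊗ₜ[A] (1:S)) *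
            (((1:S) ⊗ₜ[A] (1:S)) ⊗ₜ[A] b) := Algebra.TensorProduct.lift_tmul _ _ _ _ _
          rw [this]; simp
        have e2 : thetaEv (a ⊗ₜ[A] b) z₂ z₃ = ((1:S) ⊗ₜ[A] a) ⊗ₜ[A] b := by
          have : thetaEv (a ⊗ₜ[A] b) z₂ z₃ = (((1:S) ⊗ₜ[A] a) ⊗ₜ[A] (1:S)) *
            (((1:S) ⊗ₜ[A] (1:S)) ⊗ₜ[A] b) := Algebra.TensorProduct.lift_tmul _ _ _ _ _
          rw [this]; simp
        rw [e1, e2]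
        have e3 : (θ ⊗ₜ[A] (1:S)) * (((1:S) ⊗ₜ[A] a) ⊗ₜ[A] b) =
            (θ * ((1:S) ⊗ₜ[A] a)) ⊗ₜ[A] b := by
          rw [Algebra.TensorProduct.tmul_mul_tmul, one_mul]
        refine Eq.trans ?_ (congrArg _ e3.symm)
        simp [thetaDelta, sub_tmul]
    rw [h, hθ.mul, sub_self]
  have hex : Function.Exact (LinearMap.rTensor S (LinearMap.ker (thetaDelta θ)).subtype)
      (LinearMap.rTensor S (thetaDelta θ)) :=
    Module.Flat.rTensor_exact S (LinearMap.exact_subtype_ker_map _)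
  obtain ⟨x, hx⟩ := (hex θ).1 key
  have h1 := hθ.one
  rw [← hx] at h1
  rw [Ideal.eq_top_iff_one, ← h1]
  clear hx h1
  induction x with
  | zero => simp [thetaEv]
  | add x y hx hy =>
    rw [map_add]
    have : ∀ a b : S ⊗[A] S, thetaEv (a + b) (AlgHom.id A S) (AlgHom.id A S) =
      thetaEv a (AlgHom.id A S) (AlgHom.id A S) + thetaEv b (AlgHom.id A S) (AlgHom.id A S) := by
      intros; simp [thetaEv]
    rw [this]; exact add_mem hx hy
  | tmul p b =>
    simp only [LinearMap.rTensor_tmul, thetaEv, Algebra.TensorProduct.lift_tmul,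
      Submodule.subtype_apply, AlgHom.id_apply]
    exact Ideal.mul_mem_right _ _ (Ideal.subset_span p.2)

theorem exists_alpha {R A : Type u} [CommRing R] [CommRing A] [Algebra R A] [Module.Finite R A]
    (p : Ideal R) [p.IsPrime] :
    ∃ (s : Finset (Ideal A)) (α : Ideal A → A), (∀ q, q ∈ s ↔ (q.IsPrime ∧ q.comap (algebraMap R A) = p)) ∧
      ∀ q ∈ s, α q ∉ q ∧ ∀ q' ∈ s, q' ≠ q → α q ∈ q' := by
  classical
  have hfin : (p.primesOver A).Finite := Algebra.QuasiFinite.finite_primesOver p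
  have hs : ∀ q, q ∈ hfin.toFinset ↔ (q.IsPrime ∧ q.comap (algebraMap R A) = p) := by
    intro q
    rw [Set.Finite.mem_toFinset]
    constructor
    · rintro ⟨h1, h2⟩; exact ⟨h1, h2.over.symm⟩
    · rintro ⟨h1, h2⟩; exact ⟨h1, ⟨h2.symm⟩⟩
  have : ∀ q ∈ hfin.toFinset, ∃ a : A, a ∉ q ∧ ∀ q' ∈ hfin.toFinset, q' ≠ q → a ∈ q' := by
    intro q hq
    have hqp := ((hs q).1 hq).1
    by_contra! hcon
    have hle : (hfin.toFinset.erase q).inf id ≤ q := by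
      intro a ha
      by_contra haq
      obtain ⟨q', hq', hne, h⟩ := hcon a haq
      exact h ((Finset.inf_le (f := id) (Finset.mem_erase.2 ⟨hne, hq'⟩)) ha)
    obtain ⟨q', hq', hle'⟩ := (Ideal.IsPrime.inf_le' hqp).1 hle
    replace hle' : q' ≤ q := hle'
    obtain ⟨hne, hmem⟩ := Finset.mem_erase.1 hq'
    have := ((hs q').1 hmem).1
    have hlt := Ideal.IsIntegral.comap_lt_comap (R := R) (lt_of_le_of_ne hle' hne)
    rw [((hs q').1 hmem).2, ((hs q).1 hq).2] at hlt
    exact lt_irrefl _ hlt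
  choose! α hα using this
  exact ⟨hfin.toFinset, α, hs, hα⟩

theorem lemmaD {R A S : Type u} [CommRing R] [CommRing A] [CommRing S] [Algebra R A] [Algebra A S]
    [Module.Finite R A] [Module.FaithfullyFlat A S] (θ : S ⊗[A] S) (hθ : IsThetaCocycle θ)
    (p : Ideal R) [p.IsPrime] :
    ∃ (f : S) (r : R) (s : S), r ∉ p ∧ f * s = algebraMap A S (algebraMap R A r) ∧
      f ⊗ₜ[A] 1 = θ * (1 ⊗ₜ[A] f) := by
  classical
  -- inverse cocycle
  have hu : IsUnit θ := by
    have h := hθ.mul (Algebra.TensorProduct.includeLeft : S →ₐ[A] S ⊗[A] S)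
      Algebra.TensorProduct.includeRight Algebra.TensorProduct.includeLeft
    have h2 : thetaEv θ Algebra.TensorProduct.includeLeft
          Algebra.TensorProduct.includeRight = θ := by
      unfold thetaEv
      have : Algebra.TensorProduct.lift (Algebra.TensorProduct.includeLeft : S →ₐ[A] S ⊗[A] S)
        Algebra.TensorProduct.includeRight (fun _ _ => Commute.all _ _) = AlgHom.id A _ := by
        ext <;> simp
      exact DFunLike.congr_fun this θ
    have h3 := thetaEv_ext_comp θ (AlgHom.id A S) (AlgHom.id A S)
      (Algebra.TensorProduct.includeLeft : S →ₐ[A] S ⊗[A] S)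
    rw [hθ.one, map_one] at h3
    simp only [AlgHom.comp_id] at h3
    rw [h2, ← h3] at h
    exact .of_mul_eq_one _ h
  obtain ⟨θu, hθu⟩ := hu
  set θ' : S ⊗[A] S := ((θu⁻¹ : (S ⊗[A] S)ˣ) : S ⊗[A] S) with hθ'
  have hinv : θ * θ' = 1 := by rw [← hθu]; simp [θ']
  have hev : ∀ {B : Type u} [CommRing B] [Algebra A B] (z₁ z₂ : S →ₐ[A] B),
      thetaEv θ z₁ z₂ * thetaEv θ' z₁ z₂ = 1 := by
    intro B _ _ z₁ z₂
    simp only [thetaEv]; rw [← map_mul, hinv, map_one]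
  have hc' : IsThetaCocycle θ' := by
    constructor
    · have := hev (AlgHom.id A S) (AlgHom.id A S)
      rwa [hθ.one, one_mul] at this
    · intro B _ _ z₁ z₂ z₃
      have h12 := hev z₁ z₂
      have h23 := hev z₂ z₃
      have h13 := hev z₁ z₃
      rw [← hθ.mul z₁ z₂ z₃] at h13
      linear_combination (thetaEv θ' z₁ z₂ * thetaEv θ' z₂ z₃) * (- h13) +
        (thetaEv θ z₂ z₃ * thetaEv θ' z₂ z₃ * thetaEv θ' z₁ z₃) * h12 + thetaEv θ' z₁ z₃ * h23
  set P := LinearMap.ker (thetaDelta θ)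
  set P' := LinearMap.ker (thetaDelta θ')
  have hP := span_ker_thetaDelta θ hθ
  have hP' := span_ker_thetaDelta θ' hc'
  -- products lie in A
  have hprod : ∀ f ∈ P, ∀ n ∈ P', ∃ a : A, algebraMap A S a = f * n := by
    intro f hf n hn
    have hf' := (mem_ker_thetaDelta θ f).1 hf
    have hn' := (mem_ker_thetaDelta θ' n).1 hn
    have heff := Algebra.IsEffective.of_faithfullyFlat A S
    refine (heff (f * n)).1 ?_
    rw [Algebra.TensorProduct.includeLeftSubRight_apply, sub_eq_zero]
    have e1 : (f * n) ⊗ₜ[A] (1 : S) = (f ⊗ₜ[A] (1:S)) * (n ⊗ₜ[A] (1:S)) := by simp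
    have e2 : (1 : S) ⊗ₜ[A] (f * n) = ((1:S) ⊗ₜ[A] f) * ((1:S) ⊗ₜ[A] n) := by simp
    rw [e1, e2, hf', hn']
    linear_combination (((1:S) ⊗ₜ[A] f) * ((1:S) ⊗ₜ[A] n)) * hinv
  obtain ⟨s, α, hs, hα⟩ := exists_alpha (A := A) p
  -- local choice
  have hloc : ∀ q ∈ s, ∃ f ∈ P, ∃ n ∈ P', ∃ a : A, algebraMap A S a = f * n ∧ a ∉ q := by
    intro q hq
    by_contra! hcon
    have hqp := ((hs q).1 hq).1
    have hmul : (Ideal.span (P : Set S)) * (Ideal.span (P' : Set S)) ≤ q.map (algebraMap A S) := by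
      rw [Ideal.span_mul_span, Ideal.span_le]
      rintro x hx
      obtain ⟨f, hf, n, hn, rfl⟩ := Set.mem_mul.1 hx
      obtain ⟨a, ha⟩ := hprod f hf n hn
      change f * n ∈ _
      rw [← ha]
      exact Ideal.mem_map_of_mem _ (hcon f hf n hn a ha)
    rw [hP, hP', Ideal.top_mul] at hmul
    have h1 := Ideal.comap_map_eq_self_of_faithfullyFlat (B := S) q
    rw [top_le_iff.1 hmul, Ideal.comap_top] at h1
    exact hqp.ne_top h1.symm
  choose! F hF N hN a ha haq using hloc
  let f := ∑ q ∈ s, α q • F q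
  have hfP : f ∈ P := Submodule.sum_mem _ fun q hq => Submodule.smul_mem _ _ (hF q hq)
  let J : Ideal A :=
    { carrier := {x | ∃ n ∈ P', algebraMap A S x = f * n}
      zero_mem' := ⟨0, zero_mem _, by simp⟩
      add_mem' := by
        rintro x y ⟨n, hn, hx⟩ ⟨n', hn', hy⟩
        exact ⟨n + n', add_mem hn hn', by rw [map_add, hx, hy]; ring⟩
      smul_mem' := by
        rintro c x ⟨n, hn, hx⟩
        exact ⟨c • n, Submodule.smul_mem _ _ hn, by
          rw [smul_eq_mul, map_mul, hx, Algebra.smul_def]; ring⟩ }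
  have hJ : ¬ J.comap (algebraMap R A) ≤ p := by
    intro hle
    obtain ⟨q, hJq, hqp, hqc⟩ := Ideal.exists_ideal_over_prime_of_isIntegral p J hle
    have hq : q ∈ s := (hs q).2 ⟨hqp, hqc⟩
    have hb : ∀ q' ∈ s, ∃ b : A, algebraMap A S b = F q' * N q := fun q' hq' =>
      hprod _ (hF q' hq') _ (hN q hq)
    choose! b hb using hb
    have hx : (∑ q' ∈ s, α q' * b q') ∈ J := by
      refine ⟨N q, hN q hq, ?_⟩
      rw [map_sum, Finset.sum_mul]
      refine Finset.sum_congr rfl fun q' hq' => ?_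
      rw [map_mul, hb q' hq', Algebra.smul_def]; ring
    have hx2 := hJq hx
    rw [← Finset.add_sum_erase _ _ hq] at hx2
    have hx3 : (∑ q' ∈ s.erase q, α q' * b q') ∈ q := by
      refine Submodule.sum_mem _ fun q' hq' => ?_
      obtain ⟨hne, hmem⟩ := Finset.mem_erase.1 hq'
      exact Ideal.mul_mem_right _ _ ((hα q' hmem).2 q hq hne.symm)
    have hx4 := (Submodule.add_mem_iff_left _ hx3).1 hx2
    rcases hqp.mem_or_mem hx4 with h | h
    · exact (hα q hq).1 h
    · have : b q = a q := by
        apply FaithfulSMul.algebraMap_injective A S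
        rw [hb q hq, ha q hq]
      exact haq q hq (this ▸ h)
  obtain ⟨r, hr, hrp⟩ := Set.not_subset.1 hJ
  obtain ⟨n, hn, h⟩ := hr
  exact ⟨f, r, n, hrp, h.symm, (mem_ker_thetaDelta θ f).1 hfP⟩
end LemmaD
end

section
open TensorProduct

noncomputable section DetDev

theorem det_of_exact {R N₁ N₂ N₃ : Type u} [CommRing R] [AddCommGroup N₁] [Module R N₁]
    [AddCommGroup N₂] [Module R N₂] [AddCommGroup N₃] [Module R N₃]
    [Module.Free R N₁] [Module.Finite R N₁] [Module.Free R N₃] [Module.Finite R N₃]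
    [Module.Free R N₂] [Module.Finite R N₂]
    (f : N₁ →ₗ[R] N₂) (g : N₂ →ₗ[R] N₃) (hf : Function.Injective f) (hg : Function.Surjective g)
    (hfg : Function.Exact f g) (e₁ : N₁ →ₗ[R] N₁) (e₂ : N₂ →ₗ[R] N₂) (e₃ : N₃ →ₗ[R] N₃)
    (h12 : ∀ x, e₂ (f x) = f (e₁ x)) (h23 : ∀ x, e₃ (g x) = g (e₂ x)) :
    LinearMap.det e₂ = LinearMap.det e₁ * LinearMap.det e₃ := by
  let W := LinearMap.range f
  have he : W ≤ W.comap e₂ := by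
    rintro _ ⟨x, rfl⟩
    exact ⟨e₁ x, (h12 x).symm⟩
  let φ : N₁ ≃ₗ[R] W := LinearEquiv.ofInjective f hf
  let ψ₀ : (N₂ ⧸ LinearMap.ker g) ≃ₗ[R] N₃ := g.quotKerEquivOfSurjective hg
  have hW : W = LinearMap.ker g := (LinearMap.exact_iff.1 hfg).symm
  let ψ : (N₂ ⧸ W) ≃ₗ[R] N₃ := (Submodule.quotEquivOfEq _ _ hW).trans ψ₀
  have hψ : ∀ x, ψ (W.mkQ x) = g x := fun x => rfl
  have : Module.Free R W := Module.Free.of_equiv φ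
  have : Module.Finite R W := Module.Finite.equiv φ
  have : Module.Free R (N₂ ⧸ W) := Module.Free.of_equiv ψ.symm
  have : Module.Finite R (N₂ ⧸ W) := Module.Finite.equiv ψ.symm
  rw [LinearMap.det_eq_det_mul_det W e₂ he]
  congr 1
  · rw [← LinearMap.det_conj e₁ φ]
    congr 1
    ext ⟨_, x, rfl⟩
    have : φ.symm ⟨f x, x, rfl⟩ = x := by
      rw [LinearEquiv.symm_apply_eq]; rfl
    simp only [LinearMap.restrict_coe_apply, LinearMap.comp_apply, LinearEquiv.coe_coe]
    rw [this, h12]; rfl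
  · rw [← LinearMap.det_conj _ ψ]
    congr 1
    ext y
    obtain ⟨x, rfl⟩ := hg y
    simp only [LinearMap.comp_apply, LinearEquiv.coe_coe]
    rw [← hψ x, LinearEquiv.symm_apply_apply, Submodule.mkQ_apply, Submodule.mapQ_apply,
      ← Submodule.mkQ_apply, ← Submodule.mkQ_apply, hψ, hψ, h23]

variable {k A : Type u} [Field k] [CommRing A] [Algebra k A]

/-- action of `R ⊗ A` on `R ⊗ M` -/
def tAct (R : Type u) [CommRing R] [Algebra k R] (M : Type u) [AddCommGroup M] [Module k M]
    [Module A M] [IsScalarTower k A M] : R ⊗[k] A →ₐ[R] Module.End R (R ⊗[k] M) :=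
  (LinearMap.tensorProductEnd k R M).comp
    (Algebra.TensorProduct.map (AlgHom.id R R) (Algebra.lsmul k k M))

theorem tAct_tmul (R : Type u) [CommRing R] [Algebra k R] (M : Type u) [AddCommGroup M] [Module k M]
    [Module A M] [IsScalarTower k A M] (r r' : R) (a : A) (m : M) :
    tAct R M (r ⊗ₜ[k] a) (r' ⊗ₜ m) = (r * r') ⊗ₜ (a • m) := by
  simp only [tAct, AlgHom.comp_apply, Algebra.TensorProduct.map_tmul, AlgHom.id_apply]
  change (r • LinearMap.baseChangeHom k R M M (Algebra.lsmul k k M a)) (r' ⊗ₜ[k] m) = _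
  simp [smul_tmul']

/-- the determinant of an element of `R ⊗ A` acting on `R ⊗ M` -/
def tDet (R : Type u) [CommRing R] [Algebra k R] (M : Type u) [AddCommGroup M] [Module k M]
    [Module A M] [IsScalarTower k A M] (u : R ⊗[k] A) : R := LinearMap.det (tAct R M u)

theorem tAct_baseChange (R : Type u) [CommRing R] [Algebra k R] {M N : Type u} [AddCommGroup M]
    [Module k M] [Module A M] [IsScalarTower k A M] [AddCommGroup N]
    [Module k N] [Module A N] [IsScalarTower k A N] (f : M →ₗ[A] N) (u : R ⊗[k] A) (x : R ⊗[k] M) :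
    tAct R N u ((f.restrictScalars k).baseChange R x) =
      (f.restrictScalars k).baseChange R (tAct R M u x) := by
  induction u with
  | zero => simp
  | add u v hu hv => simp only [map_add, LinearMap.add_apply, hu, hv]
  | tmul r a =>
    induction x with
    | zero => simp
    | add u v hu hv => simp only [map_add, hu, hv]
    | tmul r' m => simp [tAct_tmul]

theorem tDet_exact (R : Type u) [CommRing R] [Algebra k R] {N₁ N₂ N₃ : Type u} [AddCommGroup N₁]
    [Module k N₁] [Module A N₁] [IsScalarTower k A N₁] [AddCommGroup N₂]
    [Module k N₂] [Module A N₂] [IsScalarTower k A N₂] [AddCommGroup N₃]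
    [Module k N₃] [Module A N₃] [IsScalarTower k A N₃] [Module.Finite k N₁] [Module.Finite k N₂]
    [Module.Finite k N₃]
    (f : N₁ →ₗ[A] N₂) (g : N₂ →ₗ[A] N₃) (hf : Function.Injective f) (hg : Function.Surjective g)
    (hfg : Function.Exact f g) (u : R ⊗[k] A) :
    tDet R N₂ u = tDet R N₁ u * tDet R N₃ u := by
  unfold tDet
  refine det_of_exact ((f.restrictScalars k).baseChange R) ((g.restrictScalars k).baseChange R)
    ?_ ?_ ?_ _ _ _ (fun x => tAct_baseChange R f u x) (fun x => tAct_baseChange R g u x)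
  · exact Module.Flat.lTensor_preserves_injective_linearMap (f.restrictScalars k) hf
  · exact LinearMap.lTensor_surjective R (g := g.restrictScalars k) hg
  · exact lTensor_exact R (f := f.restrictScalars k) (g := g.restrictScalars k) hfg hg

theorem tDet_subsingleton (R : Type u) [CommRing R] [Algebra k R] (M : Type u) [AddCommGroup M]
    [Module k M] [Module A M] [IsScalarTower k A M] [Subsingleton M] (u : R ⊗[k] A) :
    tDet R M u = 1 := by
  have : Subsingleton (R ⊗[k] M) := by
    refine subsingleton_of_forall_eq 0 fun x => ?_
    induction x with
    | zero => rfl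
    | add x y hx hy => rw [hx, hy, add_zero]
    | tmul r m => rw [Subsingleton.elim m 0, tmul_zero]
  exact LinearMap.det_eq_one_of_subsingleton _

theorem tDet_equiv (R : Type u) [CommRing R] [Algebra k R] {M N : Type u} [AddCommGroup M]
    [Module k M] [Module A M] [IsScalarTower k A M] [AddCommGroup N]
    [Module k N] [Module A N] [IsScalarTower k A N] [Module.Finite k M] [Module.Finite k N]
    (f : M ≃ₗ[A] N) (u : R ⊗[k] A) : tDet R M u = tDet R N u := by
  have := tDet_exact (k := k) R (N₃ := PUnit.{u+1}) f.toLinearMap (0 : N →ₗ[A] PUnit.{u+1})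
    f.injective (fun x => ⟨0, rfl⟩) (by
      rw [LinearMap.exact_iff, LinearMap.range_eq_top.2 f.surjective]; simp) u
  rw [this, tDet_subsingleton R PUnit.{u+1}, mul_one]

theorem tDet_pow (R : Type u) [CommRing R] [Algebra k R] (M : Type u) [AddCommGroup M]
    [Module k M] [Module A M] [IsScalarTower k A M] [Module.Finite k M] (n : ℕ) (u : R ⊗[k] A) :
    tDet R (Fin n → M) u = tDet R M u ^ n := by
  induction n with
  | zero => rw [tDet_subsingleton R (Fin 0 → M), pow_zero]
  | succ n ih =>
    have e : (Fin (n+1) → M) ≃ₗ[A] (M × (Fin n → M)) := (Fin.consLinearEquiv A (fun _ => M)).symm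
    rw [tDet_equiv R e, tDet_exact R (LinearMap.inl A M (Fin n → M)) (LinearMap.snd A M (Fin n → M))
      LinearMap.inl_injective LinearMap.snd_surjective ?_ u, ih, pow_succ']
    · exact Function.Exact.inl_snd

theorem tDet_algebra (R : Type u) [CommRing R] [Algebra k R] (E : Type u) [CommRing E]
    [Algebra k E] [Algebra A E] [IsScalarTower k A E] (u : R ⊗[k] A) :
    tDet R E u = Algebra.norm R
      (Algebra.TensorProduct.map (AlgHom.id R R) (IsScalarTower.toAlgHom k A E) u) := by
  rw [Algebra.norm_apply]
  unfold tDet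
  congr 1
  ext x
  simp
  induction u with
  | zero => simp
  | add u v hu hv => simp only [map_add, LinearMap.add_apply, hu, hv, add_mul]
  | tmul r a =>
    simp [tAct_tmul, Algebra.smul_def]

/-- Dévissage: up to powers determinants are products of norms from residue fields. -/
theorem tDet_devissage [IsNoetherianRing A] [Module.Finite k A] (E : PrimeSpectrum A → Type u)
    [∀ p, Field (E p)] [∀ p, Algebra k (E p)] [∀ p, Algebra A (E p)]
    [∀ p, IsScalarTower k A (E p)] [∀ p, Module.Finite k (E p)]
    (hE : ∀ p, RingHom.ker (algebraMap A (E p)) = p.asIdeal)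
    (M : Type u) [AddCommGroup M] [Module k M] [Module A M] [IsScalarTower k A M]
    [Module.Finite A M] :
    ∃ (c : ℕ) (l : List (PrimeSpectrum A)), 0 < c ∧ ∀ (R : Type u) [CommRing R] [Algebra k R]
      (u : R ⊗[k] A), tDet R M u ^ c = (l.map fun p => Algebra.norm R
      (Algebra.TensorProduct.map (AlgHom.id R R) (IsScalarTower.toAlgHom k A (E p)) u)).prod := by
  have key := IsNoetherianRing.induction_on_isQuotientEquivQuotientPrime A (M := M) inferInstance
    (motive := fun N _ _ _ => ∀ [Module k N] [IsScalarTower k A N],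
      ∃ (c : ℕ) (l : List (PrimeSpectrum A)), 0 < c ∧ ∀ (R : Type u) [CommRing R] [Algebra k R]
      (u : R ⊗[k] A), tDet R N u ^ c = (l.map fun p => tDet R (E p) u).prod) ?_ ?_ ?_
  · obtain ⟨c, l, hc, h⟩ := key
    exact ⟨c, l, hc, fun R _ _ u => by simp only [← tDet_algebra]; exact h R u⟩
  · intro N _ _ _ _ _ _
    exact ⟨1, [], one_pos, fun R _ _ u => by rw [tDet_subsingleton]; simp⟩
  · intro N _ _ _ p e _ _
    let K := A ⧸ p.1
    have : Module.Finite k N := Module.Finite.trans A N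
    have hmax : p.1.IsMaximal := by
      have : IsArtinianRing A := IsArtinianRing.of_finite k A
      infer_instance
    letI : Field K := Ideal.Quotient.field p.1
    letI : Module K (E p) :=
      Module.compHom (E p) (Ideal.Quotient.lift p.1 (algebraMap A (E p)) (fun a ha => by
        rwa [← hE p] at ha))
    have hst : IsScalarTower A K (E p) := ⟨fun a x y => by
      obtain ⟨x, rfl⟩ := Ideal.Quotient.mk_surjective x
      change (algebraMap A (E p) (a * x)) * y = a • (algebraMap A (E p) x * y)
      rw [Algebra.smul_def, map_mul, mul_assoc]⟩
    have : Module.Finite A (E p) := Module.Finite.of_restrictScalars_finite k A (E p)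
    have : Module.Finite K (E p) := Module.Finite.of_restrictScalars_finite A K (E p)
    have b := Module.finBasis K (E p)
    have eq : E p ≃ₗ[A] (Fin (Module.finrank K (E p)) → K) := b.equivFun.restrictScalars A
    have hpos : 0 < Module.finrank K (E p) := by
      have : Nontrivial (E p) := inferInstance
      exact Module.finrank_pos
    refine ⟨Module.finrank K (E p), [p], hpos, fun R _ _ u => ?_⟩
    simp only [List.map_cons, List.map_nil, List.prod_cons, List.prod_nil, mul_one]
    rw [tDet_equiv R eq, tDet_pow, tDet_equiv R e]
  · intro N₁ _ _ _ N₂ _ _ _ N₃ _ _ _ f g hf hg hfg h1 h3 _ _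
    letI : Module k N₁ := Module.compHom N₁ (algebraMap k A)
    letI : Module k N₃ := Module.compHom N₃ (algebraMap k A)
    have i1 : IsScalarTower k A N₁ := IsScalarTower.of_algebraMap_smul fun _ _ => rfl
    have i3 : IsScalarTower k A N₃ := IsScalarTower.of_algebraMap_smul fun _ _ => rfl
    have : Module.Finite k N₁ := Module.Finite.trans A N₁
    have : Module.Finite k N₂ := Module.Finite.trans A N₂
    have : Module.Finite k N₃ := Module.Finite.trans A N₃
    obtain ⟨c1, l1, hc1, h1⟩ := h1
    obtain ⟨c3, l3, hc3, h3⟩ := h3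
    refine ⟨c1 * c3, (List.replicate c3 l1).flatten ++ (List.replicate c1 l3).flatten,
      Nat.mul_pos hc1 hc3, fun R _ _ u => ?_⟩
    rw [tDet_exact R f g hf hg hfg, mul_pow, pow_mul, h1, mul_comm c1 c3, pow_mul, h3]
    simp [List.map_flatten, List.prod_flatten]

end DetDev
end

section
open TensorProduct

noncomputable section TNorm

variable {k : Type u} [Field k]

/-- base change map -/
abbrev tMap {R R' : Type u} [CommRing R] [Algebra k R] [CommRing R'] [Algebra k R']
    (ψ : R →ₐ[k] R') (E : Type u) [CommRing E] [Algebra k E] : R ⊗[k] E →ₐ[k] R' ⊗[k] E :=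
  Algebra.TensorProduct.map ψ (AlgHom.id k E)

theorem tNorm_natural {R R' : Type u} [CommRing R] [Algebra k R] [CommRing R'] [Algebra k R']
    (ψ : R →ₐ[k] R') (E : Type u) [CommRing E] [Algebra k E] [Module.Finite k E] (u : R ⊗[k] E) :
    Algebra.norm R' (tMap ψ E u) = ψ (Algebra.norm R u) := by
  classical
  let b := Module.finBasis k E
  rw [Algebra.norm_eq_matrix_det (Algebra.TensorProduct.basis R b),
    Algebra.norm_eq_matrix_det (Algebra.TensorProduct.basis R' b), AlgHom.map_det]
  congr 1
  have hrepr : ∀ (v : R ⊗[k] E) i, (Algebra.TensorProduct.basis R' b).repr (tMap ψ E v) i =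
      ψ ((Algebra.TensorProduct.basis R b).repr v i) := by
    intro v i
    induction v with
    | zero => simp
    | add u v hu hv => simp only [map_add, Finsupp.add_apply, hu, hv]
    | tmul r a => simp [Algebra.TensorProduct.basis_repr_tmul, Algebra.smul_def]
  ext i j
  rw [Algebra.leftMulMatrix_eq_repr_mul]
  simp only [AlgHom.mapMatrix_apply, Matrix.map_apply]
  have hb : tMap ψ E (Algebra.TensorProduct.basis R b j) = Algebra.TensorProduct.basis R' b j := by
    simp
  rw [Algebra.leftMulMatrix_eq_repr_mul, ← hrepr, map_mul (tMap ψ E), hb]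

variable (k) in
/-- the universal combination `∑ X^l φ_l` -/
def tPoly {R E : Type u} [CommRing R] [Algebra k R] [CommRing E] [Algebra k E] {n : ℕ}
    (φ : Fin n → R ⊗[k] E) : (Polynomial R) ⊗[k] E :=
  ∑ l : Fin n, ((Polynomial.X ^ (l : ℕ)) ⊗ₜ[k] (1 : E)) *
    tMap (Algebra.ofId R (Polynomial R) |>.restrictScalars k) E (φ l)

variable (k) in
/-- coefficients of the norm of the universal combination. -/
def pNorm {R E : Type u} [CommRing R] [Algebra k R] [CommRing E] [Algebra k E] {n : ℕ}
    (φ : Fin n → R ⊗[k] E) (d : ℕ) : R :=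
  (Algebra.norm (Polynomial R) (tPoly k φ)).coeff d

theorem pNorm_natural {R R' E : Type u} [CommRing R] [Algebra k R] [CommRing R'] [Algebra k R']
    (ψ : R →ₐ[k] R') [CommRing E] [Algebra k E] [Module.Finite k E] {n : ℕ}
    (φ : Fin n → R ⊗[k] E) (d : ℕ) :
    pNorm k (fun l => tMap ψ E (φ l)) d = ψ (pNorm k φ d) := by
  have h : tPoly k (fun l => tMap ψ E (φ l)) =
      tMap (Polynomial.mapAlgHom ψ) E (tPoly k φ) := by
    simp only [tPoly, map_sum, map_mul]
    refine Finset.sum_congr rfl fun l _ => ?_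
    congr 1
    · simp
    · have : (tMap ((Algebra.ofId R' (Polynomial R')).restrictScalars k) E).comp (tMap ψ E) =
        (tMap (Polynomial.mapAlgHom ψ) E).comp
          (tMap ((Algebra.ofId R (Polynomial R)).restrictScalars k) E) := by
        ext x
        · simp [Algebra.ofId_apply]
        · simp
      exact DFunLike.congr_fun this (φ l)
  rw [pNorm, h, tNorm_natural, pNorm]
  simp

theorem pNorm_smul {R E : Type u} [CommRing R] [Algebra k R]
    [CommRing E] [Algebra k E] [Module.Finite k E] {n : ℕ}
    (a : R ⊗[k] E) (φ : Fin n → R ⊗[k] E) (d : ℕ) :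
    pNorm k (fun l => a * φ l) d = Algebra.norm R a * pNorm k φ d := by
  have h : tPoly k (fun l => a * φ l) =
      tMap (Algebra.ofId R (Polynomial R) |>.restrictScalars k) E a * tPoly k φ := by
    simp only [tPoly, Finset.mul_sum, map_mul]
    refine Finset.sum_congr rfl fun l _ => ?_
    ring
  rw [pNorm, h, map_mul, tNorm_natural, pNorm]
  simp [Algebra.ofId_apply]

theorem pNorm_ne_zero {K E : Type u} [Field K] [Algebra k K]
    [CommRing E] [Algebra k E] [Module.Finite k E] {n : ℕ}
    (φ : Fin n → K ⊗[k] E) (hφ : Ideal.span (Set.range φ) = ⊤) : ∃ d, pNorm k φ d ≠ 0 := by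
  by_contra! hcon
  have h0 : Algebra.norm (Polynomial K) (tPoly k φ) = 0 := by
    ext d; exact hcon d
  rw [Algebra.norm_apply, LinearMap.det_eq_zero_iff_ker_ne_bot] at h0
  apply h0
  rw [LinearMap.ker_eq_bot']
  intro v hv
  replace hv : tPoly k φ * v = 0 := hv
  -- map to polynomials over `K ⊗ E`
  let f : (Polynomial K) ⊗[k] E →ₐ[k] Polynomial (K ⊗[k] E) :=
    Algebra.TensorProduct.lift
      (Polynomial.mapAlgHom (Algebra.TensorProduct.includeLeft : K →ₐ[k] K ⊗[k] E))
      ((Polynomial.CAlgHom (R := k) (A := K ⊗[k] E)).comp Algebra.TensorProduct.includeRight)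
      (fun _ _ => Commute.all _ _)
  let g : Polynomial (K ⊗[k] E) →+* (Polynomial K) ⊗[k] E :=
    Polynomial.eval₂RingHom
      (tMap ((Algebra.ofId K (Polynomial K)).restrictScalars k) E).toRingHom
      (Polynomial.X ⊗ₜ 1)
  have hgf : ∀ x, g (f x) = x := by
    intro x
    induction x with
    | zero => simp
    | add x y hx hy => rw [map_add, map_add, hx, hy]
    | tmul p e =>
      have : f (p ⊗ₜ e) = p.map (Algebra.TensorProduct.includeLeft : K →ₐ[k] K ⊗[k] E).toRingHom *
        Polynomial.C (1 ⊗ₜ e) := by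
        simp only [f, Algebra.TensorProduct.lift_tmul]; rfl
      rw [this, map_mul]
      have h2 : g (Polynomial.C (1 ⊗ₜ e)) = 1 ⊗ₜ e := by
        simp [g]
      rw [h2]
      have h1 : g.comp (Polynomial.mapRingHom
          (Algebra.TensorProduct.includeLeft : K →ₐ[k] K ⊗[k] E).toRingHom) =
          (Algebra.TensorProduct.includeLeft : Polynomial K →ₐ[k] Polynomial K ⊗[k] E).toRingHom := by
        apply Polynomial.ringHom_ext
        · intro a; simp [g, Algebra.ofId_apply]
        · simp [g]
      have h1' := DFunLike.congr_fun h1 p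
      simp only [RingHom.comp_apply, Polynomial.coe_mapRingHom] at h1'
      rw [h1']
      simp
  have hinj : Function.Injective f := fun x y h => by rw [← hgf x, ← hgf y, h]
  have hf : f (tPoly k φ) = ∑ l : Fin n, Polynomial.X ^ (l:ℕ) * Polynomial.C (φ l) := by
    simp only [tPoly, map_sum, map_mul]
    refine Finset.sum_congr rfl fun l _ => ?_
    congr 1
    · simp [f, ← Algebra.TensorProduct.one_def]
    · have : f.comp (tMap ((Algebra.ofId K (Polynomial K)).restrictScalars k) E) =
        (Polynomial.CAlgHom (R := k) (A := K ⊗[k] E)) := by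
        ext x
        · simp [f, Algebra.ofId_apply, ← Algebra.TensorProduct.one_def]
        · simp [f]
      exact DFunLike.congr_fun this (φ l)
  apply hinj
  rw [map_zero]
  have hfv : f (tPoly k φ) * f v = 0 := by rw [← map_mul, hv, map_zero]
  by_contra hne
  have hz : f (tPoly k φ) ∉ nonZeroDivisors (Polynomial (K ⊗[k] E)) := by
    intro h
    exact hne ((mul_left_mem_nonZeroDivisors_eq_zero_iff h).1 hfv)
  obtain ⟨a, ha, hau⟩ := Polynomial.notMem_nonZeroDivisors_iff.1 hz
  apply ha
  have hc : ∀ l, a * φ l = 0 := by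
    intro l
    have := congrArg (fun p => Polynomial.coeff p (l:ℕ)) hau
    rw [hf] at this
    have h2 : ∀ x : Fin n, (Polynomial.X ^ (x:ℕ) * Polynomial.C (φ x)).coeff (l:ℕ) =
        if x = l then φ x else 0 := by
      intro x
      rw [Polynomial.coeff_mul_C, Polynomial.coeff_X_pow]
      by_cases h : x = l
      · simp [h]
      · have : (l:ℕ) ≠ x := fun h' => h (Fin.ext h'.symm)
        simp [h, this]
    simp only [Polynomial.coeff_smul, Polynomial.finset_sum_coeff, h2, Finset.sum_ite_eq',
      Finset.mem_univ, if_true, Polynomial.coeff_zero, smul_eq_mul] at this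
    exact this
  have hle : Ideal.span (Set.range φ) ≤ LinearMap.ker (LinearMap.mulLeft (K ⊗[k] E) a) := by
    rw [Ideal.span_le]; rintro _ ⟨l, rfl⟩; exact hc l
  rw [hφ] at hle
  simpa using hle (x := 1) trivial

/-- The final norm identity -/
theorem norm_pow_eq {A : Type u} [CommRing A] [Algebra k A]
    [Module.Finite k A] (ev : A →ₐ[k] k) (E : PrimeSpectrum A → Type u)
    [∀ p, Field (E p)] [∀ p, Algebra k (E p)] (i : ∀ p, A →ₐ[k] E p) [∀ p, Module.Finite k (E p)]
    (hE : ∀ p, RingHom.ker (i p) = p.asIdeal) :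
    ∃ (c : ℕ) (l : List (PrimeSpectrum A)), 0 < c ∧ ∀ (R : Type u) [CommRing R] [Algebra k R]
      (u : R ⊗[k] A), Algebra.norm R u ^ c =
        (Algebra.TensorProduct.lift (AlgHom.id R R) ((Algebra.ofId k R).comp ev)
          (fun _ _ => Commute.all _ _) u) ^ c *
        (l.map fun p => Algebra.norm R
      (Algebra.TensorProduct.map (AlgHom.id R R) (i p) u)).prod := by
  letI : ∀ p, Algebra A (E p) := fun p => (i p).toRingHom.toAlgebra
  have : ∀ p, IsScalarTower k A (E p) := fun p => IsScalarTower.of_algebraMap_eq fun x =>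
    ((i p).commutes x).symm
  have : IsArtinianRing A := IsArtinianRing.of_finite k A
  letI : Algebra A k := ev.toRingHom.toAlgebra
  have : IsScalarTower k A k := IsScalarTower.of_algebraMap_eq fun x =>
    (ev.commutes x).symm
  obtain ⟨c, l, hc, h⟩ := tDet_devissage (k := k) E hE (RingHom.ker ev)
  refine ⟨c, l, hc, fun R _ _ u => ?_⟩
  have h1 := tDet_exact (k := k) (A := A) R (N₁ := RingHom.ker ev) (N₂ := A) (N₃ := k)
    (Submodule.subtype _) (Algebra.linearMap A k) (Submodule.subtype_injective _)
    (fun x => ⟨algebraMap k A x, ev.commutes x⟩)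
    (by
      rw [LinearMap.exact_iff, Submodule.range_subtype]; rfl) u
  rw [tDet_algebra R A, tDet_algebra R k] at h1
  have e0 : (Algebra.TensorProduct.map (AlgHom.id R R) (IsScalarTower.toAlgHom k A A) u) = u := by
    have : (Algebra.TensorProduct.map (AlgHom.id R R) (IsScalarTower.toAlgHom k A A)) =
      AlgHom.id R _ := by ext; simp
    rw [this]; rfl
  rw [e0] at h1
  rw [h1, mul_pow, mul_comm, h R u]
  congr 2
  have e1 : ∀ x : R ⊗[k] k, Algebra.norm R x = Algebra.TensorProduct.rid k R R x := by
    intro x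
    cases subsingleton_or_nontrivial R
    · exact Subsingleton.elim _ _
    obtain ⟨r, rfl⟩ := (Algebra.TensorProduct.rid k R R).symm.surjective x
    rw [AlgEquiv.apply_symm_apply]
    have : (Algebra.TensorProduct.rid k R R).symm r = algebraMap R _ r := by simp
    rw [this, Algebra.norm_algebraMap, Module.finrank_baseChange]
    simp
  rw [e1]
  have e2 : (Algebra.TensorProduct.rid k R R).toAlgHom.comp
      (Algebra.TensorProduct.map (AlgHom.id R R) (IsScalarTower.toAlgHom k A k)) =
    (Algebra.TensorProduct.lift (AlgHom.id R R) ((Algebra.ofId k R).comp ev)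
          (fun _ _ => Commute.all _ _)) := by
    ext x
    simp [Algebra.smul_def, Algebra.ofId_apply]; rfl
  exact DFunLike.congr_fun e2 u

end TNorm
end

section
noncomputable section

/-- A natural family of morphisms defined on affine test objects glues. -/
theorem glue_affine_tests {T Y : Scheme.{u}}
    (a : ∀ (R : CommRingCat.{u}) (_ : Spec R ⟶ T), (Spec R ⟶ Y))
    (nat : ∀ (R R' : CommRingCat.{u}) (φ : R ⟶ R') (t : Spec R ⟶ T),
      a R' (Spec.map φ ≫ t) = Spec.map φ ≫ a R t) :
    ∃ m : T ⟶ Y, ∀ R (t : Spec R ⟶ T), t ≫ m = a R t := by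
  have nat' : ∀ (R R' : CommRingCat.{u}) (f : Spec R' ⟶ Spec R) (t : Spec R ⟶ T),
      a R' (f ≫ t) = f ≫ a R t := by
    intro R R' f t
    obtain ⟨φ, rfl⟩ := Spec.map_surjective f
    exact nat _ _ φ t
  let 𝓤 := T.affineCover
  let b : ∀ i : 𝓤.I₀, 𝓤.X i ⟶ Y := fun i => a _ (𝓤.f i)
  have hb : ∀ (i : 𝓤.I₀) (R : CommRingCat.{u}) (s : Spec R ⟶ 𝓤.X i), s ≫ b i = a R (s ≫ 𝓤.f i) :=
    fun i R s => (nat' _ R s (𝓤.f i)).symm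
  have compat : ∀ x y, pullback.fst (𝓤.f x) (𝓤.f y) ≫ b x = pullback.snd (𝓤.f x) (𝓤.f y) ≫ b y := by
    intro x y
    refine Scheme.Cover.hom_ext (pullback (𝓤.f x) (𝓤.f y)).affineCover _ _ fun j => ?_
    rw [← Category.assoc, ← Category.assoc]
    refine (hb x _ _).trans (Eq.trans ?_ (hb y _ _).symm)
    exact congrArg (a _) ((Category.assoc _ _ _).trans
      ((congrArg _ pullback.condition).trans (Category.assoc _ _ _).symm))
  refine ⟨𝓤.glueMorphisms b compat, fun R t => ?_⟩
  refine Scheme.Cover.hom_ext (𝓤.pullback₁ t) _ _ fun i => ?_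
  refine Scheme.Cover.hom_ext (Scheme.affineCover _) _ _ fun j => ?_
  have e1 : (𝓤.pullback₁ t).f i ≫ t = pullback.snd t (𝓤.f i) ≫ 𝓤.f i := pullback.condition
  have e2 : (𝓤.pullback₁ t).f i ≫ t ≫ 𝓤.glueMorphisms b compat = pullback.snd t (𝓤.f i) ≫ b i := by
    refine (Category.assoc _ _ _).symm.trans ((congrArg (· ≫ 𝓤.glueMorphisms b compat) e1).trans ?_)
    refine (Category.assoc _ _ _).trans (congrArg (pullback.snd t (𝓤.f i) ≫ ·) ?_)
    exact Scheme.Cover.ι_glueMorphisms _ _ _ _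
  refine (congrArg (_ ≫ ·) e2).trans ((Category.assoc _ _ _).symm.trans ?_)
  refine (hb i _ _).trans (Eq.trans ?_ ((nat' _ _ _ _).trans (Category.assoc _ _ _)))
  exact congrArg (a _) ((Category.assoc _ _ _).trans
      ((congrArg _ e1.symm).trans (Category.assoc _ _ _).symm))

theorem hom_ext_affine {T Y : Scheme.{u}} {m m' : T ⟶ Y}
    (h : ∀ (R : CommRingCat.{u}) (t : Spec R ⟶ T), t ≫ m = t ≫ m') : m = m' :=
  Scheme.Cover.hom_ext T.affineCover _ _ fun _ => h _ _

/-- value of a global function at an affine test -/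
def evalAt {T : Scheme.{u}} {R : CommRingCat.{u}} (t : Spec R ⟶ T) (s : Γ(T, ⊤)) : R :=
  (Scheme.ΓSpecIso R).hom (t.appTop s)

/-- functions as maps to the affine line -/
def A1 : Scheme.{u} := Spec (.of (MvPolynomial PUnit.{u+1} (ULift.{u} ℤ)))

def toA1 (T : Scheme.{u}) : (T ⟶ A1.{u}) ≃ Γ(T, ⊤) :=
  (AffineSpace.toSpecMvPolyIntEquiv PUnit).trans (Equiv.funUnique PUnit.{u+1} _)

theorem toA1_comp {T T' : Scheme.{u}} (t : T' ⟶ T) (s : T ⟶ A1) :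
    toA1 T' (t ≫ s) = t.appTop (toA1 T s) := by
  exact AffineSpace.toSpecMvPolyIntEquiv_comp (n := PUnit.{u+1}) t s PUnit.unit

/-- global functions from values on affine tests -/
theorem exists_global {T : Scheme.{u}}
    (a : ∀ (R : CommRingCat.{u}) (_ : Spec R ⟶ T), R)
    (nat : ∀ (R R' : CommRingCat.{u}) (φ : R ⟶ R') (t : Spec R ⟶ T),
      a R' (Spec.map φ ≫ t) = φ (a R t)) :
    ∃ s : Γ(T, ⊤), ∀ R (t : Spec R ⟶ T), evalAt t s = a R t := by
  obtain ⟨m, hm⟩ := glue_affine_tests (T := T) (Y := A1)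
    (fun R t => (toA1 _).symm ((Scheme.ΓSpecIso R).inv (a R t))) (by
      intro R R' φ t
      apply (toA1 _).injective
      rw [toA1_comp, Equiv.apply_symm_apply, Equiv.apply_symm_apply, nat]
      have := Scheme.ΓSpecIso_inv_naturality φ
      exact congrArg (fun f => f.hom (a R t)) this)
  refine ⟨toA1 T m, fun R t => ?_⟩
  rw [evalAt, ← toA1_comp, hm, Equiv.apply_symm_apply]
  simp

theorem global_ext {T : Scheme.{u}} {s s' : Γ(T, ⊤)}
    (h : ∀ (R : CommRingCat.{u}) (t : Spec R ⟶ T), evalAt t s = evalAt t s') : s = s' := by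
  obtain ⟨m, rfl⟩ := (toA1 T).surjective s
  obtain ⟨m', rfl⟩ := (toA1 T).surjective s'
  congr 1
  refine hom_ext_affine fun R t => (toA1 _).injective ?_
  have := h R t
  rw [evalAt, evalAt] at this
  rw [toA1_comp, toA1_comp]
  exact (ConcreteCategory.bijective_of_isIso (Scheme.ΓSpecIso R).hom).1 this

theorem evalAt_comp {T : Scheme.{u}} {R R' : CommRingCat.{u}} (φ : R ⟶ R') (t : Spec R ⟶ T)
    (s : Γ(T, ⊤)) : evalAt (Spec.map φ ≫ t) s = φ (evalAt t s) := by
  simp only [evalAt, Scheme.Hom.comp_appTop]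
  have := Scheme.ΓSpecIso_naturality φ
  exact congrArg (fun f => f.hom (t.appTop s)) this

theorem evalAt_appTop {T T' : Scheme.{u}} {R : CommRingCat.{u}} (t : Spec R ⟶ T') (f : T' ⟶ T)
    (s : Γ(T, ⊤)) : evalAt t (f.appTop s) = evalAt (t ≫ f) s := by
  rw [evalAt, evalAt, Scheme.Hom.comp_appTop]; rfl

def evalHom {T : Scheme.{u}} {R : CommRingCat.{u}} (t : Spec R ⟶ T) : Γ(T, ⊤) →+* R :=
  (t.appTop ≫ (Scheme.ΓSpecIso R).hom).hom

theorem evalHom_apply {T : Scheme.{u}} {R : CommRingCat.{u}} (t : Spec R ⟶ T) (s : Γ(T, ⊤)) :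
    evalHom t s = evalAt t s := rfl

/-- gluing functions along a cover -/
theorem appTop_ext_of_cover {T : Scheme.{u}} (𝓤 : T.OpenCover) {s s' : Γ(T, ⊤)}
    (h : ∀ i, (𝓤.f i).appTop s = (𝓤.f i).appTop s') : s = s' := by
  obtain ⟨m, rfl⟩ := (toA1 T).surjective s
  obtain ⟨m', rfl⟩ := (toA1 T).surjective s'
  congr 1
  refine Scheme.Cover.hom_ext 𝓤 _ _ fun i => (toA1 _).injective ?_
  rw [toA1_comp, toA1_comp, h]

theorem exists_glue_cover {T : Scheme.{u}} (𝓤 : T.OpenCover) (s : ∀ i, Γ(𝓤.X i, ⊤))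
    (h : ∀ i j, (pullback.fst (𝓤.f i) (𝓤.f j)).appTop (s i) =
      (pullback.snd (𝓤.f i) (𝓤.f j)).appTop (s j)) :
    ∃ a : Γ(T, ⊤), ∀ i, (𝓤.f i).appTop a = s i := by
  refine ⟨toA1 T (𝓤.glueMorphisms (fun i => (toA1 _).symm (s i)) ?_), fun i => ?_⟩
  · intro i j
    apply (toA1 _).injective
    rw [toA1_comp, toA1_comp, Equiv.apply_symm_apply, Equiv.apply_symm_apply, h]
  · rw [← toA1_comp, Scheme.Cover.ι_glueMorphisms, Equiv.apply_symm_apply]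

end
end

section
noncomputable section

theorem mem_basicOpen_evalAt {T : Scheme.{u}} {R : CommRingCat.{u}} (t : Spec R ⟶ T) (f : Γ(T, ⊤))
    (p : Spec R) : t p ∈ T.basicOpen f ↔ evalAt t f ∉ p.asIdeal := by
  change p ∈ t ⁻¹ᵁ T.basicOpen f ↔ _
  rw [Scheme.preimage_basicOpen_top, basicOpen_eq_of_affine']
  exact Iff.rfl

theorem mem_basicOpen_field {T : Scheme.{u}} {K : Type u} [Field K] (t : Spec (.of K) ⟶ T)
    (f : Γ(T, ⊤)) (p : Spec (.of K)) : t p ∈ T.basicOpen f ↔ evalAt t f ≠ 0 := by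
  rw [mem_basicOpen_evalAt]
  have : p.asIdeal = ⊥ := by
    rcases Ideal.eq_bot_or_top p.asIdeal with h | h
    · exact h
    · exact absurd h p.isPrime.ne_top
  rw [this, Ideal.mem_bot]

theorem exists_cover_of_nhds {T : Scheme.{u}} (P : T.Opens → Prop)
    (h : ∀ t : T, ∃ V : T.Opens, t ∈ V ∧ P V) :
    ∃ 𝓤 : Scheme.OpenCover.{u} T, ∀ i : 𝓤.I₀, ∃ V : T.Opens, P V ∧ ∃ e : 𝓤.X i = V.toScheme,
      𝓤.f i = eqToHom e ≫ V.ι := by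
  choose V hV hP using h
  refine ⟨T.openCoverOfIsOpenCover V ?_, fun i => ⟨V i, hP i, rfl, ?_⟩⟩
  · rw [TopologicalSpace.IsOpenCover]
    exact top_le_iff.1 fun x _ => TopologicalSpace.Opens.mem_iSup.2 ⟨x, hV x⟩
  · exact (Category.id_comp _).symm

theorem isUnit_of_fields {T : Scheme.{u}} {f : Γ(T, ⊤)}
    (h : ∀ (K : Type u) [Field K] (t : Spec (.of K) ⟶ T), evalAt t f ≠ 0) : IsUnit f := by
  refine T.toLocallyRingedSpace.toRingedSpace.isUnit_of_isUnit_germ ⊤ f fun x hx => ?_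
  refine (T.mem_basicOpen_top f x).1 ?_
  have := h (T.residueField x) (T.fromSpecResidueField x)
  rw [← mem_basicOpen_field (K := T.residueField x) (T.fromSpecResidueField x) f
    (IsLocalRing.closedPoint _)] at this
  have e : T.fromSpecResidueField x (IsLocalRing.closedPoint (T.residueField x)) = x :=
    Scheme.fromSpecResidueField_apply _ _
  exact e ▸ this

namespace VecBundleData
variable {X : Scheme.{u}} (E : VecBundleData X)

structure IsGen {T : Scheme.{u}} (a : T ⟶ E.tot) : Prop where
  ex : ∀ {T' : Scheme.{u}} (t : T' ⟶ T) (b : T' ⟶ E.tot), b ≫ E.π = t ≫ a ≫ E.π →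
    ∃! f : Γ(T', ⊤), E.smul f (t ≫ a) = b

open Classical in
def ratio {T : Scheme.{u}} (a b : T ⟶ E.tot) : Γ(T, ⊤) :=
  if h : ∃ f, E.smul f a = b then h.choose else 0

variable {E}
theorem IsGen.pull {T T' : Scheme.{u}} {a : T ⟶ E.tot} (ha : E.IsGen a) (s : T' ⟶ T) :
    E.IsGen (s ≫ a) := by
  refine ⟨fun {T''} t b hb => ?_⟩
  have := ha.ex (t ≫ s) b (by simpa using hb)
  simpa using this

theorem IsGen.exists_smul {T : Scheme.{u}} {a : T ⟶ E.tot} (ha : E.IsGen a) {b : T ⟶ E.tot}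
    (h : b ≫ E.π = a ≫ E.π) : ∃ f, E.smul f a = b := by
  obtain ⟨f, hf, -⟩ := ha.ex (𝟙 T) b (by simpa using h)
  exact ⟨f, by simpa using hf⟩

theorem IsGen.smul_inj {T : Scheme.{u}} {a : T ⟶ E.tot} (ha : E.IsGen a) {f g : Γ(T, ⊤)}
    (h : E.smul f a = E.smul g a) : f = g := by
  obtain ⟨f', -, hf⟩ := ha.ex (𝟙 T) (E.smul g a) (by rw [E.smul_π]; simp)
  rw [hf f (by simpa using h), hf g (by simp)]

theorem IsGen.smul_ratio {T : Scheme.{u}} {a : T ⟶ E.tot} (ha : E.IsGen a) {b : T ⟶ E.tot}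
    (h : b ≫ E.π = a ≫ E.π) : E.smul (E.ratio a b) a = b := by
  have := ha.exists_smul h
  rw [ratio, dif_pos this]
  exact this.choose_spec

theorem IsGen.ratio_eq {T : Scheme.{u}} {a : T ⟶ E.tot} (ha : E.IsGen a) {b : T ⟶ E.tot}
    {f : Γ(T, ⊤)} (h : E.smul f a = b) : E.ratio a b = f :=
  ha.smul_inj ((ha.smul_ratio (by rw [← h, E.smul_π])).trans h.symm)

theorem IsGen.ratio_natural {T T' : Scheme.{u}} {a : T ⟶ E.tot} (ha : E.IsGen a) {b : T ⟶ E.tot}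
    (h : b ≫ E.π = a ≫ E.π) (t : T' ⟶ T) :
    E.ratio (t ≫ a) (t ≫ b) = t.appTop (E.ratio a b) := by
  refine (ha.pull t).ratio_eq ?_
  rw [← E.smul_natural, ha.smul_ratio h]

theorem IsGen.ratio_mul {T : Scheme.{u}} {a b c : T ⟶ E.tot} (ha : E.IsGen a) (hb : E.IsGen b)
    (h : b ≫ E.π = a ≫ E.π) (h' : c ≫ E.π = b ≫ E.π) :
    E.ratio a b * E.ratio b c = E.ratio a c := by
  refine (ha.ratio_eq ?_).symm
  rw [mul_comm, E.mul_smul, ha.smul_ratio h, hb.smul_ratio h']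

theorem IsGen.ratio_self {T : Scheme.{u}} {a : T ⟶ E.tot} (ha : E.IsGen a) : E.ratio a a = 1 :=
  ha.ratio_eq (E.one_smul a)

theorem IsGen.isUnit_ratio {T : Scheme.{u}} {a b : T ⟶ E.tot} (ha : E.IsGen a) (hb : E.IsGen b)
    (h : b ≫ E.π = a ≫ E.π) : IsUnit (E.ratio a b) :=
  IsUnit.of_mul_eq_one (E.ratio b a) (by rw [ha.ratio_mul hb h h.symm, ha.ratio_self])

theorem IsGen.smul_unit {T : Scheme.{u}} {a : T ⟶ E.tot} (ha : E.IsGen a) {f : Γ(T, ⊤)}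
    (hf : IsUnit f) : E.IsGen (E.smul f a) := by
  obtain ⟨g, hg⟩ := hf.exists_right_inv
  refine ⟨fun {T'} t b hb => ?_⟩
  rw [E.smul_π] at hb
  obtain ⟨f', hf', hu⟩ := ha.ex t b hb
  have h1 : t.appTop f * t.appTop g = 1 := by rw [← map_mul, hg, map_one]
  refine ⟨f' * t.appTop g, ?_, fun f'' h => ?_⟩
  · dsimp only
    rw [E.smul_natural, ← E.mul_smul, mul_assoc, mul_comm (t.appTop g), h1, mul_one, hf']
  · dsimp only at h
    rw [E.smul_natural, ← E.mul_smul] at h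
    rw [← hu _ h, mul_assoc, h1, mul_one]

theorem IsGen.isUnit_of_smul {T : Scheme.{u}} {a : T ⟶ E.tot} (ha : E.IsGen a) {f : Γ(T, ⊤)}
    (hf : E.IsGen (E.smul f a)) : IsUnit f := by
  rw [← ha.ratio_eq (f := f) rfl]
  exact ha.isUnit_ratio hf (E.smul_π _ _)

theorem isGen_of_cover {T : Scheme.{u}} {a : T ⟶ E.tot} (𝓤 : T.OpenCover)
    (h : ∀ i, E.IsGen (𝓤.f i ≫ a)) : E.IsGen a := by
  refine ⟨fun {T'} t b hb => ?_⟩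
  let 𝓥 := 𝓤.pullback₁ t
  have hc : ∀ i : 𝓤.I₀, pullback.fst t (𝓤.f i) ≫ t ≫ a = pullback.snd t (𝓤.f i) ≫ 𝓤.f i ≫ a :=
    fun i => by rw [← Category.assoc, pullback.condition, Category.assoc]
  have hg : ∀ i : 𝓥.I₀, E.IsGen (𝓥.f i ≫ t ≫ a) := fun i => by
    have := (h i).pull (pullback.snd t (𝓤.f i))
    rw [← hc i] at this
    exact this
  have hπ : ∀ i : 𝓥.I₀, (𝓥.f i ≫ b) ≫ E.π = (𝓥.f i ≫ t ≫ a) ≫ E.π := by simp [hb]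
  obtain ⟨f, hf⟩ := exists_glue_cover 𝓥 (fun i => E.ratio (𝓥.f i ≫ t ≫ a) (𝓥.f i ≫ b)) (by
    intro i j
    rw [← (hg i).ratio_natural (hπ i), ← (hg j).ratio_natural (hπ j)]
    simp only [← Category.assoc]
    rw [pullback.condition])
  refine ⟨f, ?_, fun f' hf' => ?_⟩
  · refine Scheme.Cover.hom_ext 𝓥 _ _ fun i => ?_
    rw [E.smul_natural, hf, (hg i).smul_ratio (hπ i)]
  · refine appTop_ext_of_cover 𝓥 fun i => ?_
    rw [hf, (hg i).ratio_eq]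
    rw [← E.smul_natural]
    exact congrArg _ hf'

theorem isFrame_iff {U : X.Opens} {s : Fin 1 → (U.toScheme ⟶ E.tot)} :
    E.IsFrame U s ↔ s 0 ≫ E.π = U.ι ∧ E.IsGen (s 0) := by
  constructor
  · rintro ⟨hs, h⟩
    refine ⟨hs 0, ⟨fun {T'} t b hb => ?_⟩⟩
    obtain ⟨h1, h2⟩ := h t
    rw [hs 0] at hb
    obtain ⟨f, hf⟩ := h2 ⟨b, hb⟩
    refine ⟨f 0, ?_, fun g hg => ?_⟩
    · have := congrArg Subtype.val hf
      simpa using this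
    · have := @h1 (fun _ => g) f (by
        rw [hf]
        exact Subtype.ext (by simpa using hg))
      rw [← this]
  · rintro ⟨h0, hg⟩
    have hs : ∀ i, s i ≫ E.π = U.ι := fun i => by rw [Subsingleton.elim i 0, h0]
    refine ⟨hs, fun {T} x => ⟨fun f g h => ?_, fun b => ?_⟩⟩
    · funext i
      rw [Subsingleton.elim i 0]
      have := congrArg Subtype.val h
      simp only [Finset.univ_unique, Fin.default_eq_zero, Finset.sum_singleton, coe_fiber_smul] at this
      exact (hg.pull x).smul_inj this
    · obtain ⟨f, hf, -⟩ := hg.ex x b.1 (by rw [h0]; exact b.2)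
      exact ⟨fun _ => f, Subtype.ext (by simpa using hf)⟩

theorem isGlobalFrame_iff {s : Fin 1 → (X ⟶ E.tot)} :
    E.IsGlobalFrame s ↔ s 0 ≫ E.π = 𝟙 X ∧ E.IsGen (s 0) := by
  constructor
  · rintro ⟨hs, h⟩
    refine ⟨hs 0, ⟨fun {T'} t b hb => ?_⟩⟩
    obtain ⟨h1, h2⟩ := h t
    rw [hs 0, Category.comp_id] at hb
    obtain ⟨f, hf⟩ := h2 ⟨b, hb⟩
    refine ⟨f 0, ?_, fun g hg => ?_⟩
    · have := congrArg Subtype.val hf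
      simpa using this
    · have := @h1 (fun _ => g) f (by
        rw [hf]
        exact Subtype.ext (by simpa using hg))
      rw [← this]
  · rintro ⟨h0, hg⟩
    have hs : ∀ i, s i ≫ E.π = 𝟙 X := fun i => by rw [Subsingleton.elim i 0, h0]
    refine ⟨hs, fun {T} x => ⟨fun f g h => ?_, fun b => ?_⟩⟩
    · funext i
      rw [Subsingleton.elim i 0]
      have := congrArg Subtype.val h
      simp only [Finset.univ_unique, Fin.default_eq_zero, Finset.sum_singleton, coe_fiber_smul] at this
      exact (hg.pull x).smul_inj this
    · obtain ⟨f, hf, -⟩ := hg.ex x b.1 (by rw [h0, Category.comp_id]; exact b.2)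
      exact ⟨fun _ => f, Subtype.ext (by simpa using hf)⟩

/-- the zero vector over a nontrivial point is not a generator -/
theorem IsGen.ne_zero {K : Type u} [Field K] {a : Spec (.of K) ⟶ E.tot} (ha : E.IsGen a) :
    a ≠ (a ≫ E.π) ≫ E.zero := by
  intro h
  rw [← E.zero_smul] at h
  have := ha.smul_inj ((E.one_smul a).trans h)
  have h2 := congrArg (evalHom (𝟙 (Spec (.of K)))) this
  simp at h2

end VecBundleData

open VecBundleData

theorem exists_local_gen {X : Scheme.{u}} (L : LineBundle X) {T : Scheme.{u}} (x : T ⟶ X) :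
    ∀ t : T, ∃ V : T.Opens, t ∈ V ∧ ∃ a : V.toScheme ⟶ L.tot, a ≫ L.π = V.ι ≫ x ∧ L.IsGen a := by
  intro t
  obtain ⟨U, s, hU, hs⟩ := L.locTriv (x t)
  rw [isFrame_iff] at hs
  refine ⟨x ⁻¹ᵁ U, hU, (x ∣_ U) ≫ s 0, ?_, hs.2.pull _⟩
  rw [Category.assoc, hs.1, morphismRestrict_ι]

theorem isGen_of_fields {X : Scheme.{u}} (L : LineBundle X) {T : Scheme.{u}} (a : T ⟶ L.tot)
    (h : ∀ (K : Type u) [Field K] (t : Spec (.of K) ⟶ T),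
      t ≫ a ≠ ((t ≫ a) ≫ L.π) ≫ L.zero) : L.IsGen a := by
  obtain ⟨𝓤, h𝓤⟩ := exists_cover_of_nhds _ (exists_local_gen L (a ≫ L.π))
  refine isGen_of_cover 𝓤 fun i => ?_
  obtain ⟨V, ⟨b, hb, hg⟩, e, he⟩ := h𝓤 i
  rw [he, Category.assoc]
  refine IsGen.pull ?_ _
  obtain ⟨f, hf⟩ := hg.exists_smul (b := V.ι ≫ a) (by rw [hb]; simp)
  rw [← hf]
  refine hg.smul_unit (isUnit_of_fields fun K _ t h0 => ?_)
  refine h K (t ≫ V.ι) ?_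
  rw [← L.zero_smul, Category.assoc, ← hf, L.smul_natural]
  have : t.appTop f = 0 := by
    rw [evalAt] at h0
    exact (ConcreteCategory.bijective_of_isIso (Scheme.ΓSpecIso (.of K)).hom).1 (h0.trans (map_zero _).symm)
  rw [this, ← L.mul_smul, zero_mul]

end
end

section
noncomputable section
open VecBundleData

/-- field points lift along surjective morphisms, after a field extension -/
theorem exists_lift_field {T T' : Scheme.{u}} (p : T' ⟶ T) [Surjective p] (K : Type u) [Field K]
    (t : Spec (.of K) ⟶ T) : ∃ (K' : Type u) (_ : Field K') (s : Spec (.of K') ⟶ T')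
      (j : Spec (.of K') ⟶ Spec (.of K)), s ≫ p = j ≫ t := by
  obtain ⟨y, hy⟩ := (pullback.snd p t).surjective (IsLocalRing.closedPoint K)
  refine ⟨(pullback p t).residueField y, inferInstance,
    (pullback p t).fromSpecResidueField y ≫ pullback.fst p t,
    (pullback p t).fromSpecResidueField y ≫ pullback.snd p t, ?_⟩
  exact (Category.assoc _ _ _).trans ((congrArg _ pullback.condition).trans (Category.assoc _ _ _).symm)

theorem isGen_of_surjective {X : Scheme.{u}} (L : LineBundle X) {T T' : Scheme.{u}} (p : T' ⟶ T)
    [Surjective p] (a : T ⟶ L.tot) (h : L.IsGen (p ≫ a)) : L.IsGen a := by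
  refine isGen_of_fields L a fun K _ t ht => ?_
  obtain ⟨K', _, s, j, e⟩ := exists_lift_field p K t
  refine ((h.pull s)).ne_zero ?_
  have h1 : s ≫ p ≫ a = j ≫ t ≫ a := by rw [← Category.assoc, e, Category.assoc]
  rw [h1]
  conv_lhs => rw [ht]
  simp

theorem vanish_aux1 {X : Scheme.{u}} (N : LineBundle X) (s : X ⟶ N.tot) (hs : s ≫ N.π = 𝟙 X)
    {T : Scheme.{u}} (x : T ⟶ X) (w : T ⟶ N.tot) (hw : w ≫ N.π = x) (hg : N.IsGen w)
    (f : Γ(T, ⊤)) (hf : N.smul f w = x ≫ s) (t : T) :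
    s (x t) ≠ N.zero (x t) → t ∈ T.basicOpen f := by
  intro hne
  by_contra hnm
  apply hne
  have h0 : evalAt (T.fromSpecResidueField t) f = 0 := by
    by_contra h0
    apply hnm
    have := (mem_basicOpen_field (K := T.residueField t) (T.fromSpecResidueField t) f
      (IsLocalRing.closedPoint (T.residueField t))).2 h0
    have e : T.fromSpecResidueField t (IsLocalRing.closedPoint (T.residueField t)) = t :=
      Scheme.fromSpecResidueField_apply _ _
    exact e ▸ this
  have h1 : (T.fromSpecResidueField t).appTop f = 0 :=
    (ConcreteCategory.bijective_of_isIso (Scheme.ΓSpecIso (T.residueField t)).hom).1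
      (h0.trans (map_zero _).symm)
  have h2 : T.fromSpecResidueField t ≫ x ≫ s = T.fromSpecResidueField t ≫ x ≫ N.zero := by
    rw [← hf, N.smul_natural, h1, N.zero_smul]
    simp only [Category.assoc, reassoc_of% hw]
  have h3 := congrArg (fun φ => φ (IsLocalRing.closedPoint (T.residueField t))) h2
  have e : T.fromSpecResidueField t (IsLocalRing.closedPoint (T.residueField t)) = t :=
      Scheme.fromSpecResidueField_apply _ _
  have h4 : s (x (T.fromSpecResidueField t (IsLocalRing.closedPoint (T.residueField t)))) =
    N.zero (x (T.fromSpecResidueField t (IsLocalRing.closedPoint (T.residueField t)))) := h3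
  exact e ▸ h4

theorem vanish_aux2 {X : Scheme.{u}} (N : LineBundle X) (s : X ⟶ N.tot) (hs : s ≫ N.π = 𝟙 X)
    {T : Scheme.{u}} (x : T ⟶ X) [IsOpenImmersion x] (w : T ⟶ N.tot) (hw : w ≫ N.π = x) (hg : N.IsGen w)
    (f : Γ(T, ⊤)) (hf : N.smul f w = x ≫ s) (t : T) :
    t ∈ T.basicOpen f → s (x t) ≠ N.zero (x t) := by
  intro hm he
  -- tautological coordinate on the pullback of the total space
  let P := pullback N.π x
  let a : P ⟶ N.tot := pullback.fst N.π x
  let p : P ⟶ T := pullback.snd N.π x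
  obtain ⟨ev, hev⟩ := (hg.pull p).exists_smul (b := a)
    (by rw [Category.assoc, hw]; exact pullback.condition)
  let σ : T ⟶ P := pullback.lift (x ≫ s) (𝟙 T) (by rw [Category.assoc, hs]; simp)
  let ζ : T ⟶ P := pullback.lift (x ≫ N.zero) (𝟙 T) (by rw [Category.assoc, N.zero_π]; simp)
  have hσ1 : σ ≫ a = x ≫ s := pullback.lift_fst _ _ _
  have hσ2 : σ ≫ p = 𝟙 T := pullback.lift_snd _ _ _
  have hζ1 : ζ ≫ a = x ≫ N.zero := pullback.lift_fst _ _ _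
  have hζ2 : ζ ≫ p = 𝟙 T := pullback.lift_snd _ _ _
  have hσe : σ.appTop ev = f := by
    apply hg.smul_inj
    rw [hf, ← hσ1, ← hev, N.smul_natural, reassoc_of% hσ2]
  have hζe : ζ.appTop ev = 0 := by
    apply hg.smul_inj
    rw [N.zero_smul, hw, ← hζ1, ← hev, N.smul_natural, reassoc_of% hζ2]
  have h1 : σ t ∈ P.basicOpen ev := by
    change t ∈ σ ⁻¹ᵁ P.basicOpen ev
    rwa [Scheme.preimage_basicOpen_top, hσe]
  have h2 : σ t = ζ t := by
    apply a.isOpenEmbedding.injective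
    have e1 : (σ ≫ a) t = (x ≫ s) t := by rw [hσ1]
    have e2 : (ζ ≫ a) t = (x ≫ N.zero) t := by rw [hζ1]
    exact e1.trans (Eq.trans he e2.symm)
  rw [h2] at h1
  change t ∈ ζ ⁻¹ᵁ P.basicOpen ev at h1
  rw [Scheme.preimage_basicOpen_top, hζe, Scheme.basicOpen_zero] at h1
  exact h1

/-- Zero locus of a section in terms of a local generator. -/
theorem vanish_iff {X : Scheme.{u}} (N : LineBundle X) (s : X ⟶ N.tot) (hs : s ≫ N.π = 𝟙 X)
    {T : Scheme.{u}} (x : T ⟶ X) (w : T ⟶ N.tot) (hw : w ≫ N.π = x) (hg : N.IsGen w)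
    (f : Γ(T, ⊤)) (hf : N.smul f w = x ≫ s) (t : T) :
    s (x t) ≠ N.zero (x t) ↔ t ∈ T.basicOpen f := by
  refine ⟨vanish_aux1 N s hs x w hw hg f hf t, fun hm => ?_⟩
  obtain ⟨U, hU, w', hw', hg'⟩ := exists_local_gen N (𝟙 X) (x t)
  rw [Category.comp_id] at hw'
  obtain ⟨f', hf'⟩ := hg'.exists_smul (b := U.ι ≫ s) (by rw [Category.assoc, hs, hw']; simp)
  refine vanish_aux2 N s hs U.ι w' hw' hg' f' hf' ⟨x t, hU⟩ ?_
  let V := x ⁻¹ᵁ U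
  let y := x ∣_ U
  have hy : y ≫ U.ι = V.ι ≫ x := morphismRestrict_ι x U
  have e1 : N.smul (y.appTop f') (y ≫ w') = V.ι ≫ x ≫ s := by
    rw [← N.smul_natural, hf', reassoc_of% hy]
  have e2 : N.smul (V.ι.appTop f) (V.ι ≫ w) = V.ι ≫ x ≫ s := by
    rw [← N.smul_natural, hf]
  have hπ : (V.ι ≫ w) ≫ N.π = (y ≫ w') ≫ N.π := by
    rw [Category.assoc, Category.assoc, hw, hw', hy]
  have h3 := (hg'.pull y).smul_ratio hπ
  rw [← h3, ← N.mul_smul, ← e1] at e2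
  have h4 := (hg'.pull y).smul_inj e2
  have hm' : (⟨t, hU⟩ : V) ∈ V.toScheme.basicOpen (V.ι.appTop f) := by
    rw [← Scheme.preimage_basicOpen_top]; exact hm
  have hm2 : (⟨t, hU⟩ : V) ∈ V.toScheme.basicOpen (y.appTop f') := by
    rw [← h4, Scheme.basicOpen_mul, Scheme.basicOpen_of_isUnit _
      ((hg'.pull y).isUnit_ratio (hg.pull V.ι) hπ)]
    exact ⟨hm', trivial⟩
  rw [← Scheme.preimage_basicOpen_top] at hm2
  have h5 : y ⟨t, hU⟩ = ⟨x t, hU⟩ := by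
    apply U.ι.isOpenEmbedding.injective
    have := congrArg (fun φ => φ (⟨t, hU⟩ : V)) hy
    exact this
  have hm3 : y ⟨t, hU⟩ ∈ U.toScheme.basicOpen f' := hm2
  rwa [h5] at hm3

/-- The `m`-th power map into a tensor power. -/
structure PowMap {X : Scheme.{u}} (L : LineBundle X) (m : ℕ) (N : LineBundle X) : Type (u+1) where
  pw : ∀ {T : Scheme.{u}}, (T ⟶ L.tot) → (T ⟶ N.tot)
  pw_π : ∀ {T : Scheme.{u}} (a : T ⟶ L.tot), pw a ≫ N.π = a ≫ L.π
  pw_nat : ∀ {T T' : Scheme.{u}} (t : T' ⟶ T) (a : T ⟶ L.tot), pw (t ≫ a) = t ≫ pw a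
  pw_smul : ∀ {T : Scheme.{u}} (f : Γ(T, ⊤)) (a : T ⟶ L.tot), pw (L.smul f a) = N.smul (f ^ m) (pw a)
  pw_gen : ∀ {T : Scheme.{u}} (a : T ⟶ L.tot), L.IsGen a → N.IsGen (pw a)

theorem exists_powMap {X : Scheme.{u}} (L : LineBundle X) (m : ℕ) : ∀ (N : LineBundle X),
    IsTensorPow L m N → Nonempty (PowMap L m N) := by
  induction m with
  | zero =>
    rintro N ⟨s, hs⟩
    rw [isGlobalFrame_iff] at hs
    exact ⟨{
      pw := fun a => a ≫ L.π ≫ s 0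
      pw_π := fun a => by rw [Category.assoc, Category.assoc, hs.1, Category.comp_id]
      pw_nat := fun t a => by rw [Category.assoc]
      pw_smul := fun f a => by
        rw [pow_zero, N.one_smul, ← Category.assoc, L.smul_π, Category.assoc]
      pw_gen := fun a _ => by rw [← Category.assoc]; exact hs.2.pull _ }⟩
  | succ m ih =>
    rintro N ⟨M, hM, β, h1, h2, -, -, h5, h6, h7⟩
    obtain ⟨P⟩ := ih M hM
    exact ⟨{
      pw := fun a => β (P.pw a) a (P.pw_π a)
      pw_π := fun a => by rw [h1, P.pw_π]
      pw_nat := fun t a => by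
        rw [h2 t _ _ _ (by rw [Category.assoc, Category.assoc, P.pw_π])]
        congr 1
        exact P.pw_nat t a
      pw_smul := fun f a => by
        have e : ∀ (b c : _ ⟶ M.tot) (hb hc), b = c → β b (L.smul f a) hb = β c (L.smul f a) hc := by
          rintro b c hb hc rfl; rfl
        rw [e _ _ _ (by rw [M.smul_π, L.smul_π, P.pw_π]) (P.pw_smul f a),
          h5 _ _ _ _ (by rw [L.smul_π, P.pw_π]), h6 _ _ _ _ (P.pw_π a), ← N.mul_smul, pow_succ]
      pw_gen := fun {T} a ha => by
        have key : ∀ t : T, ∃ V : T.Opens, t ∈ V ∧ N.IsGen (V.ι ≫ β (P.pw a) a (P.pw_π a)) := by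
          intro t
          obtain ⟨U, hU, w, hw, hg⟩ := exists_local_gen L (𝟙 X) ((a ≫ L.π) t)
          rw [Category.comp_id] at hw
          refine ⟨(a ≫ L.π) ⁻¹ᵁ U, hU, ?_⟩
          have hfr := h7 U (fun _ => P.pw w) (fun _ => w)
            (isFrame_iff.2 ⟨by rw [P.pw_π, hw], P.pw_gen w hg⟩)
            (isFrame_iff.2 ⟨hw, hg⟩) (P.pw_π w)
          have hgen := (isFrame_iff.1 hfr).2.pull ((a ≫ L.π) ∣_ U)
          set V := (a ≫ L.π) ⁻¹ᵁ U
          set y : V.toScheme ⟶ U.toScheme := (a ≫ L.π) ∣_ U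
          have hy : y ≫ U.ι = V.ι ≫ a ≫ L.π := morphismRestrict_ι _ U
          have hπ : (V.ι ≫ a) ≫ L.π = (y ≫ w) ≫ L.π := by
            rw [Category.assoc, Category.assoc, hw, hy]
          have hr := (hg.pull y).smul_ratio hπ
          have hu := (hg.pull y).isUnit_ratio (ha.pull V.ι) hπ
          have e : ∀ (b c : V.toScheme ⟶ M.tot) (b' c' : V.toScheme ⟶ L.tot) (hb hc), b = c → b' = c' →
              β b b' hb = β c c' hc := by
            rintro b c _ _ hb hc rfl rfl; rfl
          rw [h2 _ _ _ _ (by rw [Category.assoc, P.pw_π, Category.assoc])]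
          rw [h2 _ _ _ _ (by rw [Category.assoc, P.pw_π, Category.assoc])] at hgen
          rw [e _ (M.smul (L.ratio (y ≫ w) (V.ι ≫ a) ^ m) (y ≫ P.pw w)) _
            (L.smul (L.ratio (y ≫ w) (V.ι ≫ a)) (y ≫ w)) _
            (by rw [M.smul_π, L.smul_π, Category.assoc, P.pw_π, Category.assoc])
            (by rw [← P.pw_nat, ← P.pw_nat, ← P.pw_smul, hr]) hr.symm]
          rw [h5 _ _ _ _ (by rw [L.smul_π, Category.assoc, P.pw_π, Category.assoc]),
            h6 _ _ _ _ (by rw [Category.assoc, P.pw_π, Category.assoc]), ← N.mul_smul]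
          exact hgen.smul_unit ((hu.pow m).mul hu)
        obtain ⟨𝓤, h𝓤⟩ := exists_cover_of_nhds _ key
        refine isGen_of_cover 𝓤 fun i => ?_
        obtain ⟨V, hV, e, he⟩ := h𝓤 i
        rw [he, Category.assoc]
        exact hV.pull _ }⟩

end
end

section
noncomputable section

structure FrameSys (X : Scheme.{u}) : Type (u+2) where
  Fr : Scheme.{u} → Type (u+1)
  pt : ∀ {T : Scheme.{u}}, Fr T → (T ⟶ X)
  pull : ∀ {T T' : Scheme.{u}} (_ : T' ⟶ T), Fr T → Fr T'
  pt_pull : ∀ {T T' : Scheme.{u}} (t : T' ⟶ T) (w : Fr T), pt (pull t w) = t ≫ pt w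
  pull_comp : ∀ {T T' T'' : Scheme.{u}} (s : T'' ⟶ T') (t : T' ⟶ T) (w : Fr T),
    pull s (pull t w) = pull (s ≫ t) w
  pull_id : ∀ {T : Scheme.{u}} (w : Fr T), pull (𝟙 T) w = w
  c : ∀ {T : Scheme.{u}}, Fr T → Fr T → Γ(T, ⊤)
  c_nat : ∀ {T T' : Scheme.{u}} (t : T' ⟶ T) (w w' : Fr T), pt w = pt w' →
    c (pull t w) (pull t w') = t.appTop (c w w')
  c_self : ∀ {T : Scheme.{u}} (w : Fr T), c w w = 1
  c_mul : ∀ {T : Scheme.{u}} (w w' w'' : Fr T), pt w = pt w' → pt w' = pt w'' →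
    c w w' * c w' w'' = c w w''
  loc : ∀ x : X, ∃ (U : X.Opens) (w : Fr U.toScheme), x ∈ U ∧ pt w = U.ι

theorem appTop_ext_pb {T T' : Scheme.{u}} (𝓤 : T.OpenCover) (t : T' ⟶ T) {s s' : Γ(T', ⊤)}
    (h : ∀ i : 𝓤.I₀, (pullback.fst t (𝓤.f i)).appTop s = (pullback.fst t (𝓤.f i)).appTop s') : s = s' :=
  appTop_ext_of_cover (𝓤.pullback₁ t) h

theorem exists_glue_pb {T T' : Scheme.{u}} (𝓤 : T.OpenCover) (t : T' ⟶ T)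
    (s : ∀ i : 𝓤.I₀, Γ(pullback t (𝓤.f i), ⊤))
    (h : ∀ i j : 𝓤.I₀, (pullback.fst (pullback.fst t (𝓤.f i)) (pullback.fst t (𝓤.f j))).appTop (s i) =
      (pullback.snd (pullback.fst t (𝓤.f i)) (pullback.fst t (𝓤.f j))).appTop (s j)) :
    ∃ a : Γ(T', ⊤), ∀ i : 𝓤.I₀, (pullback.fst t (𝓤.f i)).appTop a = s i :=
  exists_glue_cover (𝓤.pullback₁ t) s h

namespace FrameSys
variable {X : Scheme.{u}} (F : FrameSys X)

theorem exists_cov : ∃ 𝓤 : Scheme.OpenCover.{u} X, ∀ i, ∃ w : F.Fr (𝓤.X i), F.pt w = 𝓤.f i := by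
  obtain ⟨𝓤, h⟩ := exists_cover_of_nhds (T := X)
    (fun U => ∃ w : F.Fr U.toScheme, F.pt w = U.ι)
    (fun x => by obtain ⟨U, w, hx, hw⟩ := F.loc x; exact ⟨U, hx, w, hw⟩)
  refine ⟨𝓤, fun i => ?_⟩
  obtain ⟨V, ⟨w, hw⟩, e, he⟩ := h i
  exact ⟨F.pull (eqToHom e) w, by rw [F.pt_pull, hw, he]⟩

def cov : Scheme.OpenCover.{u} X := F.exists_cov.choose
def fr (i : F.cov.I₀) : F.Fr (F.cov.X i) := (F.exists_cov.choose_spec i).choose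
theorem pt_fr (i : F.cov.I₀) : F.pt (F.fr i) = F.cov.f i := (F.exists_cov.choose_spec i).choose_spec

structure HPt (T : Scheme.{u}) : Type (u+1) where
  x : T ⟶ X
  val : ∀ {T' : Scheme.{u}} (t : T' ⟶ T) (w : F.Fr T'), F.pt w = t ≫ x → Γ(T', ⊤)
  nat : ∀ {T' T'' : Scheme.{u}} (s : T'' ⟶ T') (t : T' ⟶ T) (w : F.Fr T') (h : F.pt w = t ≫ x)
    (h' : F.pt (F.pull s w) = (s ≫ t) ≫ x), val (s ≫ t) (F.pull s w) h' = s.appTop (val t w h)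
  homog : ∀ {T' : Scheme.{u}} (t : T' ⟶ T) (w w' : F.Fr T') (h : F.pt w = t ≫ x)
    (h' : F.pt w' = t ≫ x), val t w h = F.c w w' * val t w' h'

variable {F}
namespace HPt
theorem val_congr {T : Scheme.{u}} (b : F.HPt T) {T' : Scheme.{u}} {t t' : T' ⟶ T} {w w' : F.Fr T'}
    (ht : t = t') (hw : w = w') (h h') : b.val t w h = b.val t' w' h' := by
  subst ht; subst hw; rfl

theorem ext' {T : Scheme.{u}} {b b' : F.HPt T} (hx : b.x = b'.x)
    (hv : ∀ {T' : Scheme.{u}} (t : T' ⟶ T) (w : F.Fr T') (h h'), b.val t w h = b'.val t w h') :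
    b = b' := by
  obtain ⟨x, v, _, _⟩ := b
  obtain ⟨x', v', _, _⟩ := b'
  obtain rfl : x = x' := hx
  have : @v = @v' := by
    funext T' t w h
    exact hv t w h h
  subst this
  rfl

theorem ext_local {T : Scheme.{u}} {b b' : F.HPt T} (hx : b.x = b'.x)
    (hv : ∀ i h h', b.val (pullback.fst b.x (F.cov.f i)) (F.pull (pullback.snd b.x (F.cov.f i)) (F.fr i)) h
      = b'.val (pullback.fst b.x (F.cov.f i)) (F.pull (pullback.snd b.x (F.cov.f i)) (F.fr i)) h') :
    b = b' := by
  refine ext' hx fun {T'} t w h h' => ?_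
  refine appTop_ext_pb F.cov (t ≫ b.x) fun i => ?_
  let j := pullback.fst (t ≫ b.x) (F.cov.f i)
  let r := pullback.snd (t ≫ b.x) (F.cov.f i)
  have hc : j ≫ t ≫ b.x = r ≫ F.cov.f i := pullback.condition
  let l : pullback (t ≫ b.x) (F.cov.f i) ⟶ pullback b.x (F.cov.f i) :=
    pullback.lift (j ≫ t) r (by rw [Category.assoc, hc])
  have hl1 : l ≫ pullback.fst _ _ = j ≫ t := pullback.lift_fst _ _ _
  have hl2 : l ≫ pullback.snd _ _ = r := pullback.lift_snd _ _ _
  have key : ∀ (a : F.HPt T) (ha : a.x = b.x) (h : F.pt w = t ≫ a.x)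
      (h1 : F.pt (F.pull (pullback.snd b.x (F.cov.f i)) (F.fr i)) = pullback.fst b.x (F.cov.f i) ≫ a.x),
      j.appTop (a.val t w h) = F.c (F.pull j w) (F.pull r (F.fr i)) *
        l.appTop (a.val (pullback.fst b.x (F.cov.f i)) (F.pull (pullback.snd b.x (F.cov.f i)) (F.fr i)) h1) := by
    intro a ha h h1
    rw [← a.nat j t w h (by rw [F.pt_pull, h, Category.assoc]),
      ← a.nat l _ _ h1 (by rw [F.pt_pull, h1, Category.assoc]),
      a.homog (j ≫ t) (F.pull j w) (F.pull r (F.fr i)) _ (by rw [F.pt_pull, F.pt_fr, Category.assoc, ha, hc])]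
    congr 1
    refine a.val_congr hl1.symm ?_ _ _
    rw [F.pull_comp, hl2]
  have h1 : F.pt (F.pull (pullback.snd b.x (F.cov.f i)) (F.fr i)) = pullback.fst b.x (F.cov.f i) ≫ b.x := by
    rw [F.pt_pull, F.pt_fr, pullback.condition]
  have h2 : F.pt (F.pull (pullback.snd b.x (F.cov.f i)) (F.fr i)) = pullback.fst b.x (F.cov.f i) ≫ b'.x := by
    rw [h1, hx]
  exact (key b rfl h h1).trans (((congrArg (fun z => _ * l.appTop z) (hv i h1 h2))).trans (key b' hx.symm h' h2).symm)

def pull {T T' : Scheme.{u}} (s : T' ⟶ T) (b : F.HPt T) : F.HPt T' where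
  x := s ≫ b.x
  val t w h := b.val (t ≫ s) w (by rw [h, Category.assoc])
  nat r t w h h' := by
    rw [← b.nat r (t ≫ s) w _ (by rw [h', Category.assoc, Category.assoc, Category.assoc])]
    exact b.val_congr (Category.assoc _ _ _) rfl _ _
  homog t w w' h h' := b.homog _ _ _ _ _

@[simp] theorem pull_x {T T' : Scheme.{u}} (s : T' ⟶ T) (b : F.HPt T) : (b.pull s).x = s ≫ b.x := rfl
theorem pull_val {T T' : Scheme.{u}} (s : T' ⟶ T) (b : F.HPt T) {T'' : Scheme.{u}} (t : T'' ⟶ T') (w : F.Fr T'') (h) :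
    (b.pull s).val t w h = b.val (t ≫ s) w (by rw [h, pull_x, Category.assoc]) := rfl

theorem pull_id {T : Scheme.{u}} (b : F.HPt T) : b.pull (𝟙 T) = b :=
  ext' (Category.id_comp _) fun t w h h' => b.val_congr (Category.comp_id _) rfl _ _

theorem pull_pull {T T' T'' : Scheme.{u}} (s : T'' ⟶ T') (t : T' ⟶ T) (b : F.HPt T) :
    (b.pull t).pull s = b.pull (s ≫ t) :=
  ext' (Category.assoc _ _ _).symm fun r w h h' => b.val_congr (Category.assoc _ _ _) rfl _ _

/-- the point `v • w₀` -/
def ofFr {T : Scheme.{u}} (w₀ : F.Fr T) (v : Γ(T, ⊤)) : F.HPt T where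
  x := F.pt w₀
  val t w _ := F.c w (F.pull t w₀) * t.appTop v
  nat s t w h h' := by
    rw [map_mul, ← F.c_nat s _ _ (by rw [h, F.pt_pull]), F.pull_comp, Scheme.Hom.comp_appTop]; rfl
  homog t w w' h h' := by
    rw [← mul_assoc, F.c_mul _ _ _ (h.trans h'.symm) (by rw [h', F.pt_pull])]

@[simp] theorem ofFr_x {T : Scheme.{u}} (w₀ : F.Fr T) (v : Γ(T, ⊤)) : (ofFr w₀ v).x = F.pt w₀ := rfl
theorem ofFr_val {T : Scheme.{u}} (w₀ : F.Fr T) (v : Γ(T, ⊤)) {T' : Scheme.{u}} (t : T' ⟶ T) (w : F.Fr T') (h) :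
    (ofFr w₀ v).val t w h = F.c w (F.pull t w₀) * t.appTop v := rfl

theorem pull_ofFr {T T' : Scheme.{u}} (s : T' ⟶ T) (w₀ : F.Fr T) (v : Γ(T, ⊤)) :
    (ofFr w₀ v).pull s = ofFr (F.pull s w₀) (s.appTop v) := by
  refine ext' (F.pt_pull _ _).symm fun t w h h' => ?_
  simp only [pull_val, ofFr_val, F.pull_comp, Scheme.Hom.comp_appTop]; rfl

theorem eq_ofFr {T : Scheme.{u}} (b : F.HPt T) (w₀ : F.Fr T) (h : F.pt w₀ = 𝟙 T ≫ b.x) :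
    b = ofFr w₀ (b.val (𝟙 T) w₀ h) := by
  refine ext' (by rw [ofFr_x, h, Category.id_comp]) fun t w h1 h' => ?_
  have h2 : F.pt (F.pull t w₀) = (t ≫ 𝟙 T) ≫ b.x := by rw [F.pt_pull, h]; simp
  rw [ofFr_val, ← b.nat t (𝟙 T) w₀ h h2, b.homog t w (F.pull t w₀) _ (by rw [h2, Category.comp_id])]
  congr 1

theorem ofFr_inj {T : Scheme.{u}} {w₀ : F.Fr T} {v v' : Γ(T, ⊤)} (h : ofFr w₀ v = ofFr w₀ v') :
    v = v' := by
  have h1 : ∀ v, (ofFr w₀ v).val (𝟙 T) w₀ (by simp) = v := by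
    intro v; rw [ofFr_val, F.pull_id, F.c_self, one_mul]; simp
  have : ∀ (b b' : F.HPt T) (e : b = b') (h h'), b.val (𝟙 T) w₀ h = b'.val (𝟙 T) w₀ h' := by
    intro b b' e h h'; subst e; rfl
  exact (h1 v).symm.trans ((this _ _ h _ _).trans (h1 v'))

instance small (T : Scheme.{u}) : Small.{u} (F.HPt T) := by
  let f : F.HPt T → Σ x : T ⟶ X, ∀ i, Γ(pullback x (F.cov.f i), ⊤) := fun b =>
    ⟨b.x, fun i => b.val (pullback.fst b.x (F.cov.f i)) (F.pull (pullback.snd b.x (F.cov.f i)) (F.fr i))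
      (by rw [F.pt_pull, F.pt_fr, pullback.condition])⟩
  refine small_of_injective (f := f) fun b b' hb => ?_
  have key : ∀ (x x' : T ⟶ X) (g : ∀ i, Γ(pullback x (F.cov.f i), ⊤))
      (g' : ∀ i, Γ(pullback x' (F.cov.f i), ⊤)),
      (⟨x, g⟩ : Σ x : T ⟶ X, ∀ i, Γ(pullback x (F.cov.f i), ⊤)) = ⟨x', g'⟩ →
      ∃ e : x = x', ∀ i, g i = (pullback.congrHom e rfl).hom.appTop (g' i) := by
    intro x x' g g' h
    obtain rfl : x = x' := congrArg Sigma.fst h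
    obtain rfl : g = g' := eq_of_heq (Sigma.mk.inj h).2
    exact ⟨rfl, fun i => by simp⟩
  obtain ⟨e, he⟩ := key _ _ _ _ hb
  refine ext_local e fun i h h' => ?_
  refine (he i).trans ?_
  rw [← b'.nat _ _ _ _ (by rw [F.pt_pull, F.pt_pull, F.pt_fr, Category.assoc, pullback.condition])]
  have e1 : (pullback.congrHom e (rfl : F.cov.f i = F.cov.f i)).hom ≫ pullback.fst b'.x (F.cov.f i) =
      pullback.fst b.x (F.cov.f i) := by
    rw [pullback.congrHom_hom]; exact (pullback.lift_fst _ _ _).trans (Category.comp_id _)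
  have e2 : (pullback.congrHom e (rfl : F.cov.f i = F.cov.f i)).hom ≫ pullback.snd b'.x (F.cov.f i) =
      pullback.snd b.x (F.cov.f i) := by
    rw [pullback.congrHom_hom]; exact (pullback.lift_snd _ _ _).trans (Category.comp_id _)
  refine b'.val_congr e1 ?_ _ _
  rw [F.pull_comp, e2]

theorem glue {T : Scheme.{u}} (𝓤 : T.OpenCover) (b : ∀ i, F.HPt (𝓤.X i))
    (hb : ∀ i j, (b i).pull (pullback.fst (𝓤.f i) (𝓤.f j)) = (b j).pull (pullback.snd (𝓤.f i) (𝓤.f j))) :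
    ∃ a : F.HPt T, ∀ i, a.pull (𝓤.f i) = b i := by
  let x : T ⟶ X := 𝓤.glueMorphisms (fun i => (b i).x) (fun i j => congrArg HPt.x (hb i j))
  have hx : ∀ i, 𝓤.f i ≫ x = (b i).x := fun i => 𝓤.ι_glueMorphisms _ _ i
  -- compatibility in general form
  have compat : ∀ (i j) {S : Scheme.{u}} (p : S ⟶ 𝓤.X i) (q : S ⟶ 𝓤.X j)
      (e : p ≫ 𝓤.f i = q ≫ 𝓤.f j) (w : F.Fr S) (h h'), (b i).val p w h = (b j).val q w h' := by
    intro i j S p q e w h h'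
    have h1 := hb i j
    have : ∀ (a a' : F.HPt (pullback (𝓤.f i) (𝓤.f j))) (_ : a = a') {S : Scheme.{u}} (l : S ⟶ _) (w : F.Fr S) (h h'),
        a.val l w h = a'.val l w h' := by
      intro a a' e S l w h h'; subst e; rfl
    have h2 := this _ _ h1 (pullback.lift p q e) w (by rw [h, pull_x, pullback.lift_fst_assoc]) (by rw [h', pull_x, pullback.lift_snd_assoc])
    simp only [pull_val] at h2
    refine (val_congr _ (pullback.lift_fst _ _ _).symm rfl _ _).trans (h2.trans (val_congr _ (pullback.lift_snd _ _ _) rfl _ _))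
  have ex : ∀ {T' : Scheme.{u}} (t : T' ⟶ T) (w : F.Fr T') (h : F.pt w = t ≫ x),
      ∃ a : Γ(T', ⊤), ∀ i, (pullback.fst t (𝓤.f i)).appTop a = (b i).val (pullback.snd t (𝓤.f i))
        (F.pull (pullback.fst t (𝓤.f i)) w) (by rw [F.pt_pull, h, ← hx, pullback.condition_assoc]) := by
    intro T' t w h
    refine exists_glue_pb 𝓤 t _ fun i j => ?_
    have e1 := (b i).nat (pullback.fst (pullback.fst t (𝓤.f i)) (pullback.fst t (𝓤.f j)))
      (pullback.snd t (𝓤.f i)) (F.pull (pullback.fst t (𝓤.f i)) w)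
      (by rw [F.pt_pull, h, ← hx, pullback.condition_assoc])
      (by rw [F.pt_pull, F.pt_pull, h, ← hx]; simp only [Category.assoc]; rw [pullback.condition_assoc (f := t)])
    have e2 := (b j).nat (pullback.snd (pullback.fst t (𝓤.f i)) (pullback.fst t (𝓤.f j)))
      (pullback.snd t (𝓤.f j)) (F.pull (pullback.fst t (𝓤.f j)) w)
      (by rw [F.pt_pull, h, ← hx, pullback.condition_assoc])
      (by rw [F.pt_pull, F.pt_pull, h, ← hx]; simp only [Category.assoc]; rw [pullback.condition_assoc (f := t)])
    refine e1.symm.trans (Eq.trans ?_ e2)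
    have e3 : F.pull (pullback.fst (pullback.fst t (𝓤.f i)) (pullback.fst t (𝓤.f j))) (F.pull (pullback.fst t (𝓤.f i)) w) =
      F.pull (pullback.snd (pullback.fst t (𝓤.f i)) (pullback.fst t (𝓤.f j))) (F.pull (pullback.fst t (𝓤.f j)) w) := by
      rw [F.pull_comp, F.pull_comp, pullback.condition]
    have hh : F.pt (F.pull (pullback.fst (pullback.fst t (𝓤.f i)) (pullback.fst t (𝓤.f j))) (F.pull (pullback.fst t (𝓤.f i)) w)) = (pullback.snd (pullback.fst t (𝓤.f i)) (pullback.fst t (𝓤.f j)) ≫ pullback.snd t (𝓤.f j)) ≫ (b j).x := by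
      rw [e3, F.pt_pull, F.pt_pull, h, ← hx]; simp only [Category.assoc]; rw [pullback.condition_assoc (f := t)]
    refine Eq.trans (compat i j _ (pullback.snd (pullback.fst t (𝓤.f i)) (pullback.fst t (𝓤.f j)) ≫ pullback.snd t (𝓤.f j)) ?_ _ _ hh) (val_congr _ rfl e3 _ _)
    simp only [Category.assoc, ← pullback.condition (f := t)]
    exact pullback.condition_assoc _
  choose v hv using @ex
  have hv' : ∀ {T' : Scheme.{u}} (t : T' ⟶ T) (w : F.Fr T') (h : F.pt w = t ≫ x) i {S : Scheme.{u}}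
      (p : S ⟶ T') (q : S ⟶ 𝓤.X i) (e : p ≫ t = q ≫ 𝓤.f i) (h'), p.appTop (v t w h) =
        (b i).val q (F.pull p w) h' := by
    intro T' t w h i S p q e h'
    have := congrArg (pullback.lift p q e).appTop (hv t w h i)
    rw [← (b i).nat _ _ _ _ (by rw [F.pull_comp, pullback.lift_fst, h', Category.assoc, pullback.lift_snd_assoc])] at this
    refine Eq.trans ?_ (this.trans ?_)
    · rw [← CommRingCat.comp_apply, ← Scheme.Hom.comp_appTop, pullback.lift_fst]
    · refine val_congr _ (pullback.lift_snd _ _ _) ?_ _ _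
      rw [F.pull_comp, pullback.lift_fst]
  refine ⟨⟨x, @v, ?_, ?_⟩, fun i => ?_⟩
  · intro T' T'' s t w h h'
    refine appTop_ext_pb 𝓤 (s ≫ t) fun i => ?_
    have c1 : pullback.fst (s ≫ t) (𝓤.f i) ≫ s ≫ t = pullback.snd (s ≫ t) (𝓤.f i) ≫ 𝓤.f i := pullback.condition
    have e1 := hv (s ≫ t) (F.pull s w) h' i
    have e2 := hv' t w h i (pullback.fst (s ≫ t) (𝓤.f i) ≫ s) (pullback.snd (s ≫ t) (𝓤.f i))
      (by rw [Category.assoc, c1]) (by rw [F.pt_pull, h, ← hx]; simp only [Category.assoc]; rw [reassoc_of% c1])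
    refine e1.trans (Eq.trans ?_ (e2.symm.trans ?_))
    · exact val_congr _ rfl (F.pull_comp _ _ _) _ _
    · rw [Scheme.Hom.comp_appTop]; rfl
  · intro T' t w w' h h'
    refine appTop_ext_pb 𝓤 t fun i => ?_
    refine (hv t w h i).trans (Eq.trans ?_ (map_mul (pullback.fst t (𝓤.f i)).appTop.hom _ _).symm)
    have := hv t w' h' i
    refine Eq.trans ?_ (congrArg (fun z => (pullback.fst t (𝓤.f i)).appTop (F.c w w') * z) this).symm
    rw [← F.c_nat _ _ _ (h.trans h'.symm)]
    exact (b i).homog _ _ _ _ _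
  · refine ext' (hx i) fun {T'} t w h h' => ?_
    have := hv' (t ≫ 𝓤.f i) w (by rw [h, pull_x, Category.assoc]) i (𝟙 _) t (by simp) (by rw [F.pull_id, h'])
    simp only [Scheme.Hom.id_appTop, CommRingCat.id_apply] at this
    exact this.trans (val_congr _ rfl (F.pull_id _) _ _)

theorem sep {T : Scheme.{u}} (𝓤 : T.OpenCover) {a b : F.HPt T}
    (h : ∀ i, a.pull (𝓤.f i) = b.pull (𝓤.f i)) : a = b := by
  have hx : a.x = b.x := Scheme.Cover.hom_ext 𝓤 _ _ fun i => congrArg HPt.x (h i)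
  refine ext' hx fun {T'} t w h1 h2 => appTop_ext_pb 𝓤 t fun i => ?_
  have e : ∀ (c : F.HPt T) (h : F.pt w = t ≫ c.x), (pullback.fst t (𝓤.f i)).appTop (c.val t w h) =
      (c.pull (𝓤.f i)).val (pullback.snd t (𝓤.f i)) (F.pull (pullback.fst t (𝓤.f i)) w)
        (by rw [F.pt_pull, h, pull_x, pullback.condition_assoc]) := by
    intro c h
    rw [← c.nat _ _ _ _ (by rw [F.pt_pull, h, Category.assoc])]
    exact val_congr _ pullback.condition rfl _ _
  have this : ∀ (a a' : F.HPt (𝓤.X i)) (_ : a = a') {S : Scheme.{u}} (l : S ⟶ _) (w : F.Fr S) (h h'),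
        a.val l w h = a'.val l w h' := by
      intro a a' e S l w h h'; subst e; rfl
  exact (e a h1).trans ((this _ _ (h i) _ _ _ _).trans (e b h2).symm)

end HPt
end FrameSys
end
end

section
noncomputable section
namespace FrameSys
variable {X : Scheme.{u}} (F : FrameSys X)

def psh : Scheme.{u}ᵒᵖ ⥤ Type u where
  obj T := Shrink.{u} (F.HPt T.unop)
  map f := ↾fun b => equivShrink _ (((equivShrink _).symm b).pull f.unop)
  map_id T := by
    ext b
    simp [HPt.pull_id]
  map_comp f g := by
    ext b
    simp [HPt.pull_pull]

def pe (T : Scheme.{u}) : F.HPt T ≃ F.psh.obj (op T) := equivShrink _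

theorem psh_map {T T' : Scheme.{u}} (s : T' ⟶ T) (b : F.HPt T) :
    F.psh.map s.op (F.pe T b) = F.pe T' (b.pull s) := by
  refine congrArg (fun z => F.pe T' (HPt.pull s z)) ?_
  exact Equiv.symm_apply_apply _ _

theorem psh_map' {T T' : Scheme.{u}} (s : T' ⟶ T) (b : F.psh.obj (op T)) :
    F.psh.map s.op b = F.pe T' (((F.pe T).symm b).pull s) := rfl

theorem psh_isSheaf : Presieve.IsSheaf Scheme.zariskiTopology F.psh := by
  rw [Scheme.zariskiTopology, Scheme.grothendieckTopology,
    Precoverage.isSheaf_toGrothendieck_iff_of_isStableUnderBaseChange]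
  intro Y S hS
  obtain ⟨(𝓤 : Scheme.OpenCover Y), rfl⟩ := Scheme.exists_cover_of_mem_pretopology hS
  rw [Presieve.isSheafFor_arrows_iff]
  intro x hx
  obtain ⟨a, ha⟩ := HPt.glue 𝓤 (fun i => (F.pe _).symm (x i)) (fun i j => by
    have := hx i j _ (pullback.fst (𝓤.f i) (𝓤.f j)) (pullback.snd (𝓤.f i) (𝓤.f j)) pullback.condition
    exact (F.pe _).injective this)
  refine ⟨F.pe _ a, fun i => ?_, fun b hb => ?_⟩
  · refine (F.psh_map (𝓤.f i) a).trans ?_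
    rw [ha i, Equiv.apply_symm_apply]
  · obtain ⟨b, rfl⟩ := (F.pe (Y)).surjective b
    congr 1
    refine HPt.sep 𝓤 fun i => ?_
    rw [ha i]
    refine (F.pe _).injective (((F.psh_map (𝓤.f i) b).symm.trans (hb i)).trans ?_)
    rw [Equiv.apply_symm_apply]

abbrev chart (i : F.cov.I₀) : Scheme.{u} := F.cov.X i ⨯ A1

def chartPt (i : F.cov.I₀) : F.HPt (F.chart i) :=
  HPt.ofFr (F.pull prod.fst (F.fr i)) (toA1 _ prod.snd)

def chartMap (i : F.cov.I₀) : yoneda.obj (F.chart i) ⟶ F.psh where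
  app T := ↾fun t => F.pe _ ((F.chartPt i).pull t)
  naturality T T' f := by
    ext (t : T.unop ⟶ _)
    refine Eq.trans ?_ (F.psh_map f.unop _).symm
    exact congrArg (F.pe _) (HPt.pull_pull _ _ _).symm

theorem chartPt_pull (i : F.cov.I₀) {T : Scheme.{u}} (t : T ⟶ F.chart i) :
    (F.chartPt i).pull t = HPt.ofFr (F.pull (t ≫ prod.fst) (F.fr i)) (toA1 _ (t ≫ prod.snd)) := by
  rw [chartPt, HPt.pull_ofFr, F.pull_comp, toA1_comp]

def toX : F.psh ⟶ yoneda.obj X where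
  app T := ↾fun b => ((F.pe _).symm b).x
  naturality T T' f := by
    ext t
    exact congrArg HPt.x (Equiv.symm_apply_apply (F.pe _) _)

theorem chart_isPullback (i : F.cov.I₀) :
    IsPullback (yoneda.map prod.fst) (F.chartMap i) (yoneda.map (F.cov.f i)) F.toX := by
  refine IsPullback.of_forall_isPullback_app fun T => ?_
  rw [Types.isPullback_iff]
  refine ⟨?_, ?_, ?_⟩
  · ext (t : T.unop ⟶ F.chart i)
    have : (t ≫ prod.fst) ≫ F.cov.f i = ((F.pe _).symm (F.pe _ ((F.chartPt i).pull t))).x := by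
      rw [Equiv.symm_apply_apply, chartPt_pull, HPt.ofFr_x, F.pt_pull, F.pt_fr]
    exact this
  · rintro (t : T.unop ⟶ F.chart i) (t' : T.unop ⟶ F.chart i) ⟨h1, h2⟩
    replace h1 : t ≫ prod.fst = t' ≫ prod.fst := h1
    replace h2 : (F.chartPt i).pull t = (F.chartPt i).pull t' := (F.pe _).injective h2
    refine prod.hom_ext h1 ?_
    rw [chartPt_pull, chartPt_pull, h1] at h2
    exact (toA1 _).injective (HPt.ofFr_inj h2)
  · rintro (y : T.unop ⟶ F.cov.X i) b h
    obtain ⟨b, rfl⟩ := (F.pe (T.unop)).surjective b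
    replace h : y ≫ F.cov.f i = b.x := by
      have : y ≫ F.cov.f i = ((F.pe _).symm (F.pe _ b)).x := h
      rwa [Equiv.symm_apply_apply] at this
    have h1 : F.pt (F.pull y (F.fr i)) = 𝟙 _ ≫ b.x := by rw [F.pt_pull, F.pt_fr, h, Category.id_comp]
    refine ⟨prod.lift y ((toA1 _).symm (b.val (𝟙 _) (F.pull y (F.fr i)) h1)), ?_, ?_⟩
    · have : prod.lift y ((toA1 _).symm (b.val (𝟙 _) (F.pull y (F.fr i)) h1)) ≫
        (prod.fst : F.chart i ⟶ F.cov.X i) = y := prod.lift_fst _ _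
      exact this
    · refine congrArg (F.pe _) ?_
      rw [chartPt_pull, prod.lift_fst, prod.lift_snd, Equiv.apply_symm_apply]
      exact (b.eq_ofFr _ h1).symm

theorem chart_open (i : F.cov.I₀) : IsOpenImmersion.presheaf (F.chartMap i) := by
  have h1 : IsOpenImmersion.presheaf (yoneda.map (F.cov.f i)) :=
    MorphismProperty.relative_map (P := @IsOpenImmersion) (F.cov.map_prop i)
  exact (MorphismProperty.relative_isStableUnderBaseChange (F := yoneda) (@IsOpenImmersion)).of_isPullback
    (F.chart_isPullback i) h1

instance : Presheaf.IsLocallySurjective Scheme.zariskiTopology (Sigma.desc F.chartMap) where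
  imageSieve_mem {U} s := by
    obtain ⟨b, rfl⟩ := (F.pe (U)).surjective s
    refine GrothendieckTopology.superset_covering _ ?_
      (Scheme.Cover.mem_grothendieckTopology (F.cov.pullback₁ b.x))
    rw [Sieve.generate_le_iff]
    rintro V _ ⟨i⟩
    let i : F.cov.I₀ := i
    have hc : pullback.fst b.x (F.cov.f i) ≫ b.x = pullback.snd b.x (F.cov.f i) ≫ F.cov.f i := pullback.condition
    have h1 : F.pt (F.pull (pullback.snd b.x (F.cov.f i)) (F.fr i)) = 𝟙 _ ≫ (b.pull (pullback.fst b.x (F.cov.f i))).x := by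
      rw [F.pt_pull, F.pt_fr, Category.id_comp, HPt.pull_x, hc]
    let t : pullback b.x (F.cov.f i) ⟶ F.chart i := prod.lift (pullback.snd b.x (F.cov.f i))
      ((toA1 _).symm ((b.pull (pullback.fst b.x (F.cov.f i))).val (𝟙 _) _ h1))
    refine ⟨(Sigma.ι (fun i => yoneda.obj (F.chart i)) i).app (op (pullback b.x (F.cov.f i))) t, ?_⟩
    have h2 : (F.chartMap i).app (op (pullback b.x (F.cov.f i))) t = F.psh.map (pullback.fst b.x (F.cov.f i)).op (F.pe _ b) := by
      rw [psh_map]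
      refine congrArg (F.pe _) ?_
      rw [chartPt_pull, prod.lift_fst, prod.lift_snd, Equiv.apply_symm_apply]
      exact (HPt.eq_ofFr _ _ h1).symm
    refine Eq.trans ?_ h2
    rw [← Sigma.ι_desc F.chartMap i]
    rfl

theorem exists_rep : ∃ Y : Scheme.{u}, Nonempty (F.psh.RepresentableBy Y) :=
  ⟨_, ⟨Scheme.LocalRepresentability.representableBy (F := ⟨F.psh, (isSheaf_iff_isSheaf_of_type _ _).2 F.psh_isSheaf⟩)
    (f := F.chartMap) F.chart_open⟩⟩

def tot : Scheme.{u} := F.exists_rep.choose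
def rep : F.psh.RepresentableBy F.tot := F.exists_rep.choose_spec.some

/-- points of the total space -/
def pts (T : Scheme.{u}) : (T ⟶ F.tot) ≃ F.HPt T := F.rep.homEquiv.trans (F.pe _).symm

theorem pts_comp {T T' : Scheme.{u}} (s : T' ⟶ T) (a : T ⟶ F.tot) :
    F.pts T' (s ≫ a) = (F.pts T a).pull s := by
  simp only [pts, Equiv.trans_apply, F.rep.homEquiv_comp]
  apply (F.pe _).injective
  rw [Equiv.apply_symm_apply]
  rfl

end FrameSys
end
end

section
noncomputable section
namespace FrameSys
variable {X : Scheme.{u}} {F : FrameSys X}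
namespace HPt
def addPt {T : Scheme.{u}} (a b : F.HPt T) (h : a.x = b.x) : F.HPt T where
  x := a.x
  val t w hw := a.val t w hw + b.val t w (by rw [hw, h])
  nat s t w h1 h2 := by rw [map_add, a.nat, b.nat]
  homog t w w' h1 h2 := by rw [mul_add, ← a.homog, ← b.homog]

theorem addPt_val {T : Scheme.{u}} (a b : F.HPt T) (h : a.x = b.x) {T' : Scheme.{u}} (t : T' ⟶ T) (w : F.Fr T') (hw) :
  (addPt a b h).val t w hw = a.val t w hw + b.val t w (hw.trans (congrArg (t ≫ ·) h)) := rfl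

def smulPt {T : Scheme.{u}} (f : Γ(T, ⊤)) (b : F.HPt T) : F.HPt T where
  x := b.x
  val t w hw := t.appTop f * b.val t w hw
  nat s t w h1 h2 := by rw [map_mul, b.nat, Scheme.Hom.comp_appTop]; rfl
  homog t w w' h1 h2 := by rw [b.homog t w w' h1 h2]; ring

theorem smulPt_val {T : Scheme.{u}} (f : Γ(T, ⊤)) (b : F.HPt T) {T' : Scheme.{u}} (t : T' ⟶ T) (w : F.Fr T') (hw) :
  (smulPt f b).val t w hw = t.appTop f * b.val t w hw := rfl

variable (F) in
def zeroPt {T : Scheme.{u}} (x : T ⟶ X) : F.HPt T where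
  x := x
  val t w hw := 0
  nat s t w h1 h2 := by rw [map_zero]
  homog t w w' h1 h2 := by rw [mul_zero]

theorem zeroPt_val {T : Scheme.{u}} (x : T ⟶ X) {T' : Scheme.{u}} (t : T' ⟶ T) (w : F.Fr T') (hw) :
  (zeroPt F x).val t w hw = 0 := rfl
@[simp] theorem addPt_x {T : Scheme.{u}} (a b : F.HPt T) (h : a.x = b.x) : (addPt a b h).x = a.x := rfl
@[simp] theorem smulPt_x {T : Scheme.{u}} (f : Γ(T, ⊤)) (b : F.HPt T) : (smulPt f b).x = b.x := rfl
@[simp] theorem zeroPt_x {T : Scheme.{u}} (x : T ⟶ X) : (zeroPt F x).x = x := rfl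

theorem pull_smulPt {T T' : Scheme.{u}} (s : T' ⟶ T) (f : Γ(T, ⊤)) (b : F.HPt T) :
    (smulPt f b).pull s = smulPt (s.appTop f) (b.pull s) :=
  ext' rfl fun t w h h' => by
    simp only [pull_val, smulPt_val, Scheme.Hom.comp_appTop]; rfl
theorem pull_addPt {T T' : Scheme.{u}} (s : T' ⟶ T) (a b : F.HPt T) (h) (h') :
    (addPt a b h).pull s = addPt (a.pull s) (b.pull s) h' :=
  ext' rfl fun t w h h' => rfl
theorem pull_zeroPt {T T' : Scheme.{u}} (s : T' ⟶ T) (x : T ⟶ X) :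
    (zeroPt F x).pull s = zeroPt F (s ≫ x) :=
  ext' rfl fun t w h h' => rfl
theorem addPt_congr {T : Scheme.{u}} {a a' b b' : F.HPt T} (ha : a = a') (hb : b = b') (h h') :
    addPt a b h = addPt a' b' h' := by subst ha; subst hb; rfl
theorem val_congr_pt {T : Scheme.{u}} {b b' : F.HPt T} (e : b = b') {T' : Scheme.{u}} (t : T' ⟶ T) (w : F.Fr T')
    (h h') : b.val t w h = b'.val t w h' := by subst e; rfl
end HPt
open HPt
variable (F)
def proj : F.tot ⟶ X := (F.pts _ (𝟙 _)).x
theorem comp_proj {T : Scheme.{u}} (a : T ⟶ F.tot) : a ≫ F.proj = (F.pts T a).x := by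
  have := F.pts_comp a (𝟙 _)
  rw [Category.comp_id] at this
  rw [this, pull_x]; rfl
def zeroS : X ⟶ F.tot := (F.pts X).symm (zeroPt F (𝟙 X))
theorem pts_zeroS {T : Scheme.{u}} (x : T ⟶ X) : F.pts T (x ≫ F.zeroS) = zeroPt F x := by
  rw [pts_comp, zeroS, Equiv.apply_symm_apply, pull_zeroPt, Category.comp_id]
theorem proj_eq_iff {T : Scheme.{u}} {a b : T ⟶ F.tot} : a ≫ F.proj = b ≫ F.proj ↔ (F.pts T a).x = (F.pts T b).x := by
  rw [comp_proj, comp_proj]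
def addT {T : Scheme.{u}} (a b : T ⟶ F.tot) (h : a ≫ F.proj = b ≫ F.proj) : T ⟶ F.tot :=
  (F.pts T).symm (addPt (F.pts T a) (F.pts T b) (F.proj_eq_iff.1 h))
theorem pts_addT {T : Scheme.{u}} (a b : T ⟶ F.tot) (h : a ≫ F.proj = b ≫ F.proj) :
   F.pts T (F.addT a b h) = addPt (F.pts T a) (F.pts T b) (F.proj_eq_iff.1 h) := Equiv.apply_symm_apply _ _
def smulT {T : Scheme.{u}} (f : Γ(T, ⊤)) (a : T ⟶ F.tot) : T ⟶ F.tot :=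
  (F.pts T).symm (smulPt f (F.pts T a))
theorem pts_smulT {T : Scheme.{u}} (f : Γ(T, ⊤)) (a : T ⟶ F.tot) :
   F.pts T (F.smulT f a) = smulPt f (F.pts T a) := Equiv.apply_symm_apply _ _

theorem pts_ext {T : Scheme.{u}} {a b : T ⟶ F.tot} (hx : (F.pts T a).x = (F.pts T b).x)
   (h : ∀ {T' : Scheme.{u}} (t : T' ⟶ T) (w : F.Fr T') (h h'), (F.pts T a).val t w h = (F.pts T b).val t w h') : a = b :=
  (F.pts T).injective (ext' hx h)

def bdlData : VecBundleData X where
  tot := F.tot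
  π := F.proj
  zero := F.zeroS
  zero_π := by
    rw [comp_proj]
    have := F.pts_zeroS (𝟙 X)
    rw [Category.id_comp] at this; rw [this]; rfl
  add a b h := F.addT a b h
  smul f a := F.smulT f a
  add_π a b h := by rw [comp_proj, comp_proj, pts_addT]; rfl
  smul_π f a := by rw [comp_proj, comp_proj, pts_smulT]; rfl
  add_natural g a b h h' := by
    apply (F.pts _).injective
    rw [pts_comp, pts_addT, pts_addT, pull_addPt _ _ _ _ (by rw [pull_x, pull_x, F.proj_eq_iff.1 h])]
    exact addPt_congr (F.pts_comp _ _).symm (F.pts_comp _ _).symm _ _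
  smul_natural g f a := by
    apply (F.pts _).injective
    rw [pts_comp, pts_smulT, pts_smulT, pull_smulPt, pts_comp]
  add_comm a b h h' := by
    apply (F.pts _).injective
    rw [pts_addT, pts_addT]
    exact ext' (F.proj_eq_iff.1 h) fun t w h h' => by rw [addPt_val, addPt_val, add_comm]
  add_assoc a b c h₁ h₂ h₃ h₄ := by
    apply (F.pts _).injective
    have e1 := F.proj_eq_iff.1 h₁
    have e3 := F.proj_eq_iff.1 h₃
    refine (F.pts_addT _ _ _).trans (Eq.trans ?_ (F.pts_addT _ _ _).symm)
    refine (addPt_congr (F.pts_addT a b h₁) rfl _ (e1.trans e3)).trans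
      (Eq.trans ?_ (addPt_congr rfl (F.pts_addT b c h₃) (F.proj_eq_iff.1 h₄) e1).symm)
    exact ext' rfl fun t w h h' => add_assoc _ _ _
  zero_add a h := by
    apply (F.pts _).injective
    rw [pts_addT]
    refine (addPt_congr (F.pts_zeroS _) rfl _ (F.comp_proj a)).trans ?_
    exact ext' (F.comp_proj a) fun t w h h' => zero_add _
  one_smul a := by
    apply (F.pts _).injective
    rw [pts_smulT]
    exact ext' rfl fun t w h h' => by rw [smulPt_val, map_one, one_mul]
  mul_smul f g a := by
    apply (F.pts _).injective
    rw [pts_smulT, pts_smulT, pts_smulT]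
    exact ext' rfl fun t w h h' => (congrArg (· * _) (map_mul t.appTop.hom f g)).trans (mul_assoc _ _ _)
  smul_add f a b h h' := by
    apply (F.pts _).injective
    rw [pts_smulT, pts_addT, pts_addT]
    refine Eq.trans ?_ (addPt_congr (F.pts_smulT _ _).symm (F.pts_smulT _ _).symm (F.proj_eq_iff.1 h) _)
    exact ext' rfl fun t w h h' => mul_add _ _ _
  add_smul f g a h := by
    apply (F.pts _).injective
    rw [pts_smulT, pts_addT]
    refine Eq.trans ?_ (addPt_congr (F.pts_smulT f a).symm (F.pts_smulT g a).symm rfl _)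
    exact ext' rfl fun t w h h' => (congrArg (· * _) (map_add t.appTop.hom f g)).trans (add_mul _ _ _)
  zero_smul a := by
    apply (F.pts _).injective
    rw [pts_smulT, pts_zeroS]
    exact ext' (by rw [smulPt_x, comp_proj]; rfl) fun t w h h' => by rw [smulPt_val, map_zero, zero_mul, zeroPt_val]
  smul_zero f x := by
    apply (F.pts _).injective
    rw [pts_smulT, pts_zeroS]
    exact ext' rfl fun t w h h' => mul_zero _

variable {F} in
theorem HPt.smulPt_ofFr {T : Scheme.{u}} (w : F.Fr T) (f v : Γ(T, ⊤)) : smulPt f (ofFr w v) = ofFr w (f * v) :=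
  ext' rfl fun t w' h h' => by
    refine Eq.trans ?_ (congrArg (F.c w' (F.pull t w) * ·) (map_mul t.appTop.hom f v)).symm
    exact mul_left_comm _ _ _

def gen {T : Scheme.{u}} (w : F.Fr T) : T ⟶ F.tot := (F.pts T).symm (ofFr w 1)
theorem pts_gen {T : Scheme.{u}} (w : F.Fr T) : F.pts T (F.gen w) = ofFr w 1 := Equiv.apply_symm_apply _ _
theorem gen_π {T : Scheme.{u}} (w : F.Fr T) : F.gen w ≫ F.bdlData.π = F.pt w := by
  refine (F.comp_proj _).trans ?_
  rw [pts_gen, ofFr_x]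
theorem comp_gen {T T' : Scheme.{u}} (t : T' ⟶ T) (w : F.Fr T) : t ≫ F.gen w = F.gen (F.pull t w) := by
  apply (F.pts _).injective
  rw [pts_comp, pts_gen, pts_gen, pull_ofFr, map_one]
theorem pts_smul_gen {T : Scheme.{u}} (w : F.Fr T) (f : Γ(T, ⊤)) : F.pts T (F.bdlData.smul f (F.gen w)) = ofFr w f := by
  refine (F.pts_smulT _ _).trans ?_
  rw [pts_gen, smulPt_ofFr, mul_one]
theorem isGen_gen {T : Scheme.{u}} (w : F.Fr T) : F.bdlData.IsGen (F.gen w) := by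
  refine ⟨fun {T'} t b hb => ?_⟩
  replace hb := hb.trans (congrArg (t ≫ ·) (F.gen_π w))
  suffices H : ∃! f, F.bdlData.smul f (F.gen (F.pull t w)) = b from
    (congrArg (fun z => ∃! f, F.bdlData.smul f z = b) (F.comp_gen t w)).mpr H
  have hb' : F.pt (F.pull t w) = 𝟙 _ ≫ (F.pts T' b).x := by
    rw [F.pt_pull, Category.id_comp]; exact hb.symm.trans (F.comp_proj b)
  have e := (F.pts T' b).eq_ofFr _ hb'
  refine ⟨_, (F.pts _).injective ((F.pts_smul_gen _ _).trans e.symm), fun f hf => ?_⟩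
  have : ofFr (F.pull t w) f = F.pts T' b := by rw [← pts_smul_gen, hf]
  exact ofFr_inj (this.trans e)

def bdl : LineBundle X where
  toVecBundleData := F.bdlData
  locTriv x := by
    obtain ⟨U, w, hx, hw⟩ := F.loc x
    refine ⟨U, fun _ => F.gen w, hx, VecBundleData.isFrame_iff.2 ⟨?_, F.isGen_gen w⟩⟩
    exact (F.gen_π w).trans hw

theorem isGen_of_frames {Y : LineBundle X} {T : Scheme.{u}} (a : T ⟶ Y.tot)
    (h : ∀ {T' : Scheme.{u}} (t : T' ⟶ T) (w : F.Fr T'), F.pt w = t ≫ a ≫ Y.π → Y.IsGen (t ≫ a)) : Y.IsGen a := by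
  refine VecBundleData.isGen_of_cover (F.cov.pullback₁ (a ≫ Y.π)) ?_
  intro (i : F.cov.I₀)
  refine h (pullback.fst (a ≫ Y.π) (F.cov.f i)) (F.pull (pullback.snd (a ≫ Y.π) (F.cov.f i)) (F.fr i)) ?_
  rw [F.pt_pull, F.pt_fr, pullback.condition]

@[reducible] def pow (m : ℕ) : FrameSys X where
  Fr := F.Fr
  pt := F.pt
  pull := F.pull
  pt_pull := F.pt_pull
  pull_comp := F.pull_comp
  pull_id := F.pull_id
  c w w' := F.c w w' ^ m
  c_nat t w w' h := by rw [F.c_nat t w w' h, map_pow]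
  c_self w := by rw [F.c_self, one_pow]
  c_mul w w' w'' h h' := by rw [← mul_pow, F.c_mul _ _ _ h h']
  loc := F.loc

variable {F} in
def HPt.mulPt {m : ℕ} {T : Scheme.{u}} (a : (F.pow m).HPt T) (b : F.HPt T) (h : a.x = b.x) : (F.pow (m+1)).HPt T where
  x := a.x
  val t w hw := a.val t w hw * b.val t w (by rw [← h]; exact hw)
  nat s t w h1 h2 := by
    rw [map_mul]
    exact congrArg₂ (· * ·) (a.nat _ _ _ _ _) (b.nat _ _ _ _ _)
  homog t w w' h1 h2 := by
    rw [a.homog t w w' h1 h2, b.homog t w w' (by rw [← h]; exact h1) (by rw [← h]; exact h2)]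
    show F.c w w' ^ m * _ * _ = F.c w w' ^ (m+1) * _
    ring

theorem HPt.mulPt_congr {m : ℕ} {T : Scheme.{u}} {a a' : (F.pow m).HPt T} {b b' : F.HPt T} (ha : a = a') (hb : b = b')
    (h h') : mulPt a b h = mulPt a' b' h' := by subst ha; subst hb; rfl

theorem isTensor_pow (m : ℕ) : IsTensor (F.pow m).bdl F.bdl (F.pow (m+1)).bdl := by
  have hx : ∀ {T : Scheme.{u}} {a : T ⟶ (F.pow m).tot} {b : T ⟶ F.tot} (h : a ≫ (F.pow m).proj = b ≫ F.proj),
     ((F.pow m).pts T a).x = (F.pts T b).x := by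
    intro T a b h; rw [← comp_proj, ← comp_proj, h]
  let β : ∀ {T : Scheme.{u}} (a : T ⟶ (F.pow m).tot) (b : T ⟶ F.tot), a ≫ (F.pow m).proj = b ≫ F.proj → (T ⟶ (F.pow (m+1)).tot) :=
    fun {T} a b h => ((F.pow (m+1)).pts T).symm (mulPt ((F.pow m).pts T a) (F.pts T b) (hx h))
  have hβ : ∀ {T : Scheme.{u}} (a : T ⟶ (F.pow m).tot) (b : T ⟶ F.tot) (h), (F.pow (m+1)).pts T (β a b h) =
      (mulPt ((F.pow m).pts T a) (F.pts T b) (hx h)) := fun a b h => Equiv.apply_symm_apply _ _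
  have hs1 : ∀ {T : Scheme.{u}} (f : Γ(T, ⊤)) (a : T ⟶ (F.pow m).tot) (b : T ⟶ F.tot) (h₁ h₂),
      β ((F.pow m).smulT f a) b h₁ = (F.pow (m+1)).smulT f (β a b h₂) := by
    intro T f a b h₁ h₂
    apply ((F.pow (m+1)).pts _).injective
    refine (hβ _ _ h₁).trans (((mulPt_congr F (pts_smulT _ _ _) rfl _ (hx h₂)).trans ?_).trans (pts_smulT _ _ _).symm)
    rw [hβ _ _ h₂]
    exact ext' rfl fun t w h h' => mul_assoc _ _ _
  have hs2 : ∀ {T : Scheme.{u}} (f : Γ(T, ⊤)) (a : T ⟶ (F.pow m).tot) (b : T ⟶ F.tot) (h₁ h₂),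
      β a (F.smulT f b) h₁ = (F.pow (m+1)).smulT f (β a b h₂) := by
    intro T f a b h₁ h₂
    apply ((F.pow (m+1)).pts _).injective
    refine (hβ _ _ h₁).trans (((mulPt_congr F rfl (pts_smulT _ _ _) _ (hx h₂)).trans ?_).trans (pts_smulT _ _ _).symm)
    rw [hβ _ _ h₂]
    exact ext' rfl fun t w h h' => mul_left_comm _ _ _
  have hn : ∀ {T' T : Scheme.{u}} (g : T' ⟶ T) (a : T ⟶ (F.pow m).tot) (b : T ⟶ F.tot) (h h'),
      g ≫ β a b h = β (g ≫ a) (g ≫ b) h' := by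
    intro T' T g a b h h'
    apply ((F.pow (m+1)).pts _).injective
    refine (pts_comp _ _ _).trans (((congrArg (HPt.pull g) (hβ _ _ h)).trans ?_).trans (hβ _ _ h').symm)
    refine Eq.trans ?_ (mulPt_congr F (pts_comp _ _ _).symm (pts_comp _ _ _).symm (by rw [pull_x, pull_x, hx h]) _)
    exact ext' rfl fun t w h h' => rfl
  have hp : ∀ {T : Scheme.{u}} (a : T ⟶ (F.pow m).tot) (b : T ⟶ F.tot) (h), β a b h ≫ (F.pow (m+1)).proj = a ≫ (F.pow m).proj := by
    intro T a b h
    rw [comp_proj, hβ _ _ h, comp_proj]; rfl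
  refine ⟨@β, @hp, @hn, ?_, ?_, @hs1, @hs2, ?_⟩
  · intro T a a' b h₁ h₂ h₃ h₄ h₅
    apply ((F.pow (m+1)).pts _).injective
    refine (hβ _ _ h₂).trans (((mulPt_congr F (pts_addT _ _ _ h₁) rfl _ (hx h₃)).trans ?_).trans (pts_addT _ _ _ h₅).symm)
    refine Eq.trans ?_ (addPt_congr (hβ _ _ h₃).symm (hβ _ _ h₄).symm ((proj_eq_iff _).1 h₁) _)
    exact ext' rfl fun t w h h' => add_mul _ _ _
  · intro T a b b' h₁ h₂ h₃ h₄ h₅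
    apply ((F.pow (m+1)).pts _).injective
    refine (hβ _ _ h₂).trans (((mulPt_congr F rfl (pts_addT _ _ _ h₁) _ (hx h₃)).trans ?_).trans (pts_addT _ _ _ h₅).symm)
    refine Eq.trans ?_ (addPt_congr (hβ _ _ h₃).symm (hβ _ _ h₄).symm rfl _)
    exact ext' rfl fun t w h h' => mul_add _ _ _
  · intro U sL sM hL hM h
    replace hL := VecBundleData.isFrame_iff.1 hL
    replace hM := VecBundleData.isFrame_iff.1 hM
    refine VecBundleData.isFrame_iff.2 ⟨(hp _ _ h).trans hL.1, ?_⟩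
    refine F.isGen_of_frames (Y := (F.pow (m+1)).bdl) _ fun {T'} t w hw => ?_
    have hw1 : F.pt w = t ≫ sL 0 ≫ (F.pow m).proj := hw.trans (congrArg (t ≫ ·) (hp _ _ h))
    have hw2 : F.pt w = t ≫ sM 0 ≫ F.proj := hw1.trans (congrArg (t ≫ ·) h)
    obtain ⟨f, hf⟩ := ((F.pow m).isGen_gen w).exists_smul (b := t ≫ sL 0) (((Category.assoc _ _ _).trans hw1.symm).trans ((F.pow m).gen_π w).symm)
    obtain ⟨g, hg⟩ := (F.isGen_gen w).exists_smul (b := t ≫ sM 0) (((Category.assoc _ _ _).trans hw2.symm).trans (F.gen_π w).symm)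
    have uf : IsUnit f := ((F.pow m).isGen_gen w).isUnit_of_smul (by rw [hf]; exact hL.2.pull t)
    have ug : IsUnit g := (F.isGen_gen w).isUnit_of_smul (by rw [hg]; exact hM.2.pull t)
    have h0 : (F.pow m).gen w ≫ (F.pow m).proj = F.gen w ≫ F.proj :=
      ((F.pow m).gen_π w).trans (F.gen_π w).symm
    have e0 : β ((F.pow m).gen w) (F.gen w) h0 = (F.pow (m+1)).gen w := by
      apply ((F.pow (m+1)).pts _).injective
      refine (hβ _ _ h0).trans (Eq.trans ?_ (pts_gen _ _).symm)
      refine (mulPt_congr F (pts_gen _ _) (pts_gen _ _) _ rfl).trans ?_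
      refine ext' rfl fun t w' h h' => ?_
      show F.c w' (F.pull t w) ^ m * t.appTop 1 * (F.c w' (F.pull t w) * t.appTop 1) = F.c w' (F.pull t w) ^ (m+1) * t.appTop 1
      rw [map_one]; ring
    have hcong : ∀ {a a' : T' ⟶ (F.pow m).tot} {b b' : T' ⟶ F.tot} (_ : a = a') (_ : b = b') (h h'), β a b h = β a' b' h' := by
      intro a a' b b' ha hb h h'; subst ha; subst hb; rfl
    have h1 : (F.pow m).smulT f ((F.pow m).gen w) ≫ (F.pow m).proj = F.smulT g (F.gen w) ≫ F.proj := by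
      refine ((F.pow m).bdlData.smul_π _ _).trans (h0.trans (F.bdlData.smul_π _ _).symm)
    have h2 : (F.pow m).gen w ≫ (F.pow m).proj = F.smulT g (F.gen w) ≫ F.proj := by
      refine (h0.trans (F.bdlData.smul_π _ _).symm)
    have h3 : (t ≫ sL 0) ≫ (F.pow m).proj = (t ≫ sM 0) ≫ F.proj := (Category.assoc _ _ _).trans ((congrArg (t ≫ ·) h).trans (Category.assoc _ _ _).symm)
    have e1 : t ≫ β (sL 0) (sM 0) h = (F.pow (m+1)).bdlData.smul f ((F.pow (m+1)).bdlData.smul g ((F.pow (m+1)).gen w)) := by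
      refine (hn _ _ _ h h3).trans ((hcong hf.symm hg.symm h3 h1).trans ?_)
      refine (hs1 f _ _ h1 h2).trans (congrArg ((F.pow (m+1)).smulT f) ((hs2 g _ _ h2 h0).trans ?_))
      exact congrArg ((F.pow (m+1)).smulT g) e0
    refine (congrArg (F.pow (m+1)).bdlData.IsGen e1).mpr ?_
    exact (((F.pow (m+1)).isGen_gen w).smul_unit ug).smul_unit uf

theorem isTensorPow_pow (m : ℕ) : IsTensorPow F.bdl m (F.pow m).bdl := by
  induction m with
  | zero =>
    let b : (F.pow 0).HPt X :=
      { x := 𝟙 X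
        val := fun _ _ _ => 1
        nat := fun _ _ _ _ _ => (map_one _).symm
        homog := fun _ _ _ _ _ => by show 1 = _ ^ 0 * 1; rw [pow_zero, one_mul] }
    have hb : ((F.pow 0).pts X).symm b ≫ (F.pow 0).proj = 𝟙 X := by
      rw [comp_proj, Equiv.apply_symm_apply]
    refine ⟨fun _ => ((F.pow 0).pts X).symm b, VecBundleData.isGlobalFrame_iff.2 ⟨hb, ?_⟩⟩
    refine F.isGen_of_frames (Y := (F.pow 0).bdl) _ fun {T'} t w hw => ?_
    have e : t ≫ ((F.pow 0).pts X).symm b = (F.pow 0).gen w := by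
      apply ((F.pow 0).pts _).injective
      rw [pts_comp, Equiv.apply_symm_apply, pts_gen]
      refine ext' (hw.trans (congrArg (t ≫ ·) hb)).symm fun t w' h h' => ?_
      show 1 = _ ^ 0 * t.appTop 1
      rw [pow_zero, map_one, one_mul]
    exact (congrArg (F.pow 0).bdlData.IsGen e).mpr ((F.pow 0).isGen_gen w)
  | succ m ih => exact ⟨_, ih, F.isTensor_pow m⟩

end FrameSys
end
end

section
noncomputable section
open VecBundleData

theorem exists_fpqc_desc {Z T Y : Scheme.{u}} (f : Z ⟶ T) [Flat f] [Surjective f] [QuasiCompact f]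
    (e : Z ⟶ Y) (h : ∀ {W : Scheme.{u}} (g₁ g₂ : W ⟶ Z), g₁ ≫ f = g₂ ≫ f → g₁ ≫ e = g₂ ≫ e) :
    ∃ d : T ⟶ Y, f ≫ d = e :=
  ⟨EffectiveEpi.desc f e fun g₁ g₂ hg => h g₁ g₂ hg, EffectiveEpi.fac f e _⟩

theorem fpqc_ext {Z T Y : Scheme.{u}} (f : Z ⟶ T) [Flat f] [Surjective f] {d d' : T ⟶ Y}
    (h : f ≫ d = f ≫ d') : d = d' := by
  have := Flat.epi_of_flat_of_surjective f
  exact (cancel_epi f).1 h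

theorem fpqc_appTop_ext {Z T : Scheme.{u}} (f : Z ⟶ T) [Flat f] [Surjective f] {d d' : Γ(T, ⊤)}
    (h : f.appTop d = f.appTop d') : d = d' := by
  obtain ⟨m, rfl⟩ := (toA1 T).surjective d
  obtain ⟨m', rfl⟩ := (toA1 T).surjective d'
  rw [← toA1_comp, ← toA1_comp] at h
  rw [fpqc_ext f ((toA1 _).injective h)]

theorem exists_fpqc_fun {Z T : Scheme.{u}} (f : Z ⟶ T) [Flat f] [Surjective f] [QuasiCompact f]
    (e : Γ(Z, ⊤)) (h : ∀ {W : Scheme.{u}} (g₁ g₂ : W ⟶ Z), g₁ ≫ f = g₂ ≫ f → g₁.appTop e = g₂.appTop e) :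
    ∃ d : Γ(T, ⊤), f.appTop d = e := by
  obtain ⟨m, rfl⟩ := (toA1 Z).surjective e
  obtain ⟨d, hd⟩ := exists_fpqc_desc f m (fun g₁ g₂ hg => (toA1 _).injective (by
    rw [toA1_comp, toA1_comp, h g₁ g₂ hg]))
  exact ⟨toA1 T d, by rw [← toA1_comp, hd]⟩

/-- a quasi-compact scheme is covered by an affine one, over which a line bundle is trivial -/
theorem exists_affine_cover_gen {P X : Scheme.{u}} [CompactSpace P] (L : LineBundle X) (x : P ⟶ X) :
    ∃ (S : CommRingCat.{u}) (z : Spec S ⟶ P) (a : Spec S ⟶ L.tot), Flat z ∧ Surjective z ∧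
      a ≫ L.π = z ≫ x ∧ L.IsGen a := by
  obtain ⟨𝓤', h𝓤⟩ := exists_cover_of_nhds (T := P)
    (fun V => IsAffineOpen V ∧ ∃ a : V.toScheme ⟶ L.tot, a ≫ L.π = V.ι ≫ x ∧ L.IsGen a) (by
      intro t
      obtain ⟨V, htV, a, ha, hg⟩ := exists_local_gen L x t
      obtain ⟨V', hV', htV', hle0⟩ := exists_isAffineOpen_mem_and_subset htV
      have hle : V' ≤ V := hle0
      refine ⟨V', htV', hV', P.homOfLE hle ≫ a, ?_, hg.pull _⟩
      rw [Category.assoc, ha]; simp)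
  have haff' : ∀ i : 𝓤'.I₀, IsAffine (𝓤'.X i) := fun i => by
    obtain ⟨V, ⟨hV, -⟩, e, he⟩ := h𝓤 i
    have : IsAffine V.toScheme := hV
    exact IsAffine.of_isIso (eqToHom e)
  have hgen' : ∀ i : 𝓤'.I₀, ∃ a : 𝓤'.X i ⟶ L.tot, a ≫ L.π = 𝓤'.f i ≫ x ∧ L.IsGen a := fun i => by
    obtain ⟨V, ⟨-, a, ha, hg⟩, e, he⟩ := h𝓤 i
    refine ⟨eqToHom e ≫ a, ?_, hg.pull _⟩
    rw [Category.assoc, ha, ← Category.assoc, ← he]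
  let 𝓤 := 𝓤'.finiteSubcover
  have haff : ∀ i : 𝓤.I₀, IsAffine (𝓤.X i) := fun i => haff' _
  have hgen : ∀ i : 𝓤.I₀, ∃ a : 𝓤.X i ⟶ L.tot, a ≫ L.π = 𝓤.f i ≫ x ∧ L.IsGen a := fun i => hgen' _
  choose a ha hg using hgen
  let Z := ∐ (fun i : 𝓤.I₀ ↦ 𝓤.X i)
  let p : Z ⟶ P := Sigma.desc (fun i ↦ 𝓤.f i)
  let b : Z ⟶ L.tot := Sigma.desc a
  have hp1 : Surjective p := ⟨fun x ↦ by
    obtain ⟨i, x, rfl⟩ := 𝓤.exists_eq x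
    use Sigma.ι 𝓤.X i x
    rw [← Scheme.Hom.comp_apply, Sigma.ι_desc]⟩
  have hp2 : Flat p := by
    have : IsZariskiLocalAtSource (@Flat : MorphismProperty Scheme.{u}) := HasRingHomProperty.instIsZariskiLocalAtSource (Q := RingHom.Flat)
    rw [IsZariskiLocalAtSource.iff_of_openCover (P := (@Flat : MorphismProperty Scheme.{u})) (sigmaOpenCover _)]
    intro i
    have h : IsOpenImmersion (𝓤.f i) := 𝓤.map_prop i
    have e : (sigmaOpenCover 𝓤.X).f i ≫ p = 𝓤.f i := Sigma.ι_desc _ _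
    exact e.symm ▸ (inferInstance : Flat (𝓤.f i))
  have hZ : IsAffine Z := inferInstance
  refine ⟨Γ(Z, ⊤), Z.isoSpec.inv ≫ p, Z.isoSpec.inv ≫ b, inferInstance, inferInstance, ?_, IsGen.pull ?_ _⟩
  · rw [Category.assoc, Category.assoc]
    congr 1
    refine Sigma.hom_ext _ _ fun i => ?_
    rw [Sigma.ι_desc_assoc, Sigma.ι_desc_assoc, ha]
  · refine isGen_of_cover (sigmaOpenCover _) fun i => ?_
    have : (sigmaOpenCover 𝓤.X).f i ≫ b = a i := Sigma.ι_desc _ _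
    rw [this]; exact hg i

end
end

section
noncomputable section
variable {k : Type u} [Field k]

namespace SchemeOver
/-- points of a `k`-scheme over a given structure map -/
def Pt (X : SchemeOver k) {T : Scheme.{u}} (s : T ⟶ Spk k) : Type u := {x : T ⟶ X.carrier // x ≫ X.str = s}

theorem Pt.ext {X : SchemeOver k} {T : Scheme.{u}} {s : T ⟶ Spk k} {a b : X.Pt s} (h : a.1 = b.1) : a = b :=
  Subtype.ext h

def Pt.pull {X : SchemeOver k} {T T' : Scheme.{u}} {s : T ⟶ Spk k} {s' : T' ⟶ Spk k} (t : T' ⟶ T)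
    (h : t ≫ s = s') (g : X.Pt s) : X.Pt s' := ⟨t ≫ g.1, by rw [Category.assoc, g.2, h]⟩

theorem Pt.pull_pull {X : SchemeOver k} {T T' T'' : Scheme.{u}} {s : T ⟶ Spk k} {s' : T' ⟶ Spk k}
    {s'' : T'' ⟶ Spk k} (t : T' ⟶ T) (h : t ≫ s = s') (t' : T'' ⟶ T') (h' : t' ≫ s' = s'') (g : X.Pt s) :
    (g.pull t h).pull t' h' = g.pull (t' ≫ t) (by rw [Category.assoc, h, h']) :=
  Pt.ext (Category.assoc _ _ _).symm

theorem Pt.pull_id {X : SchemeOver k} {T : Scheme.{u}} {s : T ⟶ Spk k} (g : X.Pt s) (h : 𝟙 T ≫ s = s) :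
    g.pull (𝟙 T) h = g := Pt.ext (Category.id_comp _)

end SchemeOver

namespace GroupSchemeOver
open SchemeOver
variable (G : GroupSchemeOver k)

abbrev Pt {T : Scheme.{u}} (s : T ⟶ Spk k) : Type u := G.toSchemeOver.Pt s

instance {T : Scheme.{u}} (s : T ⟶ Spk k) : Mul (G.Pt s) :=
  ⟨fun a b => ⟨G.mul a.1 b.1 (a.2.trans b.2.symm), (G.mul_str _ _ _).trans a.2⟩⟩
instance {T : Scheme.{u}} (s : T ⟶ Spk k) : One (G.Pt s) :=
  ⟨⟨s ≫ G.one, by rw [Category.assoc, G.one_str, Category.comp_id]⟩⟩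
instance {T : Scheme.{u}} (s : T ⟶ Spk k) : Inv (G.Pt s) :=
  ⟨fun a => ⟨G.inv a.1, (G.inv_str _).trans a.2⟩⟩

theorem mul_val {T : Scheme.{u}} {s : T ⟶ Spk k} (a b : G.Pt s) : (a * b).1 = G.mul a.1 b.1 (a.2.trans b.2.symm) := rfl
theorem one_val {T : Scheme.{u}} (s : T ⟶ Spk k) : (1 : G.Pt s).1 = s ≫ G.one := rfl
theorem inv_val {T : Scheme.{u}} {s : T ⟶ Spk k} (a : G.Pt s) : (a⁻¹).1 = G.inv a.1 := rfl

theorem one_val' {T : Scheme.{u}} {s : T ⟶ Spk k} (a : G.Pt s) : a.1 ≫ G.str ≫ G.one = (1 : G.Pt s).1 := by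
  rw [one_val, ← Category.assoc, a.2]

instance {T : Scheme.{u}} (s : T ⟶ Spk k) : Group (G.Pt s) :=
  Group.ofLeftAxioms
    (fun a b c => Pt.ext (G.mul_assoc _ _ _ _ _ _ _))
    (fun a => Pt.ext ((G.mul_congr (G.one_val' a).symm rfl _ (by rw [G.one_val']; exact (1 : G.Pt s).2.trans a.2.symm)).trans (G.one_mul a.1 _)))
    (fun a => Pt.ext ((G.inv_mul a.1 _).trans (G.one_val' a)))

variable {G}
theorem pull_mul {T T' : Scheme.{u}} {s : T ⟶ Spk k} {s' : T' ⟶ Spk k} (t : T' ⟶ T) (h : t ≫ s = s') (a b : G.Pt s) :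
    (a * b).pull t h = (a.pull t h : G.Pt s') * b.pull t h :=
  Pt.ext (G.mul_natural _ _ _ _ _)
theorem pull_inv {T T' : Scheme.{u}} {s : T ⟶ Spk k} {s' : T' ⟶ Spk k} (t : T' ⟶ T) (h : t ≫ s = s') (a : G.Pt s) :
    (a⁻¹).pull t h = (a.pull t h : G.Pt s')⁻¹ :=
  Pt.ext (G.inv_natural _ _)
theorem pull_one {T T' : Scheme.{u}} {s : T ⟶ Spk k} {s' : T' ⟶ Spk k} (t : T' ⟶ T) (h : t ≫ s = s') :
    (1 : G.Pt s).pull t h = (1 : G.Pt s') :=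
  Pt.ext (by subst h; exact (Category.assoc _ _ _).symm)
end GroupSchemeOver

open SchemeOver

namespace GroupHom
variable {G H : GroupSchemeOver k} (φ : GroupHom H G)
def map {T : Scheme.{u}} {s : T ⟶ Spk k} (h : H.Pt s) : G.Pt s := ⟨h.1 ≫ φ.hom, by rw [Category.assoc, φ.hom_str, h.2]⟩
theorem map_mul {T : Scheme.{u}} {s : T ⟶ Spk k} (a b : H.Pt s) : φ.map (a * b) = φ.map a * φ.map b :=
  Pt.ext (φ.hom_mul _ _ _ _)
theorem map_one {T : Scheme.{u}} {s : T ⟶ Spk k} : φ.map (1 : H.Pt s) = 1 :=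
  Pt.ext (by show (s ≫ H.one) ≫ φ.hom = s ≫ G.one; rw [Category.assoc, φ.hom_one])
theorem map_inv {T : Scheme.{u}} {s : T ⟶ Spk k} (a : H.Pt s) : φ.map a⁻¹ = (φ.map a)⁻¹ := by
  apply eq_inv_of_mul_eq_one_left; rw [← map_mul, inv_mul_cancel, map_one]
theorem pull_map {T T' : Scheme.{u}} {s : T ⟶ Spk k} {s' : T' ⟶ Spk k} (t : T' ⟶ T) (h : t ≫ s = s') (a : H.Pt s) :
    (φ.map a).pull t h = φ.map (a.pull t h : H.Pt s') := Pt.ext (Category.assoc _ _ _).symm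
end GroupHom

namespace ActionOver
variable {G : GroupSchemeOver k} {X : SchemeOver k} (α : ActionOver G X)
def ac {T : Scheme.{u}} {s : T ⟶ Spk k} (g : G.Pt s) (x : X.Pt s) : X.Pt s :=
  ⟨α.act g.1 x.1 (g.2.trans x.2.symm), (α.act_str _ _ _).trans x.2⟩
theorem mul_ac {T : Scheme.{u}} {s : T ⟶ Spk k} (g g' : G.Pt s) (x : X.Pt s) : α.ac (g * g') x = α.ac g (α.ac g' x) :=
  Pt.ext (α.mul_act _ _ _ _ _ _ _)
theorem one_ac {T : Scheme.{u}} {s : T ⟶ Spk k} (x : X.Pt s) : α.ac 1 x = x := by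
  have e : x.1 ≫ X.str ≫ G.one = (1 : G.Pt s).1 := by rw [GroupSchemeOver.one_val, ← Category.assoc, x.2]
  exact Pt.ext ((α.act_congr e.symm rfl _ (by rw [e]; exact (1 : G.Pt s).2.trans x.2.symm)).trans (α.one_act x.1 _))
theorem pull_ac {T T' : Scheme.{u}} {s : T ⟶ Spk k} {s' : T' ⟶ Spk k} (t : T' ⟶ T) (h : t ≫ s = s') (g : G.Pt s) (x : X.Pt s) :
    (α.ac g x).pull t h = α.ac (g.pull t h : G.Pt s') (x.pull t h) :=
  Pt.ext (α.act_natural _ _ _ _ _)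
end ActionOver

/-- total space as a scheme over `k` -/
abbrev VecBundleData.totOver {X : SchemeOver k} (E : VecBundleData X.carrier) : SchemeOver k := ⟨E.tot, E.π ≫ X.str⟩

namespace LinearizationData
variable {G : GroupSchemeOver k} {X : SchemeOver k} {α : ActionOver G X} {L : LineBundle X.carrier}
  (Λ : LinearizationData α L)

def base {T : Scheme.{u}} {s : T ⟶ Spk k} (e : L.totOver.Pt s) : X.Pt s := ⟨e.1 ≫ L.π, (Category.assoc _ _ _).trans e.2⟩

def la {T : Scheme.{u}} {s : T ⟶ Spk k} (g : G.Pt s) (e : L.totOver.Pt s) : L.totOver.Pt s :=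
  ⟨Λ.lact g.1 e.1 (g.2.trans (base e).2.symm), by
    have := Λ.lact_π g.1 e.1 (g.2.trans (base e).2.symm) (g.2.trans (base e).2.symm)
    refine (Category.assoc _ _ _).symm.trans ?_
    rw [this, α.act_str]
    exact (base e).2⟩
theorem base_la {T : Scheme.{u}} {s : T ⟶ Spk k} (g : G.Pt s) (e : L.totOver.Pt s) : base (Λ.la g e) = α.ac g (base e) :=
  Pt.ext (Λ.lact_π _ _ _ _)
theorem lact_congr {T : Scheme.{u}} {g g' : T ⟶ G.carrier} {e e' : T ⟶ L.tot} (hg : g = g') (he : e = e') (h h') :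
    Λ.lact g e h = Λ.lact g' e' h' := by subst hg; subst he; rfl
theorem mul_la {T : Scheme.{u}} {s : T ⟶ Spk k} (g g' : G.Pt s) (e : L.totOver.Pt s) : Λ.la (g * g') e = Λ.la g (Λ.la g' e) :=
  Pt.ext (Λ.mul_lact _ _ _ _ _ _ _)
theorem one_la {T : Scheme.{u}} {s : T ⟶ Spk k} (e : L.totOver.Pt s) : Λ.la 1 e = e := by
  have h1 : ((e.1 ≫ L.π) ≫ X.str) ≫ G.one = (1 : G.Pt s).1 := by
    rw [GroupSchemeOver.one_val]; exact congrArg (· ≫ G.one) (base e).2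
  exact Pt.ext ((Λ.lact_congr h1.symm rfl _ (by rw [h1]; exact (1 : G.Pt s).2.trans (base e).2.symm)).trans (Λ.one_lact e.1 _))
theorem pull_la {T T' : Scheme.{u}} {s : T ⟶ Spk k} {s' : T' ⟶ Spk k} (t : T' ⟶ T) (h : t ≫ s = s') (g : G.Pt s) (e : L.totOver.Pt s) :
    (Λ.la g e).pull t h = Λ.la (g.pull t h : G.Pt s') (e.pull t h) :=
  Pt.ext (Λ.lact_natural _ _ _ _ _)
theorem base_pull {T T' : Scheme.{u}} {s : T ⟶ Spk k} {s' : T' ⟶ Spk k} (t : T' ⟶ T) (h : t ≫ s = s') (e : L.totOver.Pt s) :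
    base (e.pull t h) = (base e).pull t h := Pt.ext (Category.assoc _ _ _)

/-- scaling -/
def sm {T : Scheme.{u}} {s : T ⟶ Spk k} (f : Γ(T, ⊤)) (e : L.totOver.Pt s) : L.totOver.Pt s :=
  ⟨L.smul f e.1, by
    refine (Category.assoc _ _ _).symm.trans ?_
    rw [L.smul_π]; exact (base e).2⟩
theorem base_sm {T : Scheme.{u}} {s : T ⟶ Spk k} (f : Γ(T, ⊤)) (e : L.totOver.Pt s) : base (sm f e) = base e :=
  Pt.ext (L.smul_π _ _)
theorem la_sm {T : Scheme.{u}} {s : T ⟶ Spk k} (f : Γ(T, ⊤)) (g : G.Pt s) (e : L.totOver.Pt s) :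
    Λ.la g (sm f e) = sm f (Λ.la g e) := Pt.ext (Λ.lact_smul _ _ _ _ _)
theorem pull_sm {T T' : Scheme.{u}} {s : T ⟶ Spk k} {s' : T' ⟶ Spk k} (t : T' ⟶ T) (h : t ≫ s = s') (f : Γ(T, ⊤)) (e : L.totOver.Pt s) :
    (sm f e).pull t h = sm (t.appTop f) (e.pull t h : L.totOver.Pt s') := Pt.ext (L.smul_natural _ _ _)
theorem sm_sm {T : Scheme.{u}} {s : T ⟶ Spk k} (f f' : Γ(T, ⊤)) (e : L.totOver.Pt s) : sm f (sm f' e) = sm (f * f') e :=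
  Pt.ext (L.mul_smul _ _ _).symm

/-- the linearization preserves generators -/
theorem isGen_la {T : Scheme.{u}} {s : T ⟶ Spk k} (g : G.Pt s) (e : L.totOver.Pt s) (he : L.IsGen e.1) :
    L.IsGen (Λ.la g e).1 := by
  refine ⟨fun {T'} t b hb => ?_⟩
  let s' := t ≫ s
  let b' : L.totOver.Pt s' := ⟨b, by
    refine (Category.assoc _ _ _).symm.trans ?_
    rw [hb, Category.assoc]; exact congrArg (t ≫ ·) (base (Λ.la g e)).2⟩
  have hb' : base b' = (α.ac (g.pull t rfl) ((base e).pull t rfl) : X.Pt s') := by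
    rw [← ActionOver.pull_ac, ← base_la]; exact Pt.ext hb
  have key : ∀ f, L.smul f (t ≫ (Λ.la g e).1) = b ↔ L.smul f (t ≫ e.1) = (Λ.la (g.pull t rfl : G.Pt s')⁻¹ b').1 := by
    intro f
    have e1 : (sm f ((Λ.la g e).pull t (rfl : t ≫ s = s')) : L.totOver.Pt s') = Λ.la (g.pull t rfl) (sm f (e.pull t rfl)) := by
      rw [pull_la, la_sm]
    constructor
    · intro h
      have h2 : (sm f ((Λ.la g e).pull t (rfl : t ≫ s = s')) : L.totOver.Pt s') = b' := Pt.ext h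
      rw [e1] at h2
      rw [← h2, ← mul_la, inv_mul_cancel, one_la]; rfl
    · intro h
      have h2 : (sm f (e.pull t rfl) : L.totOver.Pt s') = Λ.la (g.pull t rfl : G.Pt s')⁻¹ b' := Pt.ext h
      rw [h2, ← mul_la, mul_inv_cancel, one_la] at e1
      exact congrArg Subtype.val e1
  obtain ⟨f, hf, hu⟩ := he.ex t (Λ.la (g.pull t rfl : G.Pt s')⁻¹ b').1 (by
    have : base (Λ.la (g.pull t rfl : G.Pt s')⁻¹ b') = (base e).pull t rfl := by
      rw [base_la, hb', ← ActionOver.mul_ac, inv_mul_cancel, ActionOver.one_ac]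
    exact congrArg Subtype.val this)
  exact ⟨f, (key f).2 hf, fun f' h => hu f' ((key f').1 h)⟩
end LinearizationData
end
end

section
open scoped TensorProduct
noncomputable section
variable {k : Type u} [Field k]
open SchemeOver

/-- A good presentation of the quotient `G / H` by the spectrum of a finite `k`-algebra. -/
structure QData (G H : GroupSchemeOver k) (ι : GroupHom H G) where
  A : Type u
  [cr : CommRing A]
  [alg : Algebra k A]
  [fin : Module.Finite k A]
  p : G.carrier ⟶ Spec (.of A)
  p_str : p ≫ Spec.map (CommRingCat.ofHom (algebraMap k A)) = G.str
  flat : Flat p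
  surj : Surjective p
  qc : QuasiCompact p
  coset : ∀ {T : Scheme.{u}} {s : T ⟶ Spk k} (g g' : G.Pt s), g.1 ≫ p = g'.1 ≫ p ↔ ∃ h : H.Pt s, g * ι.map h = g'

attribute [instance] QData.cr QData.alg QData.fin QData.flat QData.surj QData.qc

theorem flat_over_field {Y : Scheme.{u}} (f : Y ⟶ Spk k) : Flat f := by
  have : IsIntegral (Spk k) := inferInstance
  have : Subsingleton (Spk k) := inferInstanceAs (Subsingleton (PrimeSpectrum k))
  infer_instance

/-- the fibre product is a base change of the action map -/
theorem flat_fst_of_coset (G H : GroupSchemeOver k) (ι : GroupHom H G) [Mono ι.hom] {B : Scheme.{u}} (p : G.carrier ⟶ B)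
    (b : B ⟶ Spk k) (hb : p ≫ b = G.str)
    (coset : ∀ {T : Scheme.{u}} {s : T ⟶ Spk k} (g g' : G.Pt s), g.1 ≫ p = g'.1 ≫ p ↔ ∃ h : H.Pt s, g * ι.map h = g')
    {W U : Scheme.{u}} (w : W ⟶ G.carrier) (f : U ⟶ G.carrier) [Flat f] : Flat (pullback.fst (w ≫ p) (f ≫ p)) := by
  let s : W ⟶ Spk k := w ≫ G.str
  let WH := pullback s H.str
  let sWH : WH ⟶ Spk k := pullback.fst s H.str ≫ s
  let wp : G.Pt sWH := ⟨pullback.fst s H.str ≫ w, Category.assoc _ _ _⟩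
  let hp : H.Pt sWH := ⟨pullback.snd s H.str, pullback.condition.symm⟩
  let m : WH ⟶ G.carrier := (wp * ι.map hp).1
  have f1 : Flat (pullback.fst m f) := inferInstance
  have f2 : Flat (pullback.fst s H.str) := by
    have := flat_over_field H.str
    infer_instance
  let P' := pullback m f
  let Z := pullback (w ≫ p) (f ≫ p)
  let sZ : Z ⟶ Spk k := pullback.fst (w ≫ p) (f ≫ p) ≫ s
  have hsZ : pullback.snd (w ≫ p) (f ≫ p) ≫ f ≫ G.str = sZ := by
    have : pullback.fst (w ≫ p) (f ≫ p) ≫ w ≫ p = pullback.snd (w ≫ p) (f ≫ p) ≫ f ≫ p := pullback.condition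
    have e := congrArg (· ≫ b) this
    simp only [Category.assoc, hb] at e
    exact e.symm
  let gZ : G.Pt sZ := ⟨pullback.fst (w ≫ p) (f ≫ p) ≫ w, Category.assoc _ _ _⟩
  let gZ' : G.Pt sZ := ⟨pullback.snd (w ≫ p) (f ≫ p) ≫ f, (Category.assoc _ _ _).trans hsZ⟩
  obtain ⟨h, hh⟩ := (coset gZ gZ').1 (by
    show (_ ≫ _) ≫ _ = (_ ≫ _) ≫ _
    rw [Category.assoc, Category.assoc]; exact pullback.condition)
  let i0 : Z ⟶ WH := pullback.lift (pullback.fst (w ≫ p) (f ≫ p)) h.1 h.2.symm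
  have hi0s : i0 ≫ sWH = sZ := by
    show i0 ≫ pullback.fst s H.str ≫ s = _
    rw [← Category.assoc, pullback.lift_fst]
  have e1 : wp.pull i0 hi0s = gZ := Pt.ext (by
    show i0 ≫ pullback.fst s H.str ≫ w = _
    rw [← Category.assoc, pullback.lift_fst])
  have e2 : hp.pull i0 hi0s = h := Pt.ext (pullback.lift_snd _ _ _)
  have hi0 : i0 ≫ m = pullback.snd (w ≫ p) (f ≫ p) ≫ f := by
    have : ((wp * ι.map hp).pull i0 hi0s : G.Pt sZ) = gZ' := by
      rw [GroupSchemeOver.pull_mul, GroupHom.pull_map, e1, e2, hh]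
    exact congrArg Subtype.val this
  let i : Z ⟶ P' := pullback.lift i0 (pullback.snd (w ≫ p) (f ≫ p)) hi0
  have hj : (pullback.fst m f ≫ pullback.fst s H.str) ≫ w ≫ p = pullback.snd m f ≫ f ≫ p := by
    have h1 : wp.1 ≫ p = m ≫ p := (coset wp (wp * ι.map hp)).2 ⟨hp, rfl⟩
    have h2 : pullback.fst m f ≫ m = pullback.snd m f ≫ f := pullback.condition
    rw [← Category.assoc (pullback.snd m f), ← h2, Category.assoc, Category.assoc, ← h1]
    show _ = _ ≫ (_ ≫ _) ≫ _
    rw [Category.assoc]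
  let j : P' ⟶ Z := pullback.lift (pullback.fst m f ≫ pullback.fst s H.str) (pullback.snd m f) hj
  have hij : i ≫ j = 𝟙 Z := by
    apply pullback.hom_ext
    · rw [Category.assoc, pullback.lift_fst, ← Category.assoc, pullback.lift_fst, pullback.lift_fst, Category.id_comp]
    · rw [Category.assoc, pullback.lift_snd, pullback.lift_snd, Category.id_comp]
  have hji : j ≫ i = 𝟙 P' := by
    apply pullback.hom_ext
    · rw [Category.assoc, pullback.lift_fst, Category.id_comp]
      have a1 : (j ≫ i0) ≫ pullback.fst s H.str = pullback.fst m f ≫ pullback.fst s H.str := by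
        rw [Category.assoc, pullback.lift_fst, pullback.lift_fst]
      apply pullback.hom_ext a1
      have hs1 : (j ≫ i0) ≫ sWH = pullback.fst m f ≫ sWH := by
        show (j ≫ i0) ≫ _ ≫ s = _ ≫ _ ≫ s
        rw [← Category.assoc, a1, Category.assoc]
      have b1 : wp.pull (j ≫ i0) hs1 = wp.pull (pullback.fst m f) rfl := Pt.ext (by
        show (j ≫ i0) ≫ _ ≫ w = _ ≫ _ ≫ w
        rw [← Category.assoc, a1, Category.assoc])
      have b2 : (wp * ι.map hp).pull (j ≫ i0) hs1 = (wp * ι.map hp).pull (pullback.fst m f) rfl := Pt.ext (by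
        show (j ≫ i0) ≫ m = pullback.fst m f ≫ m
        rw [Category.assoc, hi0, ← Category.assoc, pullback.lift_snd]
        exact pullback.condition.symm)
      rw [GroupSchemeOver.pull_mul, GroupSchemeOver.pull_mul, b1, GroupHom.pull_map, GroupHom.pull_map] at b2
      have b3 := congrArg Subtype.val (mul_left_cancel (G := G.Pt (pullback.fst m f ≫ sWH)) b2)
      exact (cancel_mono ι.hom).1 b3
    · rw [Category.assoc, pullback.lift_snd, pullback.lift_snd, Category.id_comp]
  have : IsIso i := ⟨j, hij, hji⟩
  have : i ≫ pullback.fst m f ≫ pullback.fst s H.str = pullback.fst (w ≫ p) (f ≫ p) := by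
    rw [← Category.assoc, pullback.lift_fst, pullback.lift_fst]
  rw [← this]; infer_instance

theorem flat_of_pullback_flat {A : Type u} [CommRing A] [IsArtinianRing A] {S M : CommRingCat.{u}} (χ : CommRingCat.of A ⟶ S) (φ : CommRingCat.of A ⟶ M)
    (hχ : Function.Injective χ) (h : Flat (pullback.fst (Spec.map χ) (Spec.map φ))) : Flat (Spec.map φ) := by
  algebraize [χ.hom, φ.hom]
  rw [Flat.SpecMap_iff]
  have h2 : Flat (Spec.map (CommRingCat.ofHom (algebraMap S (S ⊗[A] M)))) := by
    rw [← pullbackSpecIso_inv_fst' A S M]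
    have : Flat (pullback.fst (Spec.map (CommRingCat.ofHom (algebraMap A S))) (Spec.map (CommRingCat.ofHom (algebraMap A M)))) := h
    infer_instance
  rw [Flat.SpecMap_iff] at h2
  have h3 : Module.Flat S (S ⊗[A] M) := (RingHom.flat_algebraMap_iff).1 h2
  have := flat_of_flat_injective (A := A) (S := S) (M := M) hχ
  exact (RingHom.flat_algebraMap_iff (R := A) (S := M)).2 this

theorem exists_qdata (G H : GroupSchemeOver k) (hG : G.IsAlgebraic) (ι : GroupHom H G) [Mono ι.hom] (Q : SchemeOver k)
    (q : G.carrier ⟶ Q.carrier) (hq : IsCosetQuotient G H ι Q q) (hQ : IsFinite Q.str) : Nonempty (QData G H ι) := by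
  obtain ⟨q_str, q_surj, q_cos⟩ := hq
  have hcs : CompactSpace G.carrier := by
    have := hG.2
    exact (quasiCompact_iff_compactSpace (f := G.str)).1 inferInstance
  have haff : IsAffine Q.carrier := isAffine_of_isAffineHom Q.str
  let B := Γ(Q.carrier, ⊤)
  obtain ⟨φ, hφ⟩ := Spec.map_surjective (Q.carrier.isoSpec.inv ≫ Q.str)
  have φfin : φ.hom.Finite := by
    rw [← IsFinite.SpecMap_iff, hφ]; infer_instance
  let A := q.appTop.hom.range
  let ρ : B →+* A := q.appTop.hom.rangeRestrict
  have hρ : Function.Surjective ρ := RingHom.rangeRestrict_surjective _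
  letI : Algebra k A := (ρ.comp φ.hom).toAlgebra
  have fin : Module.Finite k A := RingHom.Finite.comp (RingHom.Finite.of_surjective ρ hρ) φfin
  let p : G.carrier ⟶ Spec (.of A) := G.carrier.toSpecΓ ≫ Spec.map (CommRingCat.ofHom A.subtype)
  have hpq : p ≫ Spec.map (CommRingCat.ofHom ρ) = q ≫ Q.carrier.isoSpec.hom := by
    show (_ ≫ _) ≫ _ = _
    rw [Category.assoc, ← Spec.map_comp]
    have : CommRingCat.ofHom ρ ≫ CommRingCat.ofHom A.subtype = q.appTop := by ext x; rfl
    rw [this, ← Scheme.toSpecΓ_naturality]; rfl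
  have hcl : IsClosedImmersion (Spec.map (CommRingCat.ofHom ρ)) := IsClosedImmersion.spec_of_surjective _ hρ
  have p_str : p ≫ Spec.map (CommRingCat.ofHom (algebraMap k A)) = G.str := by
    have : CommRingCat.ofHom (algebraMap k A) = φ ≫ CommRingCat.ofHom ρ := rfl
    rw [this, Spec.map_comp, ← Category.assoc, hpq, hφ]; simp [q_str]
  have surj : Surjective p := by
    refine ⟨fun y => ?_⟩
    have hs : Surjective (q ≫ Q.carrier.isoSpec.hom) := inferInstance
    obtain ⟨x, hx⟩ := hs.1 ((Spec.map (CommRingCat.ofHom ρ)) y)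
    refine ⟨x, (Spec.map (CommRingCat.ofHom ρ)).isClosedEmbedding.injective ?_⟩
    rw [← Scheme.Hom.comp_apply, hpq, hx]
  have coset : ∀ {T : Scheme.{u}} {s : T ⟶ Spk k} (g g' : G.Pt s), g.1 ≫ p = g'.1 ≫ p ↔ ∃ h : H.Pt s, g * ι.map h = g' := by
    intro T s g g'
    have e1 : g.1 ≫ p = g'.1 ≫ p ↔ g.1 ≫ q = g'.1 ≫ q := by
      have e3 : ∀ a : T ⟶ G.carrier, (a ≫ p) ≫ Spec.map (CommRingCat.ofHom ρ) = (a ≫ q) ≫ Q.carrier.isoSpec.hom := fun a =>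
        (Category.assoc _ _ _).trans ((congrArg (a ≫ ·) hpq).trans (Category.assoc _ _ _).symm)
      rw [← cancel_mono (Spec.map (CommRingCat.ofHom ρ)), e3, e3, cancel_mono]
    rw [e1, q_cos _ _ (g.2.trans g'.2.symm)]
    constructor
    · rintro ⟨h, hh, e⟩
      refine ⟨⟨h, ?_⟩, Pt.ext e⟩
      rw [Category.assoc, ι.hom_str] at hh
      exact hh.symm.trans g.2
    · rintro ⟨h, e⟩
      exact ⟨h.1, g.2.trans (ι.map h).2.symm, congrArg Subtype.val e⟩
  have : IsArtinianRing A := IsArtinianRing.of_finite k A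
  have flat : Flat p := by
    have hloc : IsZariskiLocalAtSource (@Flat : MorphismProperty Scheme.{u}) := HasRingHomProperty.instIsZariskiLocalAtSource (Q := RingHom.Flat)
    have hid : MorphismProperty.ContainsIdentities (@Flat : MorphismProperty Scheme.{u}) := ⟨fun X => (inferInstance : Flat (𝟙 X))⟩
    obtain ⟨Y, w0, hw1, hw2, hY⟩ := G.carrier.exists_hom_isAffine_of_isZariskiLocalAtSource (@Flat : MorphismProperty Scheme.{u})
    let S := Γ(Y, ⊤)
    let w : Spec S ⟶ G.carrier := Y.isoSpec.inv ≫ w0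
    have w1 : Surjective w := inferInstance
    have w2 : Flat w := inferInstance
    let χ : CommRingCat.of A ⟶ S := CommRingCat.ofHom A.subtype ≫ w.appTop ≫ (Scheme.ΓSpecIso S).hom
    have hχ : w ≫ p = Spec.map χ := by
      show w ≫ _ ≫ _ = _
      rw [Spec.map_comp, Spec.map_comp, ← Category.assoc, Scheme.toSpecΓ_naturality, ← Scheme.isoSpec_Spec_hom]; rfl
    have hinj : Function.Injective χ := by
      intro a b hab
      have h1 : (Scheme.ΓSpecIso S).hom (w.appTop a.1) = (Scheme.ΓSpecIso S).hom (w.appTop b.1) := hab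
      have h2 : w.appTop a.1 = w.appTop b.1 := (ConcreteCategory.bijective_of_isIso (Scheme.ΓSpecIso S).hom).1 h1
      exact Subtype.ext (fpqc_appTop_ext w h2)
    have hgen : ∀ (M : CommRingCat.{u}) (f : Spec M ⟶ G.carrier) (_ : IsOpenImmersion f), Flat (f ≫ p) := by
      intro M f hf
      obtain ⟨ψ, hψ⟩ := Spec.map_surjective (f ≫ p)
      have h4 : Flat (pullback.fst (w ≫ p) (f ≫ p)) := flat_fst_of_coset G H ι p _ p_str coset w f
      rw [← hψ] at h4 ⊢
      rw [hχ] at h4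
      exact flat_of_pullback_flat χ ψ hinj h4
    rw [IsZariskiLocalAtSource.iff_of_openCover (P := (@Flat : MorphismProperty Scheme.{u})) G.carrier.affineCover]
    exact fun i => hgen _ (G.carrier.affineCover.f i) (G.carrier.affineCover.map_prop i)
  have qc : QuasiCompact p := inferInstance
  exact ⟨{ A := A, p := p, p_str := p_str, flat := flat, surj := surj, qc := qc, coset := coset }⟩
end
end

section
open scoped TensorProduct
noncomputable section
variable {k : Type u} [Field k]
open SchemeOver

variable (k) in
/-- structure map of the spectrum of an algebra -/
abbrev strOf (E : Type u) [CommRing E] [Algebra k E] : Spec (.of E) ⟶ Spk k :=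
  Spec.map (CommRingCat.ofHom (algebraMap k E))

@[reducible] def algOf {R : Type u} [CommRing R] (a : Spec (.of R) ⟶ Spk k) : Algebra k R := (Spec.preimage a).hom.toAlgebra

theorem strOf_algOf {R : Type u} [CommRing R] (a : Spec (.of R) ⟶ Spk k) : @strOf k _ R _ (algOf a) = a :=
  Spec.map_preimage a

theorem spec_algHom {R R' : Type u} [CommRing R] [CommRing R'] [Algebra k R] [Algebra k R'] (ψ : R →ₐ[k] R') :
    Spec.map (CommRingCat.ofHom (ψ : R →+* R')) ≫ strOf k R = strOf k R' := by
  rw [← Spec.map_comp]; congr 1; ext x; exact ψ.commutes x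

/-- a ring map compatible with structure maps -/
theorem exists_algHom {R R' : Type u} [CommRing R] [CommRing R'] [Algebra k R] [Algebra k R'] (ψ : R →+* R')
    (h : Spec.map (CommRingCat.ofHom ψ) ≫ strOf k R = strOf k R') : ∃ ψ' : R →ₐ[k] R', (ψ' : R →+* R') = ψ := by
  rw [← Spec.map_comp] at h
  have h2 := Spec.map_injective h
  exact ⟨{ ψ with commutes' := fun x => congrArg (fun f => f.hom x) h2 }, rfl⟩

section prodE
variable (E : Type u) [CommRing E] [Algebra k E]

abbrev prodE {T : Scheme.{u}} (s : T ⟶ Spk k) : Scheme.{u} := pullback s (strOf k E)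

variable {E}
def prodE.lift {T T' : Scheme.{u}} {s : T ⟶ Spk k} (t : T' ⟶ T) (y : T' ⟶ Spec (.of E)) (h : t ≫ s = y ≫ strOf k E) :
    T' ⟶ prodE E s := pullback.lift t y h

theorem prodE.comp_lift {T T' T'' : Scheme.{u}} {s : T ⟶ Spk k} (t : T' ⟶ T) (y : T' ⟶ Spec (.of E)) (h : t ≫ s = y ≫ strOf k E)
   (t' : T'' ⟶ T') (h') : t' ≫ prodE.lift t y h = prodE.lift (t' ≫ t) (t' ≫ y) h' := pullback.hom_ext
    (by rw [Category.assoc, prodE.lift, prodE.lift, pullback.lift_fst, pullback.lift_fst])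
    (by rw [Category.assoc, prodE.lift, prodE.lift, pullback.lift_snd, pullback.lift_snd])

theorem prodE.lift_congr {T T' : Scheme.{u}} {s : T ⟶ Spk k} {t t' : T' ⟶ T} {y y' : T' ⟶ Spec (.of E)} (e : t = t') (e' : y = y') (h h') :
   prodE.lift (s := s) t y h = prodE.lift t' y' h' := by subst e e'; rfl

variable (E) in
def prodE.map {T T' : Scheme.{u}} {s : T ⟶ Spk k} {s' : T' ⟶ Spk k} (t : T' ⟶ T) (h : t ≫ s = s') : prodE E s' ⟶ prodE E s :=
  prodE.lift (pullback.fst s' (strOf k E) ≫ t) (pullback.snd _ _) (by rw [Category.assoc, h, pullback.condition])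

theorem prodE.lift_map {T T' T'' : Scheme.{u}} {s : T ⟶ Spk k} {s' : T' ⟶ Spk k} (t : T' ⟶ T) (h : t ≫ s = s')
    (t' : T'' ⟶ T') (y : T'' ⟶ Spec (.of E)) (h1 : t' ≫ s' = y ≫ strOf k E) (h2) :
    prodE.lift t' y h1 ≫ prodE.map E t h = prodE.lift (t' ≫ t) y h2 := by
  have e1 : prodE.lift t' y h1 ≫ pullback.fst s' (strOf k E) = t' := pullback.lift_fst _ _ _
  have e2 : prodE.lift t' y h1 ≫ pullback.snd s' (strOf k E) = y := pullback.lift_snd _ _ _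
  refine (prodE.comp_lift _ _ _ _ ?_).trans (prodE.lift_congr ?_ ?_ _ _)
  · rw [e2, ← Category.assoc, e1, h2]
  · rw [← Category.assoc, e1]
  · exact e2

variable (E) in
/-- the universal point over an affine test -/
def uni {T : Scheme.{u}} {s : T ⟶ Spk k} {R : Type u} [CommRing R] [Algebra k R] (t : Spec (.of R) ⟶ T) (h : t ≫ s = strOf k R) :
    Spec (.of (R ⊗[k] E)) ⟶ prodE E s :=
  prodE.lift (Spec.map (CommRingCat.ofHom (algebraMap R (R ⊗[k] E))) ≫ t)
    (Spec.map (CommRingCat.ofHom ((Algebra.TensorProduct.includeRight : E →ₐ[k] R ⊗[k] E) : E →+* R ⊗[k] E))) (by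
      rw [Category.assoc, h, spec_algHom]
      exact spec_algHom (Algebra.TensorProduct.includeLeft : R →ₐ[k] R ⊗[k] E))

theorem uni_comp {T : Scheme.{u}} {s : T ⟶ Spk k} {R R' : Type u} [CommRing R] [Algebra k R] [CommRing R'] [Algebra k R']
    (ψ : R →ₐ[k] R') (t : Spec (.of R) ⟶ T) (h : t ≫ s = strOf k R) (h') :
    Spec.map (CommRingCat.ofHom (tMap ψ E : R ⊗[k] E →+* R' ⊗[k] E)) ≫ uni E t h =
      uni E (Spec.map (CommRingCat.ofHom (ψ : R →+* R')) ≫ t) h' := by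
  have e1 : Spec.map (CommRingCat.ofHom (tMap ψ E : R ⊗[k] E →+* R' ⊗[k] E)) ≫
     Spec.map (CommRingCat.ofHom (algebraMap R (R ⊗[k] E))) ≫ t =
     Spec.map (CommRingCat.ofHom (algebraMap R' (R' ⊗[k] E))) ≫ Spec.map (CommRingCat.ofHom (ψ : R →+* R')) ≫ t := by
    rw [← Category.assoc, ← Category.assoc, ← Spec.map_comp, ← Spec.map_comp]
    congr 2
  have e2 : Spec.map (CommRingCat.ofHom (tMap ψ E : R ⊗[k] E →+* R' ⊗[k] E)) ≫
    Spec.map (CommRingCat.ofHom ((Algebra.TensorProduct.includeRight : E →ₐ[k] R ⊗[k] E) : E →+* R ⊗[k] E)) =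
    Spec.map (CommRingCat.ofHom ((Algebra.TensorProduct.includeRight : E →ₐ[k] R' ⊗[k] E) : E →+* R' ⊗[k] E)) := by
    rw [← Spec.map_comp]
    congr 1
    ext x; simp
  refine (prodE.comp_lift _ _ _ _ ?_).trans (prodE.lift_congr e1 e2 _ _)
  rw [e1, e2, Category.assoc, h', spec_algHom]
  exact spec_algHom (Algebra.TensorProduct.includeLeft : R' →ₐ[k] R' ⊗[k] E)

theorem uni_map {T T' : Scheme.{u}} {s : T ⟶ Spk k} {s' : T' ⟶ Spk k} (t' : T' ⟶ T) (ht : t' ≫ s = s') {R : Type u} [CommRing R] [Algebra k R]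
    (t : Spec (.of R) ⟶ T') (h : t ≫ s' = strOf k R) (h') :
    uni E t h ≫ prodE.map E t' ht = uni E (t ≫ t') h' := by
  refine (prodE.lift_map _ _ _ _ _ ?_).trans (prodE.lift_congr (Category.assoc _ _ _) rfl _ _)
  rw [Category.assoc, Category.assoc, ht, h, spec_algHom]
  exact spec_algHom (Algebra.TensorProduct.includeLeft : R →ₐ[k] R ⊗[k] E)

/-- evaluation of a function on the product at a universal point. -/
def evE {T : Scheme.{u}} {s : T ⟶ Spk k} {R : Type u} [CommRing R] [Algebra k R] (t : Spec (.of R) ⟶ T) (h : t ≫ s = strOf k R) :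
    Γ(prodE E s, ⊤) →+* R ⊗[k] E := evalHom (R := .of (R ⊗[k] E)) (uni E t h)

theorem evE_comp {T : Scheme.{u}} {s : T ⟶ Spk k} {R R' : Type u} [CommRing R] [Algebra k R] [CommRing R'] [Algebra k R']
    (ψ : R →ₐ[k] R') (t : Spec (.of R) ⟶ T) (h : t ≫ s = strOf k R) (h') (f : Γ(prodE E s, ⊤)) :
    evE (Spec.map (CommRingCat.ofHom (ψ : R →+* R')) ≫ t) h' f = tMap ψ E (evE t h f) := by
  have := evalAt_comp (CommRingCat.ofHom (tMap ψ E : R ⊗[k] E →+* R' ⊗[k] E)) (uni E t h) f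
  rw [uni_comp ψ t h h'] at this
  exact this

theorem evE_map {T T' : Scheme.{u}} {s : T ⟶ Spk k} {s' : T' ⟶ Spk k} (t' : T' ⟶ T) (ht : t' ≫ s = s') {R : Type u} [CommRing R] [Algebra k R]
    (t : Spec (.of R) ⟶ T') (h : t ≫ s' = strOf k R) (h') (f : Γ(prodE E s, ⊤)) :
    evE t h ((prodE.map E t' ht).appTop f) = evE (t ≫ t') h' f := by
  have := evalAt_appTop (R := .of (R ⊗[k] E)) (uni E t h) (prodE.map E t' ht) f
  rw [uni_map t' ht t h h'] at this
  exact this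

variable (k E) in
/-- a natural operation on tuples of elements of `R ⊗ E` -/
structure NatOp (I : Type) where
  op : ∀ (R : Type u) [CommRing R] [Algebra k R], (I → R ⊗[k] E) → R
  nat : ∀ {R R' : Type u} [CommRing R] [Algebra k R] [CommRing R'] [Algebra k R'] (ψ : R →ₐ[k] R') (φ : I → R ⊗[k] E),
    op R' (fun i => tMap ψ E (φ i)) = ψ (op R φ)

namespace NatOp
variable {I : Type} (O : NatOp k E I)

theorem exists_gl {T : Scheme.{u}} (s : T ⟶ Spk k) (φ : I → Γ(prodE E s, ⊤)) :
    ∃ f : Γ(T, ⊤), ∀ (R : Type u) [CommRing R] [Algebra k R] (t : Spec (.of R) ⟶ T) (h : t ≫ s = strOf k R),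
      evalAt t f = O.op R (fun i => evE t h (φ i)) := by
  let a : ∀ (R : CommRingCat.{u}) (_ : Spec R ⟶ T), R := fun R t =>
    letI : Algebra k R := algOf (R := R) (t ≫ s)
    O.op R (fun i => evE (R := R) t (strOf_algOf (R := R) (t ≫ s)).symm (φ i))
  obtain ⟨f, hf⟩ := exists_global a (by
    intro R R' ψ t
    letI : Algebra k R := algOf (R := R) (t ≫ s)
    letI : Algebra k R' := algOf (R := R') ((Spec.map ψ ≫ t) ≫ s)
    have h1 := (strOf_algOf (R := R) (t ≫ s)).symm
    have h2 := (strOf_algOf (R := R') ((Spec.map ψ ≫ t) ≫ s)).symm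
    obtain ⟨ψ', hψ'⟩ := exists_algHom (R := R) (R' := R') ψ.hom (by
      refine (congrArg (Spec.map ψ ≫ ·) h1.symm).trans ?_
      exact (Category.assoc _ _ _).symm.trans h2)
    have h3 : ψ = CommRingCat.ofHom (ψ' : R →+* R') := by rw [hψ']; rfl
    show O.op R' (fun i => evE (R := R') (Spec.map ψ ≫ t) h2 (φ i)) = ψ.hom (O.op R (fun i => evE (R := R) t h1 (φ i)))
    rw [← hψ']
    refine Eq.trans ?_ (O.nat ψ' _)
    congr 1
    funext i
    refine Eq.trans ?_ (evE_comp ψ' t h1 (by rw [hψ']; exact h2) (φ i))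
    congr 1
    congr 1
    rw [hψ']; rfl)
  refine ⟨f, fun R _ alg t h => (hf (.of R) t).trans ?_⟩
  have : alg = algOf (R := R) (t ≫ s) := by
    apply Algebra.algebra_ext
    intro r
    have h4 : strOf k R = @strOf k _ R _ (algOf (t ≫ s)) := h.symm.trans (strOf_algOf (R := R) (t ≫ s)).symm
    have h5 := Spec.map_injective h4
    exact congrArg (fun f => f.hom r) h5
  subst this
  rfl

/-- globalized operation -/
def gl {T : Scheme.{u}} (s : T ⟶ Spk k) (φ : I → Γ(prodE E s, ⊤)) : Γ(T, ⊤) := (O.exists_gl s φ).choose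

theorem evalAt_gl {T : Scheme.{u}} {s : T ⟶ Spk k} (φ : I → Γ(prodE E s, ⊤)) {R : Type u} [CommRing R] [Algebra k R]
    (t : Spec (.of R) ⟶ T) (h : t ≫ s = strOf k R) : evalAt t (O.gl s φ) = O.op R (fun i => evE t h (φ i)) :=
  (O.exists_gl s φ).choose_spec R t h

end NatOp

theorem global_ext' {T : Scheme.{u}} (s : T ⟶ Spk k) {f f' : Γ(T, ⊤)}
    (H : ∀ (R : Type u) [CommRing R] [Algebra k R] (t : Spec (.of R) ⟶ T) (_ : t ≫ s = strOf k R), evalAt t f = evalAt t f') : f = f' := by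
  refine global_ext fun R t => ?_
  letI : Algebra k R := algOf (R := R) (t ≫ s)
  exact H R t (strOf_algOf (R := R) (t ≫ s)).symm

theorem NatOp.gl_nat {I : Type} (O : NatOp k E I) {T T' : Scheme.{u}} {s : T ⟶ Spk k} {s' : T' ⟶ Spk k} (t' : T' ⟶ T) (ht : t' ≫ s = s')
    (φ : I → Γ(prodE E s, ⊤)) : O.gl s' (fun i => (prodE.map E t' ht).appTop (φ i)) = t'.appTop (O.gl s φ) := by
  refine global_ext' s' fun R _ _ t h => ?_
  have h' : (t ≫ t') ≫ s = strOf k R := by rw [Category.assoc, ht, h]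
  rw [O.evalAt_gl _ t h]
  refine Eq.trans ?_ (evalAt_appTop (R := .of R) t t' (O.gl s φ)).symm
  rw [O.evalAt_gl _ _ h']
  congr 1
  funext i
  exact evE_map t' ht t h h' (φ i)

variable (k E) in
/-- the norm as a natural operation -/
def normOp [Module.Finite k E] : NatOp k E Unit := ⟨fun R _ _ φ => Algebra.norm R (φ ()), fun ψ φ => tNorm_natural ψ E _⟩

variable (k E) in
/-- coefficients of norms of polynomials as a natural operation -/
def pnormOp [Module.Finite k E] (n d : ℕ) : NatOp k E (Fin n) := ⟨fun R _ _ φ => pNorm k φ d, fun ψ φ => pNorm_natural ψ φ d⟩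

variable [Module.Finite k E]
/-- geometric norm -/
def gN {T : Scheme.{u}} (s : T ⟶ Spk k) (f : Γ(prodE E s, ⊤)) : Γ(T, ⊤) := (normOp k E).gl s (fun _ => f)

theorem evalAt_gN {T : Scheme.{u}} {s : T ⟶ Spk k} (f : Γ(prodE E s, ⊤)) {R : Type u} [CommRing R] [Algebra k R]
    (t : Spec (.of R) ⟶ T) (h : t ≫ s = strOf k R) : evalAt t (gN s f) = Algebra.norm R (evE t h f) :=
  (normOp k E).evalAt_gl _ t h

theorem gN_nat {T T' : Scheme.{u}} {s : T ⟶ Spk k} {s' : T' ⟶ Spk k} (t' : T' ⟶ T) (ht : t' ≫ s = s')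
    (f : Γ(prodE E s, ⊤)) : gN s' ((prodE.map E t' ht).appTop f) = t'.appTop (gN s f) :=
  (normOp k E).gl_nat t' ht _

theorem gN_mul {T : Scheme.{u}} {s : T ⟶ Spk k} (f f' : Γ(prodE E s, ⊤)) : gN s (f * f') = gN s f * gN s f' := by
  refine global_ext' s fun R _ _ t h => ?_
  have : evalAt t (gN s f * gN s f') = evalAt t (gN s f) * evalAt t (gN s f') := map_mul (evalHom t) _ _
  rw [this, evalAt_gN _ t h, evalAt_gN _ t h, evalAt_gN _ t h, map_mul, map_mul]

theorem gN_one {T : Scheme.{u}} {s : T ⟶ Spk k} : gN s (1 : Γ(prodE E s, ⊤)) = 1 := by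
  refine global_ext' s fun R _ _ t h => ?_
  have : evalAt t (1 : Γ(T, ⊤)) = 1 := map_one (evalHom t)
  rw [this, evalAt_gN _ t h, map_one, map_one]

theorem gpN_smul {T : Scheme.{u}} {s : T ⟶ Spk k} {n d : ℕ} (f : Γ(prodE E s, ⊤)) (φ : Fin n → Γ(prodE E s, ⊤)) :
    (pnormOp k E n d).gl s (fun i => f * φ i) = gN s f * (pnormOp k E n d).gl s φ := by
  refine global_ext' s fun R _ _ t h => ?_
  have : evalAt t (gN s f * (pnormOp k E n d).gl s φ) = evalAt t (gN s f) * evalAt t ((pnormOp k E n d).gl s φ) := map_mul (evalHom t) _ _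
  rw [this, evalAt_gN _ t h, NatOp.evalAt_gl _ _ t h, NatOp.evalAt_gl _ _ t h]
  refine Eq.trans ?_ (pNorm_smul _ _ _)
  show pNorm k _ d = _
  congr 1
  funext i
  exact map_mul _ _ _
end prodE
end
end

section
open scoped TensorProduct
noncomputable section
variable {k : Type u} [Field k]
open SchemeOver

def SchemeOver.mkPt (X : SchemeOver k) {T : Scheme.{u}} {s : T ⟶ Spk k} (x : T ⟶ X.carrier) (h : x ≫ X.str = s) : X.Pt s := ⟨x, h⟩
def GroupSchemeOver.mkPt (G : GroupSchemeOver k) {T : Scheme.{u}} {s : T ⟶ Spk k} (x : T ⟶ G.carrier) (h : x ≫ G.str = s) : G.Pt s := ⟨x, h⟩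

namespace QData
variable {G H : GroupSchemeOver k} {ι : GroupHom H G} (D : QData G H ι)

theorem str_of_p {T : Scheme.{u}} (g : T ⟶ G.carrier) : (g ≫ D.p) ≫ strOf k D.A = g ≫ G.str := by
  rw [Category.assoc]; exact congrArg (g ≫ ·) D.p_str

/-- descent of morphisms along `G ⟶ G / H` -/
theorem desc_hom {T Y : Scheme.{u}} (y : T ⟶ Spec (.of D.A))
    (e : ∀ {T' : Scheme.{u}} (t : T' ⟶ T) (g : T' ⟶ G.carrier), g ≫ D.p = t ≫ y → (T' ⟶ Y))
    (nat : ∀ {T' T'' : Scheme.{u}} (t' : T'' ⟶ T') (t : T' ⟶ T) (g : T' ⟶ G.carrier) (h h'),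
      t' ≫ e t g h = e (t' ≫ t) (t' ≫ g) h')
    (inv : ∀ {T' : Scheme.{u}} (t : T' ⟶ T) (g g' : T' ⟶ G.carrier) (h h'), e t g h = e t g' h') :
    ∃ d : T ⟶ Y, ∀ {T' : Scheme.{u}} (t : T' ⟶ T) (g : T' ⟶ G.carrier) (h), t ≫ d = e t g h := by
  have e0 := pullback.condition (f := y) (g := D.p)
  have congr : ∀ {T' : Scheme.{u}} {t t' : T' ⟶ T} {g g' : T' ⟶ G.carrier} (_ : t = t') (_ : g = g') (h h'),
    e t g h = e t' g' h' := by intro T' t t' g g' ht hg h h'; subst ht; subst hg; rfl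
  obtain ⟨d, hd⟩ := exists_fpqc_desc (pullback.fst y D.p) (e (pullback.fst y D.p) (pullback.snd y D.p) e0.symm) (by
    intro W g₁ g₂ hg
    rw [nat g₁ _ _ _ (by rw [Category.assoc, Category.assoc, e0]),
      nat g₂ _ _ _ (by rw [Category.assoc, Category.assoc, e0])]
    have h3 : (g₂ ≫ pullback.snd y D.p) ≫ D.p = (g₁ ≫ pullback.fst y D.p) ≫ y := by
      rw [hg, Category.assoc, Category.assoc, e0]
    exact (inv _ _ _ _ h3).trans (congr hg rfl _ _))
  refine ⟨d, fun {T'} t g h => ?_⟩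
  have e1 : pullback.lift t g h.symm ≫ pullback.fst y D.p = t := pullback.lift_fst _ _ _
  have e2 : pullback.lift t g h.symm ≫ pullback.snd y D.p = g := pullback.lift_snd _ _ _
  calc t ≫ d = pullback.lift t g h.symm ≫ pullback.fst y D.p ≫ d := by rw [← Category.assoc, e1]
    _ = _ := by
      rw [hd, nat _ _ _ _ (by rw [e1, e2, h])]
      exact congr e1 e2 _ _

theorem hom_ext_p {T Y : Scheme.{u}} (y : T ⟶ Spec (.of D.A)) {d d' : T ⟶ Y}
    (h : ∀ {T' : Scheme.{u}} (t : T' ⟶ T) (g : T' ⟶ G.carrier), g ≫ D.p = t ≫ y → t ≫ d = t ≫ d') : d = d' :=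
  fpqc_ext (pullback.fst y D.p) (h _ _ (pullback.condition (f := y) (g := D.p)).symm)

/-- descent of functions -/
theorem desc_fun {T : Scheme.{u}} (s : T ⟶ Spk k)
    (e : ∀ {T' : Scheme.{u}} (t : T' ⟶ T) (g : T' ⟶ G.carrier), g ≫ G.str = t ≫ s → Γ(T', ⊤))
    (nat : ∀ {T' T'' : Scheme.{u}} (t' : T'' ⟶ T') (t : T' ⟶ T) (g : T' ⟶ G.carrier) (h h'),
      t'.appTop (e t g h) = e (t' ≫ t) (t' ≫ g) h')
    (inv : ∀ {T' : Scheme.{u}} (t : T' ⟶ T) (g g' : T' ⟶ G.carrier) (h h'), g ≫ D.p = g' ≫ D.p → e t g h = e t g' h') :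
    ∃ d : Γ(prodE D.A s, ⊤), ∀ {T' : Scheme.{u}} (t : T' ⟶ T) (g : T' ⟶ G.carrier) (h : g ≫ G.str = t ≫ s),
      (prodE.lift t (g ≫ D.p) (h.symm.trans (D.str_of_p g).symm)).appTop d = e t g h := by
  have hst : ∀ {T' : Scheme.{u}} (t : T' ⟶ prodE D.A s) (g : T' ⟶ G.carrier), g ≫ D.p = t ≫ pullback.snd _ _ →
    g ≫ G.str = (t ≫ pullback.fst _ _) ≫ s := by
    intro T' t g h
    rw [← D.str_of_p, h, Category.assoc, Category.assoc, pullback.condition]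
  obtain ⟨d, hd⟩ := D.desc_hom (T := prodE D.A s) (Y := A1) (pullback.snd _ _)
    (fun {T'} t g h => (toA1 T').symm (e (t ≫ pullback.fst _ _) g (hst t g h))) (by
      intro T' T'' t' t g h h'
      apply (toA1 T'').injective
      rw [toA1_comp, Equiv.apply_symm_apply, Equiv.apply_symm_apply, nat _ _ _ _ (by
        rw [Category.assoc, hst t g h, Category.assoc, Category.assoc, Category.assoc])]
      congr 1) (by
      intro T' t g g' h h'
      apply (toA1 T').injective
      rw [Equiv.apply_symm_apply, Equiv.apply_symm_apply]
      exact inv _ _ _ _ _ (h.trans h'.symm))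
  refine ⟨toA1 _ d, fun {T'} t g h => ?_⟩
  have e1 : prodE.lift t (g ≫ D.p) (h.symm.trans (D.str_of_p g).symm) ≫ pullback.fst s (strOf k D.A) = t := pullback.lift_fst _ _ _
  have e2 : prodE.lift t (g ≫ D.p) (h.symm.trans (D.str_of_p g).symm) ≫ pullback.snd s (strOf k D.A) = g ≫ D.p := pullback.lift_snd _ _ _
  have := hd (prodE.lift t (g ≫ D.p) (h.symm.trans (D.str_of_p g).symm)) g e2.symm
  rw [← toA1_comp, this, Equiv.apply_symm_apply]
  congr 1

theorem fun_ext {T : Scheme.{u}} {s : T ⟶ Spk k} {d d' : Γ(prodE D.A s, ⊤)}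
    (H : ∀ {T' : Scheme.{u}} (t : T' ⟶ T) (g : T' ⟶ G.carrier) (h : g ≫ G.str = t ≫ s),
      (prodE.lift t (g ≫ D.p) (h.symm.trans (D.str_of_p g).symm)).appTop d =
      (prodE.lift t (g ≫ D.p) (h.symm.trans (D.str_of_p g).symm)).appTop d') : d = d' := by
  have e0 := pullback.condition (f := pullback.snd s (strOf k D.A)) (g := D.p)
  refine fpqc_appTop_ext (pullback.fst (pullback.snd s (strOf k D.A)) D.p) ?_
  have h0 : pullback.snd (pullback.snd s (strOf k D.A)) D.p ≫ G.str =
    (pullback.fst (pullback.snd s (strOf k D.A)) D.p ≫ pullback.fst s (strOf k D.A)) ≫ s := by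
    rw [← D.str_of_p, ← e0, Category.assoc, Category.assoc, pullback.condition]
  have e1 : prodE.lift (pullback.fst (pullback.snd s (strOf k D.A)) D.p ≫ pullback.fst s (strOf k D.A))
    (pullback.snd (pullback.snd s (strOf k D.A)) D.p ≫ D.p) (h0.symm.trans (D.str_of_p _).symm) =
      pullback.fst (pullback.snd s (strOf k D.A)) D.p := pullback.hom_ext
        (pullback.lift_fst _ _ _) ((pullback.lift_snd _ _ _).trans e0.symm)
  have := H _ _ h0
  rwa [e1] at this

/-- the translation action on the product -/
theorem exists_sig {T : Scheme.{u}} {s : T ⟶ Spk k} (g : G.Pt s) :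
    ∃ σ : prodE D.A s ⟶ prodE D.A s, σ ≫ pullback.fst _ _ = pullback.fst _ _ ∧
     ∀ {T' : Scheme.{u}} {s' : T' ⟶ Spk k} (t : T' ⟶ T) (ht : t ≫ s = s') (g' : G.Pt s') (h h'),
      prodE.lift t (g'.1 ≫ D.p) h ≫ σ = prodE.lift t ((g.pull t ht * g' : G.Pt s').1 ≫ D.p) h' := by
  have hst : ∀ {T' : Scheme.{u}} (t : T' ⟶ prodE D.A s) (g : T' ⟶ G.carrier), g ≫ D.p = t ≫ pullback.snd _ _ →
    g ≫ G.str = (t ≫ pullback.fst _ _) ≫ s := by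
    intro T' t g h
    rw [← D.str_of_p, h, Category.assoc, Category.assoc, pullback.condition]
  obtain ⟨d, hd⟩ := D.desc_hom (T := prodE D.A s) (Y := Spec (.of D.A)) (pullback.snd _ _)
    (fun {T'} t g' h => ((g.pull (t ≫ pullback.fst _ _) rfl : G.Pt ((t ≫ pullback.fst _ _) ≫ s)) * G.mkPt g' (hst t g' h)).1 ≫ D.p) (by
      intro T' T'' t' t g' h h'
      refine (Category.assoc _ _ _).symm.trans (congrArg (· ≫ D.p) ?_)
      refine (G.mul_natural _ _ _ _ (by
        refine (Category.assoc _ _ _).trans ((congrArg (t' ≫ ·) ?_).trans (Category.assoc _ _ _).symm)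
        exact (Category.assoc _ _ _).trans ((congrArg ((t ≫ pullback.fst s (strOf k D.A)) ≫ ·) g.2).trans (hst t g' h).symm))).trans (G.mul_congr ?_ rfl _ _)
      exact (by simp : t' ≫ (t ≫ pullback.fst s (strOf k D.A)) ≫ g.1 = ((t' ≫ t) ≫ pullback.fst s (strOf k D.A)) ≫ g.1)) (by
      intro T' t g₁ g₂ h₁ h₂
      refine (D.coset _ _).2 ?_
      obtain ⟨η, hη⟩ := (D.coset (s := (t ≫ pullback.fst _ _) ≫ s) (G.mkPt g₁ (hst t g₁ h₁)) (G.mkPt g₂ (hst t g₂ h₂))).1 (h₁.trans h₂.symm)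
      exact ⟨η, by rw [mul_assoc, hη]⟩)
  have hd2 : ∀ {T' : Scheme.{u}} {s' : T' ⟶ Spk k} (t : T' ⟶ prodE D.A s) (ht : (t ≫ pullback.fst _ _) ≫ s = s') (g' : G.Pt s'),
     g'.1 ≫ D.p = t ≫ pullback.snd _ _ → t ≫ d = (g.pull (t ≫ pullback.fst _ _) ht * g' : G.Pt s').1 ≫ D.p := by
    intro T' s' t ht g' h
    subst ht
    exact hd t g'.1 h
  have hdk : d ≫ strOf k D.A = pullback.fst s (strOf k D.A) ≫ s := by
    refine D.hom_ext_p (pullback.snd _ _) fun {T'} t g' h => ?_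
    rw [← Category.assoc, hd t g' h, D.str_of_p]
    exact (G.mul_str _ _ _).trans ((Category.assoc _ _ _).trans ((congrArg ((t ≫ pullback.fst s (strOf k D.A)) ≫ ·) g.2).trans (Category.assoc _ _ _)))
  refine ⟨prodE.lift (pullback.fst _ _) d hdk.symm, pullback.lift_fst _ _ _, ?_⟩
  intro T' s' t ht g' h h'
  have e1 : prodE.lift t (g'.1 ≫ D.p) h ≫ pullback.fst s (strOf k D.A) = t := pullback.lift_fst _ _ _
  have e2 : prodE.lift t (g'.1 ≫ D.p) h ≫ pullback.snd s (strOf k D.A) = g'.1 ≫ D.p := pullback.lift_snd _ _ _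
  have e3 := hd2 (s' := s') (prodE.lift t (g'.1 ≫ D.p) h) (by rw [e1, ht]) g' e2.symm
  have e4 : (g.pull (prodE.lift t (g'.1 ≫ D.p) h ≫ pullback.fst s (strOf k D.A)) (by rw [e1, ht]) : G.Pt s') = g.pull t ht :=
    Pt.ext (congrArg (· ≫ g.1) e1)
  rw [e4] at e3
  refine (prodE.comp_lift _ _ _ _ (by rw [e1, e3]; exact h')).trans (prodE.lift_congr e1 e3 _ _)

def sig {T : Scheme.{u}} {s : T ⟶ Spk k} (g : G.Pt s) : prodE D.A s ⟶ prodE D.A s := (D.exists_sig g).choose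
theorem sig_fst {T : Scheme.{u}} {s : T ⟶ Spk k} (g : G.Pt s) : D.sig g ≫ pullback.fst _ _ = pullback.fst _ _ :=
  (D.exists_sig g).choose_spec.1
theorem lift_sig {T : Scheme.{u}} {s : T ⟶ Spk k} (g : G.Pt s) {T' : Scheme.{u}} {s' : T' ⟶ Spk k} (t : T' ⟶ T) (ht : t ≫ s = s') (g' : G.Pt s') (h h') :
      prodE.lift t (g'.1 ≫ D.p) h ≫ D.sig g = prodE.lift t ((g.pull t ht * g' : G.Pt s').1 ≫ D.p) h' :=
  (D.exists_sig g).choose_spec.2 t ht g' h h'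

theorem sig_mul {T : Scheme.{u}} {s : T ⟶ Spk k} (g g' : G.Pt s) (e : g' * g = 1) : D.sig g ≫ D.sig g' = 𝟙 _ := by
  refine D.hom_ext_p (pullback.snd s (strOf k D.A)) fun {T'} t a h => ?_
  let s' := (t ≫ pullback.fst s (strOf k D.A)) ≫ s
  have ha : a ≫ G.str = s' := by rw [← D.str_of_p, h, Category.assoc, ← pullback.condition]; exact (Category.assoc _ _ _).symm
  let a' : G.Pt s' := ⟨a, ha⟩
  have hh : ∀ b : G.Pt s', (t ≫ pullback.fst s (strOf k D.A)) ≫ s = (b.1 ≫ D.p) ≫ strOf k D.A := fun b => by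
    rw [D.str_of_p, b.2]
  have et : t = prodE.lift (t ≫ pullback.fst s (strOf k D.A)) (a'.1 ≫ D.p) (hh a') := pullback.hom_ext
    (pullback.lift_fst _ _ _).symm (h.symm.trans (pullback.lift_snd _ _ _).symm)
  rw [Category.comp_id, ← Category.assoc]
  conv_rhs => rw [et]
  conv_lhs => rw [et]
  rw [D.lift_sig g _ rfl a' _ (hh _), D.lift_sig g' _ rfl _ _ (hh _), ← mul_assoc, ← GroupSchemeOver.pull_mul, e,
    GroupSchemeOver.pull_one, one_mul]
end QData

section auto
variable {E : Type u} [CommRing E] [Algebra k E] 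

theorem uni_factor {T : Scheme.{u}} {s : T ⟶ Spk k} {R : Type u} [CommRing R] [Algebra k R] (t : Spec (.of R) ⟶ T) (h : t ≫ s = strOf k R)
    (m : Spec (.of (R ⊗[k] E)) ⟶ prodE E s) (hm : m ≫ pullback.fst _ _ = Spec.map (CommRingCat.ofHom (algebraMap R (R ⊗[k] E))) ≫ t) :
    ∃ θ : R ⊗[k] E →ₐ[R] R ⊗[k] E, Spec.map (CommRingCat.ofHom (θ : R ⊗[k] E →+* R ⊗[k] E)) ≫ uni E t h = m := by
  obtain ⟨γ0, hγ0⟩ := Spec.map_surjective (m ≫ pullback.snd _ _)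
  have hstr : m ≫ pullback.snd _ _ ≫ strOf k E = strOf k (R ⊗[k] E) := by
    rw [← pullback.condition, ← Category.assoc, hm, Category.assoc, h]
    exact spec_algHom (Algebra.TensorProduct.includeLeft : R →ₐ[k] R ⊗[k] E)
  obtain ⟨γ, hγ⟩ := exists_algHom (k := k) γ0.hom (R := E) (R' := R ⊗[k] E) (by
    rw [CommRingCat.ofHom_hom, hγ0, Category.assoc, hstr])
  refine ⟨Algebra.TensorProduct.lift (Algebra.ofId R (R ⊗[k] E)) γ (fun _ _ => Commute.all _ _), ?_⟩
  have e1 : Spec.map (CommRingCat.ofHom ((Algebra.TensorProduct.lift (Algebra.ofId R (R ⊗[k] E)) γ (fun _ _ => Commute.all _ _) : R ⊗[k] E →ₐ[R] R ⊗[k] E) : R ⊗[k] E →+* R ⊗[k] E)) ≫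
     Spec.map (CommRingCat.ofHom (algebraMap R (R ⊗[k] E))) = Spec.map (CommRingCat.ofHom (algebraMap R (R ⊗[k] E))) := by
    rw [← Spec.map_comp]
    congr 1
    ext x
    exact AlgHom.commutes (Algebra.TensorProduct.lift (Algebra.ofId R (R ⊗[k] E)) γ (fun _ _ => Commute.all _ _) : R ⊗[k] E →ₐ[R] R ⊗[k] E) x
  have e2 : Spec.map (CommRingCat.ofHom ((Algebra.TensorProduct.lift (Algebra.ofId R (R ⊗[k] E)) γ (fun _ _ => Commute.all _ _) : R ⊗[k] E →ₐ[R] R ⊗[k] E) : R ⊗[k] E →+* R ⊗[k] E)) ≫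
     Spec.map (CommRingCat.ofHom ((Algebra.TensorProduct.includeRight : E →ₐ[k] R ⊗[k] E) : E →+* R ⊗[k] E)) = m ≫ pullback.snd _ _ := by
    rw [← Spec.map_comp, ← hγ0]
    congr 1
    ext x
    have : γ0.hom x = γ x := congrArg (fun f => f x) hγ.symm
    simp only [CommRingCat.hom_comp, CommRingCat.hom_ofHom, RingHom.comp_apply]
    refine Eq.trans ?_ this.symm
    show Algebra.TensorProduct.lift (Algebra.ofId R (R ⊗[k] E)) γ (fun _ _ => Commute.all _ _) (1 ⊗ₜ x) = _
    rw [Algebra.TensorProduct.lift_tmul, map_one, one_mul]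
  refine (prodE.comp_lift _ _ _ _ (by
    rw [e2, ← Category.assoc, e1, Category.assoc, Category.assoc, hstr, h]
    exact spec_algHom (Algebra.TensorProduct.includeLeft : R →ₐ[k] R ⊗[k] E))).trans ?_
  refine pullback.hom_ext ((pullback.lift_fst _ _ _).trans ?_) ((pullback.lift_snd _ _ _).trans e2)
  rw [← Category.assoc, e1, hm]

theorem uni_cancel {T : Scheme.{u}} {s : T ⟶ Spk k} {R : Type u} [CommRing R] [Algebra k R] (t : Spec (.of R) ⟶ T) (h : t ≫ s = strOf k R)
    (θ : R ⊗[k] E →ₐ[R] R ⊗[k] E) (hθ : Spec.map (CommRingCat.ofHom (θ : R ⊗[k] E →+* R ⊗[k] E)) ≫ uni E t h = uni E t h) :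
    θ = AlgHom.id R _ := by
  have h2 : uni E t h ≫ pullback.snd _ _ = Spec.map (CommRingCat.ofHom ((Algebra.TensorProduct.includeRight : E →ₐ[k] R ⊗[k] E) : E →+* R ⊗[k] E)) := pullback.lift_snd _ _ _
  have h3 := congrArg (· ≫ pullback.snd _ _) hθ
  simp only [Category.assoc] at h3
  rw [h2, ← Spec.map_comp] at h3
  have h4 := Spec.map_injective h3
  ext x
  exact congrArg (fun f => f.hom x) h4

variable [Module.Finite k E]
theorem gN_auto {T : Scheme.{u}} {s : T ⟶ Spk k} (σ σ' : prodE E s ⟶ prodE E s) (h1 : σ ≫ pullback.fst _ _ = pullback.fst _ _)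
    (h2 : σ' ≫ pullback.fst _ _ = pullback.fst _ _) (h12 : σ ≫ σ' = 𝟙 _) (h21 : σ' ≫ σ = 𝟙 _) (f : Γ(prodE E s, ⊤)) :
    gN s (σ.appTop f) = gN s f := by
  refine global_ext' s fun R _ _ t h => ?_
  have hu : uni E t h ≫ pullback.fst _ _ = Spec.map (CommRingCat.ofHom (algebraMap R (R ⊗[k] E))) ≫ t := pullback.lift_fst _ _ _
  obtain ⟨θ, hθ⟩ := uni_factor t h (uni E t h ≫ σ) (by rw [Category.assoc, h1, hu])
  obtain ⟨θ', hθ'⟩ := uni_factor t h (uni E t h ≫ σ') (by rw [Category.assoc, h2, hu])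
  have k1 : θ.comp θ' = AlgHom.id R _ := uni_cancel t h _ (by
    have e : CommRingCat.ofHom ((θ.comp θ' : R ⊗[k] E →ₐ[R] R ⊗[k] E) : R ⊗[k] E →+* R ⊗[k] E) =
      CommRingCat.ofHom (θ' : R ⊗[k] E →+* R ⊗[k] E) ≫ CommRingCat.ofHom (θ : R ⊗[k] E →+* R ⊗[k] E) := rfl
    rw [e, Spec.map_comp, Category.assoc, hθ', ← Category.assoc, hθ, Category.assoc, h12, Category.comp_id])
  have k2 : θ'.comp θ = AlgHom.id R _ := uni_cancel t h _ (by
    have e : CommRingCat.ofHom ((θ'.comp θ : R ⊗[k] E →ₐ[R] R ⊗[k] E) : R ⊗[k] E →+* R ⊗[k] E) =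
      CommRingCat.ofHom (θ : R ⊗[k] E →+* R ⊗[k] E) ≫ CommRingCat.ofHom (θ' : R ⊗[k] E →+* R ⊗[k] E) := rfl
    rw [e, Spec.map_comp, Category.assoc, hθ, ← Category.assoc, hθ', Category.assoc, h21, Category.comp_id])
  rw [evalAt_gN _ t h, evalAt_gN _ t h]
  have e3 : evE t h (σ.appTop f) = AlgEquiv.ofAlgHom θ θ' k1 k2 (evE t h f) := by
    have a1 := evalAt_appTop (R := .of (R ⊗[k] E)) (uni E t h) σ f
    rw [← hθ] at a1
    exact a1.trans (evalAt_comp (CommRingCat.ofHom (θ : R ⊗[k] E →+* R ⊗[k] E)) (uni E t h) f)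
  rw [e3]
  exact Algebra.norm_eq_of_algEquiv _ _
end auto

theorem QData.gN_sig {G H : GroupSchemeOver k} {ι : GroupHom H G} (D : QData G H ι) {T : Scheme.{u}} {s : T ⟶ Spk k} (g : G.Pt s)
    (f : Γ(prodE D.A s, ⊤)) : gN s ((D.sig g).appTop f) = gN s f :=
  gN_auto _ (D.sig g⁻¹) (D.sig_fst _) (D.sig_fst _) (D.sig_mul _ _ (inv_mul_cancel g)) (D.sig_mul _ _ (mul_inv_cancel g)) f
end
end

section
noncomputable section
variable {k : Type u} [Field k]
open SchemeOver LinearizationData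

theorem SchemeOver.pull_mkPt {X : SchemeOver k} {T T' : Scheme.{u}} {s : T ⟶ Spk k} {s' : T' ⟶ Spk k} (t : T' ⟶ T) (h : t ≫ s = s')
    (x : T ⟶ X.carrier) (hx : x ≫ X.str = s) (h') : (X.mkPt x hx).pull t h = X.mkPt (s := s') (t ≫ x) h' := rfl

theorem SchemeOver.mkPt_congr {X : SchemeOver k} {T : Scheme.{u}} {s : T ⟶ Spk k} {x x' : T ⟶ X.carrier} (e : x = x') (h h') :
    X.mkPt (s := s) x h = X.mkPt x' h' := by subst e; rfl

variable {G H : GroupSchemeOver k} {ι : GroupHom H G} {X : SchemeOver k} (α : ActionOver G X)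

theorem ActionOver.res_ac {T : Scheme.{u}} {s : T ⟶ Spk k} (η : H.Pt s) (x : X.Pt s) : (α.res ι).ac η x = α.ac (ι.map η) x := rfl

variable {α} {L : LineBundle X.carrier} (Λ : LinearizationData (α.res ι) L)

/-- equivariant frames -/
structure EqFr (T : Scheme.{u}) : Type (u+1) where
  x : T ⟶ X.carrier
  w : ∀ {T' : Scheme.{u}} {s' : T' ⟶ Spk k} (t : T' ⟶ T) (_ : G.Pt s') (_ : (t ≫ x) ≫ X.str = s'), L.totOver.Pt s'
  w_base : ∀ {T' : Scheme.{u}} {s' : T' ⟶ Spk k} (t : T' ⟶ T) (g : G.Pt s') (h : (t ≫ x) ≫ X.str = s'),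
    base (w t g h) = α.ac g⁻¹ (X.mkPt (t ≫ x) h)
  w_gen : ∀ {T' : Scheme.{u}} {s' : T' ⟶ Spk k} (t : T' ⟶ T) (g : G.Pt s') (h : (t ≫ x) ≫ X.str = s'),
    L.IsGen (w t g h).1
  w_nat : ∀ {T' T'' : Scheme.{u}} {s' : T' ⟶ Spk k} {s'' : T'' ⟶ Spk k} (t' : T'' ⟶ T') (ht' : t' ≫ s' = s'')
    (t : T' ⟶ T) (g : G.Pt s') (h h'), (w t g h).pull t' ht' = w (t' ≫ t) (g.pull t' ht') h'
  w_eqv : ∀ {T' : Scheme.{u}} {s' : T' ⟶ Spk k} (t : T' ⟶ T) (g : G.Pt s') (η : H.Pt s') (h),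
    Λ.la η (w t (g * ι.map η) h) = w t g h

namespace EqFr
variable {Λ}
theorem w_congr {T : Scheme.{u}} (w : EqFr Λ T) {T' : Scheme.{u}} {s' : T' ⟶ Spk k} {t t' : T' ⟶ T} {g g' : G.Pt s'}
    (ht : t = t') (hg : g = g') (h h') : w.w t g h = w.w t' g' h' := by subst ht; subst hg; rfl

theorem ext' {T : Scheme.{u}} {w w' : EqFr Λ T} (hx : w.x = w'.x)
    (h : ∀ {T' : Scheme.{u}} {s' : T' ⟶ Spk k} (t : T' ⟶ T) (g : G.Pt s') (h h'), w.w t g h = w'.w t g h') : w = w' := by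
  obtain ⟨x, w, h1, h2, h3, h4⟩ := w
  obtain ⟨x', w', h1', h2', h3', h4'⟩ := w'
  dsimp only at hx
  subst hx
  congr 1
  funext T' s' t g hh
  exact h t g hh hh

def pull {T T' : Scheme.{u}} (t : T' ⟶ T) (w : EqFr Λ T) : EqFr Λ T' where
  x := t ≫ w.x
  w t' g h := w.w (t' ≫ t) g (by rw [← h]; simp only [Category.assoc])
  w_base t' g h := by rw [w.w_base]; congr 1
  w_gen t' g h := w.w_gen _ _ _
  w_nat t' ht' t g h h' := by
    rw [w.w_nat _ _ _ _ _ (by rw [← h']; simp only [Category.assoc])]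
    exact w.w_congr (Category.assoc _ _ _) rfl _ _
  w_eqv t g η h := w.w_eqv _ _ _ _

theorem pull_w {T T' : Scheme.{u}} (t : T' ⟶ T) (w : EqFr Λ T) {T'' : Scheme.{u}} {s' : T'' ⟶ Spk k} (t' : T'' ⟶ T') (g : G.Pt s') (h h') :
    (w.pull t).w t' g h = w.w (t' ≫ t) g h' := rfl

theorem pull_pull {T T' T'' : Scheme.{u}} (s : T'' ⟶ T') (t : T' ⟶ T) (w : EqFr Λ T) : (w.pull t).pull s = w.pull (s ≫ t) :=
  ext' (Category.assoc _ _ _).symm fun t' g h h' => w.w_congr (Category.assoc _ _ _) rfl _ _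

theorem pull_id {T : Scheme.{u}} (w : EqFr Λ T) : w.pull (𝟙 T) = w :=
  ext' (Category.id_comp _) fun t' g h h' => w.w_congr (Category.comp_id _) rfl _ _

/-- translation of frames -/
def tau {T : Scheme.{u}} {s : T ⟶ Spk k} (g : G.Pt s) (w : EqFr Λ T) (hs : w.x ≫ X.str = s) : EqFr Λ T where
  x := (α.ac g (X.mkPt w.x hs)).1
  w {T' s'} t g' h :=
    have ht : t ≫ s = s' := by rw [← h, Category.assoc]; exact congrArg (t ≫ ·) (α.ac g (X.mkPt w.x hs)).2.symm
    w.w t ((g.pull t ht : G.Pt s')⁻¹ * g') (by rw [Category.assoc, hs, ht])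
  w_base {T' s'} t g' h := by
    have ht : t ≫ s = s' := by rw [← h, Category.assoc]; exact congrArg (t ≫ ·) (α.ac g (X.mkPt w.x hs)).2.symm
    have h0 : (t ≫ w.x) ≫ X.str = s' := by rw [Category.assoc, hs, ht]
    refine (w.w_base _ _ _).trans ?_
    rw [mul_inv_rev, inv_inv, ActionOver.mul_ac]
    congr 1
    exact (α.pull_ac t ht g (X.mkPt w.x hs)).symm
  w_gen t g h := w.w_gen _ _ _
  w_nat {T' T'' s' s''} t' ht' t g' h h' := by
    have ht : (t' ≫ t) ≫ s = s'' := by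
      rw [← h', Category.assoc (t' ≫ t)]; exact congrArg ((t' ≫ t) ≫ ·) (α.ac g (X.mkPt w.x hs)).2.symm
    rw [w.w_nat _ _ _ _ _ (by rw [Category.assoc, hs, ht])]
    refine w.w_congr rfl ?_ _ _
    rw [GroupSchemeOver.pull_mul, GroupSchemeOver.pull_inv, Pt.pull_pull]
  w_eqv t g' η h := by
    refine Eq.trans ?_ (w.w_eqv t _ η _)
    congr 1
    exact w.w_congr rfl (mul_assoc _ _ _).symm _ _

theorem tau_w {T : Scheme.{u}} {s : T ⟶ Spk k} (g : G.Pt s) (w : EqFr Λ T) (hs : w.x ≫ X.str = s) {T' : Scheme.{u}} {s' : T' ⟶ Spk k}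
   (t : T' ⟶ T) (g' : G.Pt s') (h) (ht : t ≫ s = s') (h') :
   (w.tau g hs).w t g' h = w.w t ((g.pull t ht : G.Pt s')⁻¹ * g') h' := rfl
theorem tau_x {T : Scheme.{u}} {s : T ⟶ Spk k} (g : G.Pt s) (w : EqFr Λ T) (hs : w.x ≫ X.str = s) :
   (w.tau g hs).x = (α.ac g (X.mkPt w.x hs)).1 := rfl
theorem tau_str {T : Scheme.{u}} {s : T ⟶ Spk k} (g : G.Pt s) (w : EqFr Λ T) (hs : w.x ≫ X.str = s) :
   (w.tau g hs).x ≫ X.str = s := (α.ac g (X.mkPt w.x hs)).2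

theorem tau_mul {T : Scheme.{u}} {s : T ⟶ Spk k} (g g' : G.Pt s) (w : EqFr Λ T) (hs : w.x ≫ X.str = s) (hs') :
    (w.tau g' hs).tau g hs' = w.tau (g * g') hs :=
  ext' (congrArg Subtype.val (α.mul_ac g g' (X.mkPt w.x hs)).symm) fun {T' s'} t a h h' => by
    have ht : t ≫ s = s' := by rw [← h', Category.assoc]; exact congrArg (t ≫ ·) (α.ac (g * g') (X.mkPt w.x hs)).2.symm
    have h0 : (t ≫ w.x) ≫ X.str = s' := by rw [Category.assoc, hs, ht]
    refine w.w_congr rfl ?_ h0 h0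
    rw [GroupSchemeOver.pull_mul, mul_inv_rev, mul_assoc]

theorem tau_one {T : Scheme.{u}} {s : T ⟶ Spk k} (w : EqFr Λ T) (hs : w.x ≫ X.str = s) :
    w.tau 1 hs = w :=
  ext' (congrArg Subtype.val (α.one_ac (X.mkPt w.x hs))) fun {T' s'} t a h h' => by
    refine w.w_congr rfl ?_ h' h'
    rw [GroupSchemeOver.pull_one, inv_one, one_mul]

theorem pull_tau {T T' : Scheme.{u}} {s : T ⟶ Spk k} {s' : T' ⟶ Spk k} (t : T' ⟶ T) (ht : t ≫ s = s') (g : G.Pt s) (w : EqFr Λ T)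
    (hs : w.x ≫ X.str = s) (hs') : (w.tau g hs).pull t = (w.pull t).tau (g.pull t ht : G.Pt s') hs' :=
  ext' (congrArg Subtype.val (α.pull_ac t ht g (X.mkPt w.x hs))) fun {T'' s''} t' a h h' => by
    have ht' : t' ≫ s' = s'' := by
      rw [← h', Category.assoc]; exact congrArg (t' ≫ ·) (α.ac (g.pull t ht) (X.mkPt (w.pull t).x hs')).2.symm
    have h0 : ((t' ≫ t) ≫ w.x) ≫ X.str = s'' := by rw [Category.assoc, hs, Category.assoc, ht, ht']
    refine w.w_congr rfl ?_ h0 h0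
    rw [Pt.pull_pull]

variable (D : QData G H ι)
/-- the function on `T × G/H` comparing two frames -/
def IsRatio {T : Scheme.{u}} (w w' : EqFr Λ T) (s : T ⟶ Spk k) (r : Γ(prodE D.A s, ⊤)) : Prop :=
  ∀ {T' : Scheme.{u}} {s' : T' ⟶ Spk k} (t : T' ⟶ T) (g : G.Pt s') (h h' hh),
    (prodE.lift t (g.1 ≫ D.p) hh).appTop r = L.ratio (w.w t g h).1 (w'.w t g h').1

variable {D}
theorem ratio_inv {T : Scheme.{u}} (w w' : EqFr Λ T) (hx : w'.x = w.x) {T' : Scheme.{u}} {s' : T' ⟶ Spk k} (t : T' ⟶ T) (g g' : G.Pt s') (h h')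
    (hg : g.1 ≫ D.p = g'.1 ≫ D.p) : L.ratio (w.w t g h).1 (w'.w t g h').1 = L.ratio (w.w t g' h).1 (w'.w t g' h').1 := by
  obtain ⟨η, rfl⟩ := (D.coset _ _).1 hg
  have hb : (w'.w t (g * ι.map η) h').1 ≫ L.π = (w.w t (g * ι.map η) h).1 ≫ L.π := by
    have h1 := w.w_base t (g * ι.map η) h
    have h2 := w'.w_base t (g * ι.map η) h'
    rw [mkPt_congr (congrArg (t ≫ ·) hx) h' h, ← h1] at h2
    exact congrArg Subtype.val h2
  refine (w.w_gen t g h).ratio_eq ?_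
  have e := (w.w_gen t (g * ι.map η) h).smul_ratio hb
  have e2 : sm (L.ratio (w.w t (g * ι.map η) h).1 (w'.w t (g * ι.map η) h').1) (w.w t (g * ι.map η) h) = w'.w t (g * ι.map η) h' := Pt.ext e
  have e3 := congrArg (Λ.la η) e2
  rw [la_sm, w.w_eqv, w'.w_eqv] at e3
  exact congrArg Subtype.val e3

theorem w_π_eq {T : Scheme.{u}} (w w' : EqFr Λ T) (hx : w'.x = w.x) {T' : Scheme.{u}} {s' : T' ⟶ Spk k} (t : T' ⟶ T) (g : G.Pt s') (h h') :
    (w'.w t g h').1 ≫ L.π = (w.w t g h).1 ≫ L.π := by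
  have h1 := w.w_base t g h
  have h2 := w'.w_base t g h'
  rw [mkPt_congr (congrArg (t ≫ ·) hx) h' h, ← h1] at h2
  exact congrArg Subtype.val h2

variable (D) in
theorem exists_isRatio {T : Scheme.{u}} (w w' : EqFr Λ T) (hx : w'.x = w.x) (s : T ⟶ Spk k) (hs : w.x ≫ X.str = s) :
    ∃ r, IsRatio D w w' s r := by
  have hs' : w'.x ≫ X.str = s := by rw [hx, hs]
  obtain ⟨r, hr⟩ := D.desc_fun s (fun {T'} t g h =>
    L.ratio (w.w (s' := t ≫ s) t (G.mkPt g h) (by rw [Category.assoc, hs])).1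
      (w'.w (s' := t ≫ s) t (G.mkPt g h) (by rw [Category.assoc, hs'])).1) (by
    intro T' T'' t' t g h h'
    have hh : t' ≫ t ≫ s = (t' ≫ t) ≫ s := (Category.assoc _ _ _).symm
    have hw : ((t' ≫ t) ≫ w.x) ≫ X.str = (t' ≫ t) ≫ s := by rw [Category.assoc, hs]
    have hw' : ((t' ≫ t) ≫ w'.x) ≫ X.str = (t' ≫ t) ≫ s := by rw [Category.assoc, hs']
    have hv : (t ≫ w.x) ≫ X.str = t ≫ s := by rw [Category.assoc, hs]
    have hv' : (t ≫ w'.x) ≫ X.str = t ≫ s := by rw [Category.assoc, hs']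
    have e1 := w.w_nat t' hh t (G.mkPt g h) hv hw
    have e2 := w'.w_nat t' hh t (G.mkPt g h) hv' hw'
    have e3 := (w.w_gen t (G.mkPt g h) hv).ratio_natural (w_π_eq w w' hx t (G.mkPt g h) hv hv') t'
    refine e3.symm.trans ?_
    exact congrArg₂ L.ratio (congrArg Subtype.val e1) (congrArg Subtype.val e2)) (by
    intro T' t g g' h h' hg
    exact ratio_inv (D := D) w w' hx t (G.mkPt g h) (G.mkPt g' h') _ _ hg)
  refine ⟨r, fun {T' s'} t g h h' hh => ?_⟩
  have ht : t ≫ s = s' := by rw [← h, Category.assoc, hs]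
  subst ht
  exact hr t g.1 g.2

theorem IsRatio.unique {T : Scheme.{u}} {w w' : EqFr Λ T} (hx : w'.x = w.x) {s : T ⟶ Spk k} (hs : w.x ≫ X.str = s)
    {r r' : Γ(prodE D.A s, ⊤)} (h : IsRatio D w w' s r) (h' : IsRatio D w w' s r') : r = r' := by
  have hs' : w'.x ≫ X.str = s := by rw [hx, hs]
  refine D.fun_ext fun {T'} t g hg => ?_
  have hv : (t ≫ w.x) ≫ X.str = t ≫ s := by rw [Category.assoc, hs]
  have hv' : (t ≫ w'.x) ≫ X.str = t ≫ s := by rw [Category.assoc, hs']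
  exact (h t (G.mkPt g hg) hv hv' _).trans (h' t (G.mkPt g hg) hv hv' _).symm

variable (D) in
open Classical in
def cc (c0 : ℕ) {T : Scheme.{u}} (w w' : EqFr Λ T) : Γ(T, ⊤) :=
  if hx : w'.x = w.x then gN (w.x ≫ X.str) (exists_isRatio D w w' hx _ rfl).choose ^ c0 else 0

theorem cc_eq (c0 : ℕ) {T : Scheme.{u}} {w w' : EqFr Λ T} (hx : w'.x = w.x) {s : T ⟶ Spk k} (hs : w.x ≫ X.str = s) {r : Γ(prodE D.A s, ⊤)} 
    (hr : IsRatio D w w' s r) : cc D c0 w w' = gN s r ^ c0 := by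
  subst hs
  rw [cc, dif_pos hx]
  congr 2
  exact IsRatio.unique hx rfl (exists_isRatio D w w' hx _ rfl).choose_spec hr

theorem cc_nat (c0 : ℕ) {T T' : Scheme.{u}} (t : T' ⟶ T) (w w' : EqFr Λ T) (hx : w'.x = w.x) :
    cc D c0 (w.pull t) (w'.pull t) = t.appTop (cc D c0 w w') := by
  obtain ⟨r, hr⟩ := exists_isRatio D w w' hx _ rfl
  have hs : (w.pull t).x ≫ X.str = t ≫ w.x ≫ X.str := Category.assoc _ _ _
  rw [cc_eq c0 hx rfl hr, cc_eq c0 (congrArg (t ≫ ·) hx) hs (r := (prodE.map D.A t rfl).appTop r), gN_nat, map_pow]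
  intro T'' s' t' g h h' hh
  have h3 : (t' ≫ t) ≫ w.x ≫ X.str = (g.1 ≫ D.p) ≫ strOf k D.A := by rw [← hh, Category.assoc]
  have e1 := hr (s' := s') (t' ≫ t) g (by rw [← h]; simp only [EqFr.pull, Category.assoc]) (by rw [← h']; simp only [EqFr.pull, Category.assoc]) h3
  rw [← prodE.lift_map t rfl t' (g.1 ≫ D.p) hh h3] at e1
  refine Eq.trans ?_ e1
  rw [Scheme.Hom.comp_appTop]; rfl

theorem isRatio_one {T : Scheme.{u}} (w : EqFr Λ T) (s) : IsRatio D w w s 1 := by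
  intro T' s' t g h h' hh
  rw [map_one, (w.w_gen t g h).ratio_self]

theorem cc_self (c0 : ℕ) {T : Scheme.{u}} (w : EqFr Λ T) : cc D c0 w w = 1 := by
  rw [cc_eq c0 rfl rfl (isRatio_one w _), gN_one, one_pow]

theorem cc_mul (c0 : ℕ) {T : Scheme.{u}} (w w' w'' : EqFr Λ T) (hx : w.x = w'.x) (hx' : w'.x = w''.x) :
    cc D c0 w w' * cc D c0 w' w'' = cc D c0 w w'' := by
  obtain ⟨r, hr⟩ := exists_isRatio D w w' hx.symm _ rfl
  have hs' : w'.x ≫ X.str = w.x ≫ X.str := by rw [hx]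
  have hs'' : w''.x ≫ X.str = w.x ≫ X.str := by rw [hx, hx']
  obtain ⟨r', hr'⟩ := exists_isRatio D w' w'' hx'.symm _ hs'
  rw [cc_eq c0 hx.symm rfl hr, cc_eq c0 hx'.symm hs' hr', cc_eq c0 (hx.trans hx').symm rfl (r := r * r'), gN_mul, mul_pow]
  intro T' s' t g h h'' hh
  have h' : (t ≫ w'.x) ≫ X.str = s' := by rw [← h, hx]
  rw [map_mul, hr t g h h' hh, hr' t g h' h'' hh]
  exact (w.w_gen t g h).ratio_mul (w'.w_gen t g h') (w_π_eq w w' hx.symm _ _ _ _) (w_π_eq w' w'' hx'.symm _ _ _ _)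

theorem cc_tau (c0 : ℕ) {T : Scheme.{u}} {s : T ⟶ Spk k} (g : G.Pt s) (w w' : EqFr Λ T) (hx : w'.x = w.x) (hs : w.x ≫ X.str = s) (hs') :
    cc D c0 (w.tau g hs) (w'.tau g hs') = cc D c0 w w' := by
  obtain ⟨r, hr⟩ := exists_isRatio D w w' hx _ hs
  have hx2 : (w'.tau g hs').x = (w.tau g hs).x := by rw [tau_x, tau_x, mkPt_congr hx hs' hs]
  rw [cc_eq c0 hx hs hr, cc_eq c0 hx2 (tau_str g w hs) (r := (D.sig g⁻¹).appTop r), D.gN_sig]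
  intro T' s' t g' h h' hh
  have ht : t ≫ s = s' := by rw [← h, Category.assoc, tau_str]
  have h0 : (t ≫ w.x) ≫ X.str = s' := by rw [Category.assoc, hs, ht]
  have h0' : (t ≫ w'.x) ≫ X.str = s' := by rw [Category.assoc, hs', ht]
  rw [tau_w g w hs t g' h ht h0, tau_w g w' hs' t g' h' ht h0']
  have h3 : t ≫ s = ((g⁻¹.pull t ht * g' : G.Pt s').1 ≫ D.p) ≫ strOf k D.A := by
    rw [D.str_of_p, ht]; exact (g⁻¹.pull t ht * g' : G.Pt s').2.symm
  have e1 := D.lift_sig g⁻¹ t ht g' hh h3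
  have e2 := hr t (g⁻¹.pull t ht * g' : G.Pt s') h0 h0' h3
  rw [← e1] at e2
  rw [GroupSchemeOver.pull_inv] at e2
  refine Eq.trans ?_ e2
  rw [Scheme.Hom.comp_appTop]; rfl
end EqFr
end
end

section
open scoped TensorProduct
noncomputable section

/-- ring elements as functions on the spectrum -/
def fnS {S : Type u} [CommRing S] (f : S) : Γ(Spec (.of S), ⊤) := (Scheme.ΓSpecIso (.of S)).inv f

theorem evalAt_fnS {S B : Type u} [CommRing S] [CommRing B] (ψ : S →+* B) (f : S) :
    evalAt (R := .of B) (Spec.map (CommRingCat.ofHom ψ)) (fnS f) = ψ f := by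
  have h := evalAt_comp (CommRingCat.ofHom ψ) (𝟙 (Spec (.of S))) (fnS f)
  rw [Category.comp_id] at h
  rw [h]
  have : evalAt (R := .of S) (𝟙 (Spec (.of S))) (fnS f) = f := by
    simp [evalAt, fnS]
  rw [this]; rfl

theorem evalAt_mul' {T : Scheme.{u}} {R : CommRingCat.{u}} (t : Spec R ⟶ T) (a b : Γ(T, ⊤)) : evalAt t (a * b) = evalAt t a * evalAt t b := by
  rw [← evalHom_apply, map_mul]; rfl
theorem evalAt_one' {T : Scheme.{u}} {R : CommRingCat.{u}} (t : Spec R ⟶ T) : evalAt t (1 : Γ(T, ⊤)) = 1 := by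
  rw [← evalHom_apply, map_one]

theorem cocycle_triv {R C S : Type u} [CommRing R] [CommRing C] [CommRing S] [Algebra R C] [Algebra C S] [Module.Finite R C]
    [Module.FaithfullyFlat C S] 
    (Θ : ∀ {T : Scheme.{u}} (u₁ u₂ : T ⟶ Spec (.of S)) (_ : u₁ ≫ Spec.map (CommRingCat.ofHom (algebraMap C S)) =
      u₂ ≫ Spec.map (CommRingCat.ofHom (algebraMap C S))), Γ(T, ⊤))
    (nat : ∀ {T T' : Scheme.{u}} (t : T' ⟶ T) (u₁ u₂ : T ⟶ Spec (.of S)) (h h'), t.appTop (Θ u₁ u₂ h) = Θ (t ≫ u₁) (t ≫ u₂) h')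
    (self : ∀ {T : Scheme.{u}} (u : T ⟶ Spec (.of S)) (h), Θ u u h = 1)
    (mul : ∀ {T : Scheme.{u}} (u₁ u₂ u₃ : T ⟶ Spec (.of S)) (h h' h''), Θ u₁ u₂ h * Θ u₂ u₃ h' = Θ u₁ u₃ h'')
    (p : Ideal R) [p.IsPrime] :
    ∃ (f : Γ(Spec (.of S), ⊤)) (r : R), r ∉ p ∧
      (∀ {T : Scheme.{u}} (u : T ⟶ Spec (.of S)), IsUnit ((u ≫ Spec.map (CommRingCat.ofHom (algebraMap C S)) ≫
         Spec.map (CommRingCat.ofHom (algebraMap R C))).appTop (fnS r)) → IsUnit (u.appTop f)) ∧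
      ∀ {T : Scheme.{u}} (u₁ u₂ : T ⟶ Spec (.of S)) (h), u₁.appTop f = Θ u₁ u₂ h * u₂.appTop f := by
  have Θcongr : ∀ {T : Scheme.{u}} {u₁ u₂ u₁' u₂' : T ⟶ Spec (.of S)} (e : u₁ = u₁') (e' : u₂ = u₂') (h h'), Θ u₁ u₂ h = Θ u₁' u₂' h' := by
    intro T u₁ u₂ u₁' u₂' e e' h h'; subst e e'; rfl
  have hS : ∀ {B : Type u} [CommRing B] [Algebra C B] (z : S →ₐ[C] B), Spec.map (CommRingCat.ofHom (z : S →+* B)) ≫ Spec.map (CommRingCat.ofHom (algebraMap C S)) =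
     Spec.map (CommRingCat.ofHom (algebraMap C B)) := by
    intro B _ _ z
    rw [← Spec.map_comp]; congr 1; ext x; exact z.commutes x
  have hS2 : ∀ {B : Type u} [CommRing B] [Algebra C B] (z z' : S →ₐ[C] B), Spec.map (CommRingCat.ofHom (z : S →+* B)) ≫ Spec.map (CommRingCat.ofHom (algebraMap C S)) =
     Spec.map (CommRingCat.ofHom (z' : S →+* B)) ≫ Spec.map (CommRingCat.ofHom (algebraMap C S)) := fun z z' => (hS z).trans (hS z').symm
  let ev2 : ∀ {B : Type u} [CommRing B] [Algebra C B] (z z' : S →ₐ[C] B), B := fun {B} _ _ z z' => evalAt (R := .of B) (𝟙 (Spec (.of B))) (Θ _ _ (hS2 z z'))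
  let θ : S ⊗[C] S := ev2 Algebra.TensorProduct.includeLeft Algebra.TensorProduct.includeRight
  have hθ : ∀ {B : Type u} [CommRing B] [Algebra C B] (z z' : S →ₐ[C] B), thetaEv θ z z' = ev2 z z' := by
    intro B _ _ z z'
    let ψ := Algebra.TensorProduct.lift z z' (fun _ _ => Commute.all _ _)
    have h1 := evalAt_comp (CommRingCat.ofHom (ψ : S ⊗[C] S →+* B)) (𝟙 (Spec (.of (S ⊗[C] S))))
      (Θ _ _ (hS2 Algebra.TensorProduct.includeLeft Algebra.TensorProduct.includeRight))
    have h2 := evalAt_appTop (𝟙 (Spec (.of B))) (Spec.map (CommRingCat.ofHom (ψ : S ⊗[C] S →+* B)))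
      (Θ _ _ (hS2 Algebra.TensorProduct.includeLeft Algebra.TensorProduct.includeRight))
    rw [Category.comp_id] at h1
    rw [Category.id_comp] at h2
    refine h1.symm.trans (h2.symm.trans ?_)
    have e1 : Spec.map (CommRingCat.ofHom (ψ : S ⊗[C] S →+* B)) ≫ Spec.map (CommRingCat.ofHom ((Algebra.TensorProduct.includeLeft : S →ₐ[C] S ⊗[C] S) : S →+* S ⊗[C] S)) =
       Spec.map (CommRingCat.ofHom (z : S →+* B)) := by
      rw [← Spec.map_comp]; congr 1; ext x; exact (by simp [ψ] : ψ (x ⊗ₜ 1) = z x)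
    have e2 : Spec.map (CommRingCat.ofHom (ψ : S ⊗[C] S →+* B)) ≫ Spec.map (CommRingCat.ofHom ((Algebra.TensorProduct.includeRight : S →ₐ[C] S ⊗[C] S) : S →+* S ⊗[C] S)) =
       Spec.map (CommRingCat.ofHom (z' : S →+* B)) := by
      rw [← Spec.map_comp]; congr 1; ext x; exact (by simp [ψ] : ψ (1 ⊗ₜ x) = z' x)
    refine congrArg (evalAt (R := .of B) (𝟙 (Spec (.of B)))) ?_
    exact (nat _ _ _ _ (by rw [e1, e2]; exact hS2 z z')).trans (Θcongr e1 e2 _ _)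
  have hc : IsThetaCocycle θ := by
    constructor
    · rw [hθ]; exact (congrArg (evalAt (R := .of S) (𝟙 (Spec (.of S)))) (self _ _)).trans (evalAt_one' _)
    · intro B _ _ z₁ z₂ z₃
      rw [hθ, hθ, hθ]
      exact (evalAt_mul' (R := .of B) _ _ _).symm.trans (congrArg (evalAt (R := .of B) (𝟙 (Spec (.of B)))) (mul _ _ _ _ _ _))
  obtain ⟨f, r, s, hr, hfs, hf⟩ := lemmaD θ hc p
  refine ⟨fnS f, r, hr, ?_, ?_⟩
  · intro T u hu
    rw [← Spec.map_comp] at hu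
    have : (u ≫ Spec.map (CommRingCat.ofHom (algebraMap R C) ≫ CommRingCat.ofHom (algebraMap C S))).appTop (fnS r) =
       u.appTop (fnS f) * u.appTop (fnS s) := by
      refine global_ext fun B t => ?_
      obtain ⟨φ, hφ⟩ := Spec.map_surjective (t ≫ u)
      rw [evalAt_mul', evalAt_appTop, evalAt_appTop, evalAt_appTop, ← Category.assoc, ← hφ, ← Spec.map_comp]
      refine (evalAt_fnS (φ.hom.comp ((algebraMap C S).comp (algebraMap R C))) r).trans ?_
      refine Eq.trans ?_ (congrArg₂ (· * ·) (evalAt_fnS φ.hom f) (evalAt_fnS φ.hom s)).symm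
      show φ.hom (algebraMap C S (algebraMap R C r)) = φ.hom f * φ.hom s
      rw [← map_mul, hfs]
    rw [this] at hu
    exact isUnit_of_mul_isUnit_left hu
  · intro T u₁ u₂ h
    refine global_ext fun B t => ?_
    obtain ⟨φ₁, hφ₁⟩ := Spec.map_surjective (t ≫ u₁)
    obtain ⟨φ₂, hφ₂⟩ := Spec.map_surjective (t ≫ u₂)
    have hh : CommRingCat.ofHom (algebraMap C S) ≫ φ₁ = CommRingCat.ofHom (algebraMap C S) ≫ φ₂ := by
      apply Spec.map_injective
      rw [Spec.map_comp, Spec.map_comp, hφ₁, hφ₂, Category.assoc, h, Category.assoc]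
    letI : Algebra C B := (φ₁.hom.comp (algebraMap C S)).toAlgebra
    let z₁ : S →ₐ[C] B := { φ₁.hom with commutes' := fun x => rfl }
    let z₂ : S →ₐ[C] B := { φ₂.hom with commutes' := fun x => (congrArg (fun q => q.hom x) hh).symm }
    have k1 := congrArg (fun q => Algebra.TensorProduct.lift z₁ z₂ (fun _ _ => Commute.all _ _) q) hf
    simp only [map_mul, Algebra.TensorProduct.lift_tmul, map_one, mul_one, one_mul] at k1
    have k2 : Algebra.TensorProduct.lift z₁ z₂ (fun _ _ => Commute.all _ _) θ = evalAt t (Θ u₁ u₂ h) := by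
      refine (hθ z₁ z₂).trans ?_
      have h2 := evalAt_appTop (𝟙 _) t (Θ u₁ u₂ h)
      rw [Category.id_comp] at h2
      rw [← h2]
      refine congrArg (evalAt (R := B) (𝟙 (Spec B))) ?_
      refine Eq.trans (Θcongr hφ₁ hφ₂ _ (by rw [Category.assoc, h, Category.assoc])) (nat _ _ _ _ _).symm
    rw [k2] at k1
    rw [evalAt_mul', evalAt_appTop, evalAt_appTop, ← hφ₁, ← hφ₂]
    refine (evalAt_fnS φ₁.hom f).trans (k1.trans ?_)
    refine congrArg (evalAt t (Θ u₁ u₂ h) * ·) (evalAt_fnS φ₂.hom f).symm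
end
end

section
open scoped TensorProduct
noncomputable section
variable {k : Type u} [Field k]
open SchemeOver LinearizationData
variable {G H : GroupSchemeOver k} {ι : GroupHom H G} {X : SchemeOver k} {α : ActionOver G X}
  {L : LineBundle X.carrier} (Λ : LinearizationData (α.res ι) L)

/-- descent of an equivariant local section -/
theorem locA {B Z : Scheme.{u}} {s : B ⟶ Spk k} (v : X.Pt s) (tz : Z ⟶ B) {sz : Z ⟶ Spk k} (hz : tz ≫ s = sz) (gz : G.Pt sz)
    (hc : tz ≫ s = gz.1 ≫ G.str)
    [Flat (pullback.lift tz gz.1 hc)] [Surjective (pullback.lift tz gz.1 hc)] [QuasiCompact (pullback.lift tz gz.1 hc)]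
    (b : L.totOver.Pt sz) (hb : base b = α.ac gz⁻¹ (v.pull tz hz))
    (heq : ∀ {T : Scheme.{u}} {s' : T ⟶ Spk k} (u₁ u₂ : T ⟶ Z) (h₁ : u₁ ≫ sz = s') (h₂ : u₂ ≫ sz = s') (_ : u₁ ≫ tz = u₂ ≫ tz)
      (η : H.Pt s') (_ : gz.pull u₁ h₁ * ι.map η = gz.pull u₂ h₂), Λ.la η (b.pull u₂ h₂) = b.pull u₁ h₁) :
    ∃ w : ∀ {T : Scheme.{u}} {s' : T ⟶ Spk k} (t : T ⟶ B) (_ : G.Pt s') (_ : t ≫ s = s'), L.totOver.Pt s',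
      (∀ {T : Scheme.{u}} {s' : T ⟶ Spk k} (t : T ⟶ B) (g : G.Pt s') (h : t ≫ s = s'), base (w t g h) = α.ac g⁻¹ (v.pull t h)) ∧
      (∀ {T T' : Scheme.{u}} {s' : T ⟶ Spk k} {s'' : T' ⟶ Spk k} (t' : T' ⟶ T) (ht : t' ≫ s' = s'') (t : T ⟶ B) (g : G.Pt s') (h h'),
        (w t g h).pull t' ht = w (t' ≫ t) (g.pull t' ht) h') ∧
      (∀ {T : Scheme.{u}} {s' : T ⟶ Spk k} (t : T ⟶ B) (g : G.Pt s') (η : H.Pt s') (h), Λ.la η (w t (g * ι.map η) h) = w t g h) ∧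
      (∀ {T : Scheme.{u}} {s' : T ⟶ Spk k} (t : T ⟶ B) (g : G.Pt s') (h), ∃ (T' : Scheme.{u}) (c : T' ⟶ T) (u : T' ⟶ Z),
         Surjective c ∧ u ≫ tz = c ≫ t ∧ c ≫ (w t g h).1 = u ≫ b.1) := by
  let z := pullback.lift tz gz.1 hc
  have z1 : z ≫ pullback.fst s G.str = tz := pullback.lift_fst _ _ _
  have z2 : z ≫ pullback.snd s G.str = gz.1 := pullback.lift_snd _ _ _
  obtain ⟨d, hd⟩ := exists_fpqc_desc z b.1 (fun {W} g₁ g₂ hg => by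
    have e1 : g₁ ≫ tz = g₂ ≫ tz := by rw [← z1, ← Category.assoc, hg, Category.assoc]
    have e2 : g₁ ≫ gz.1 = g₂ ≫ gz.1 := by rw [← z2, ← Category.assoc, hg, Category.assoc]
    have e3 : g₂ ≫ sz = g₁ ≫ sz := by rw [← hz, ← Category.assoc, ← e1, Category.assoc]
    have := heq (s' := g₁ ≫ sz) g₁ g₂ rfl e3 e1 1 (by rw [GroupHom.map_one, mul_one]; exact Pt.ext e2)
    rw [Λ.one_la] at this
    exact (congrArg Subtype.val this).symm)
  let sP := pullback.fst s G.str ≫ s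
  let gP : G.Pt sP := G.mkPt (pullback.snd s G.str) pullback.condition.symm
  have hzP : z ≫ sP = sz := by rw [← hz, ← z1, Category.assoc]
  have hgP : gP.pull z hzP = gz := Pt.ext z2
  have hdπ : d ≫ L.π = (α.ac gP⁻¹ (v.pull _ rfl)).1 := by
    refine fpqc_ext z ?_
    rw [← Category.assoc, hd]
    refine (congrArg Subtype.val hb).trans ?_
    have : (α.ac gP⁻¹ (v.pull (pullback.fst s G.str) (rfl : _ = sP))).pull z hzP = α.ac gz⁻¹ (v.pull tz hz) := by
      rw [ActionOver.pull_ac, GroupSchemeOver.pull_inv, hgP, Pt.pull_pull]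
      congr 1
      exact Pt.ext (congrArg (· ≫ v.1) z1)
    exact (congrArg Subtype.val this).symm
  let q : ∀ {T : Scheme.{u}} {s' : T ⟶ Spk k} (t : T ⟶ B) (g : G.Pt s') (_ : t ≫ s = s'), T ⟶ pullback s G.str :=
    fun t g h => pullback.lift t g.1 (h.trans g.2.symm)
  have q1 : ∀ {T : Scheme.{u}} {s' : T ⟶ Spk k} (t : T ⟶ B) (g : G.Pt s') (h : t ≫ s = s'), q t g h ≫ pullback.fst s G.str = t :=
    fun t g h => pullback.lift_fst _ _ _
  have q2 : ∀ {T : Scheme.{u}} {s' : T ⟶ Spk k} (t : T ⟶ B) (g : G.Pt s') (h : t ≫ s = s'), q t g h ≫ pullback.snd s G.str = g.1 :=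
    fun t g h => pullback.lift_snd _ _ _
  have hq : ∀ {T : Scheme.{u}} {s' : T ⟶ Spk k} (t : T ⟶ B) (g : G.Pt s') (h : t ≫ s = s'), q t g h ≫ sP = s' :=
    fun t g h => by rw [← Category.assoc, q1 t g h, h]
  have hdS : d ≫ L.totOver.str = sP := by
    refine (Category.assoc _ _ _).symm.trans ((congrArg (· ≫ X.str) hdπ).trans ?_)
    exact (α.ac gP⁻¹ (v.pull _ rfl)).2
  let dP : L.totOver.Pt sP := L.totOver.mkPt d hdS
  have hdz : dP.pull z hzP = b := Pt.ext hd
  let w : ∀ {T : Scheme.{u}} {s' : T ⟶ Spk k} (t : T ⟶ B) (_ : G.Pt s') (_ : t ≫ s = s'), L.totOver.Pt s' :=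
    fun t g h => dP.pull (q t g h) (hq t g h)
  have qcomp : ∀ {T T' : Scheme.{u}} {s' : T ⟶ Spk k} {s'' : T' ⟶ Spk k} (t' : T' ⟶ T) (ht : t' ≫ s' = s'') (t : T ⟶ B) (g : G.Pt s') (h h'),
      t' ≫ q t g h = q (t' ≫ t) (g.pull t' ht) h' := by
    intro T T' s' s'' t' ht t g h h'
    refine pullback.hom_ext ?_ ?_
    · rw [q1 _ _ h', Category.assoc, q1 t g h]
    · rw [q2 _ _ h', Category.assoc, q2 t g h]; rfl
  have wnat : ∀ {T T' : Scheme.{u}} {s' : T ⟶ Spk k} {s'' : T' ⟶ Spk k} (t' : T' ⟶ T) (ht : t' ≫ s' = s'') (t : T ⟶ B) (g : G.Pt s') (h h'),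
        (w t g h).pull t' ht = w (t' ≫ t) (g.pull t' ht) h' := by
    intro T T' s' s'' t' ht t g h h'
    refine Pt.ext ?_
    exact (Category.assoc _ _ _).symm.trans (congrArg (· ≫ d) (qcomp t' ht t g h h'))
  have wz : ∀ {T : Scheme.{u}} {s' : T ⟶ Spk k} (t : T ⟶ B) (g : G.Pt s') (h) (u : T ⟶ Z) (hu : q t g h = u ≫ z) (hu' : u ≫ sz = s'),
       w t g h = b.pull u hu' := by
    intro T s' t g h u hu hu'
    refine Pt.ext ?_
    show q t g h ≫ d = u ≫ b.1
    rw [hu, Category.assoc, hd]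
  refine ⟨w, ?_, wnat, ?_, ?_⟩
  · intro T s' t g h
    refine (base_pull _ _ _).trans ?_
    have : base dP = α.ac gP⁻¹ (v.pull (pullback.fst s G.str) (rfl : _ = sP)) := Pt.ext hdπ
    rw [this, ActionOver.pull_ac, GroupSchemeOver.pull_inv]
    congr 1
    · congr 1; exact Pt.ext (q2 t g h)
    · exact Pt.ext ((Category.assoc _ _ _).symm.trans (congrArg (· ≫ v.1) (q1 t g h)))
  · intro T s' t g η h
    let c₁ := pullback.fst (q t g h) z
    let c₂ := pullback.fst (c₁ ≫ q t (g * ι.map η) h) z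
    have : Flat (c₂ ≫ c₁) := inferInstance
    have : Surjective (c₂ ≫ c₁) := inferInstance
    refine Pt.ext (fpqc_ext (c₂ ≫ c₁) ?_)
    let s'' := (c₂ ≫ c₁) ≫ s'
    let u₁ : _ ⟶ Z := c₂ ≫ pullback.snd (q t g h) z
    let u₂ : _ ⟶ Z := pullback.snd (c₁ ≫ q t (g * ι.map η) h) z
    have h₁ : (c₂ ≫ c₁) ≫ q t g h = u₁ ≫ z := by rw [Category.assoc, pullback.condition, Category.assoc]
    have h₂ : (c₂ ≫ c₁) ≫ q t (g * ι.map η) h = u₂ ≫ z := by rw [Category.assoc, pullback.condition]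
    have hs : (c₂ ≫ c₁) ≫ t ≫ s = s'' := by rw [h]
    have hs' : ((c₂ ≫ c₁) ≫ t) ≫ s = s'' := by rw [Category.assoc, h]
    have k₁ : u₁ ≫ sz = s'' := by rw [← hzP, ← Category.assoc, ← h₁, Category.assoc, hq t g h]
    have k₂ : u₂ ≫ sz = s'' := by rw [← hzP, ← Category.assoc, ← h₂, Category.assoc, hq t _ h]
    have e1 : (w t g h).pull (c₂ ≫ c₁) rfl = b.pull u₁ k₁ := by
      rw [wnat (c₂ ≫ c₁) rfl t g h hs', wz _ _ hs' u₁ ((qcomp (c₂ ≫ c₁) rfl t g h hs').symm.trans h₁) k₁]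
    have e2 : (w t (g * ι.map η) h).pull (c₂ ≫ c₁) rfl = b.pull u₂ k₂ := by
      rw [wnat (c₂ ≫ c₁) rfl t (g * ι.map η) h hs', wz _ _ hs' u₂ ((qcomp (c₂ ≫ c₁) rfl t (g * ι.map η) h hs').symm.trans h₂) k₂]
    have e3 : (Λ.la η (w t (g * ι.map η) h)).pull (c₂ ≫ c₁) rfl = (w t g h).pull (c₂ ≫ c₁) rfl := by
      rw [pull_la, e1, e2]
      have gg₁ : gz.pull u₁ k₁ = g.pull (c₂ ≫ c₁) rfl := Pt.ext (by
        show u₁ ≫ gz.1 = (c₂ ≫ c₁) ≫ g.1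
        rw [← q2 t g h, ← z2, ← Category.assoc, ← h₁, Category.assoc])
      have gg₂ : gz.pull u₂ k₂ = (g * ι.map η).pull (c₂ ≫ c₁) rfl := Pt.ext (by
        show u₂ ≫ gz.1 = (c₂ ≫ c₁) ≫ (g * ι.map η).1
        rw [← q2 t (g * ι.map η) h, ← z2, ← Category.assoc, ← h₂, Category.assoc])
      refine heq u₁ u₂ k₁ k₂ ?_ _ ?_
      · rw [← z1, ← Category.assoc, ← h₁, ← Category.assoc, ← h₂, Category.assoc, Category.assoc _ (q t (g * ι.map η) h), q1 t g h, q1 t _ h]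
      · rw [gg₁, gg₂, GroupSchemeOver.pull_mul, GroupHom.pull_map]
    exact congrArg Subtype.val e3
  · intro T s' t g h
    refine ⟨_, pullback.fst (q t g h) z, pullback.snd (q t g h) z, inferInstance, ?_, ?_⟩
    · rw [← z1, ← Category.assoc, ← pullback.condition, Category.assoc, q1 t g h]
    · show _ ≫ q t g h ≫ d = _
      rw [← Category.assoc, pullback.condition, Category.assoc, hd]
end
end

section
open scoped TensorProduct
noncomputable section
variable {k : Type u} [Field k]
open SchemeOver LinearizationData
variable {G H : GroupSchemeOver k} {ι : GroupHom H G} {X : SchemeOver k} {α : ActionOver G X}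
  {L : LineBundle X.carrier} (Λ : LinearizationData (α.res ι) L)

theorem geo1 (D : QData G H ι) (R : Type u) [CommRing R] [Algebra k R] :
    ∃ πB : pullback (strOf k R) G.str ⟶ Spec (.of (R ⊗[k] D.A)), Flat πB ∧ Surjective πB ∧
      πB ≫ Spec.map (CommRingCat.ofHom (algebraMap R (R ⊗[k] D.A))) = pullback.fst _ _ ∧
      πB ≫ Spec.map (CommRingCat.ofHom ((Algebra.TensorProduct.includeRight : D.A →ₐ[k] R ⊗[k] D.A) : D.A →+* R ⊗[k] D.A)) =
        pullback.snd _ _ ≫ D.p := by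
  let m : pullback (strOf k R) G.str ⟶ prodE D.A (strOf k R) := prodE.lift (pullback.fst _ _) (pullback.snd _ _ ≫ D.p) (by
    rw [D.str_of_p]; exact pullback.condition)
  have m1 : m ≫ pullback.fst _ _ = pullback.fst _ _ := pullback.lift_fst _ _ _
  have m2 : m ≫ pullback.snd _ _ = pullback.snd _ _ ≫ D.p := pullback.lift_snd _ _ _
  have hp : IsPullback (pullback.snd (strOf k R) G.str) m D.p (pullback.snd (strOf k R) (strOf k D.A)) := by
    refine IsPullback.of_bot (v₂₁ := pullback.fst (strOf k R) (strOf k D.A)) (v₂₂ := strOf k D.A) (h₃₁ := strOf k R) ?_ m2.symm ?_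
    · rw [m1]
      have : D.p ≫ strOf k D.A = G.str := D.p_str
      rw [this]
      exact (IsPullback.of_hasPullback _ _).flip
    · exact (IsPullback.of_hasPullback _ _).flip
  have f1 : Flat m := MorphismProperty.of_isPullback hp D.flat
  have f2 : Surjective m := MorphismProperty.of_isPullback hp D.surj
  refine ⟨m ≫ (pullbackSpecIso k R D.A).hom, inferInstance, inferInstance, ?_, ?_⟩
  · rw [Category.assoc]
    exact (congrArg (m ≫ ·) (pullbackSpecIso_hom_fst' k R D.A)).trans m1
  · rw [Category.assoc]
    exact (congrArg (m ≫ ·) (pullbackSpecIso_hom_snd k R D.A)).trans m2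

theorem geo3 {R A : Type u} [CommRing R] [Algebra k R] [CommRing A] [Algebra k A] {T : Scheme.{u}} {u₁ u₂ : T ⟶ Spec (.of (R ⊗[k] A))}
    (h1 : u₁ ≫ Spec.map (CommRingCat.ofHom (algebraMap R (R ⊗[k] A))) = u₂ ≫ Spec.map (CommRingCat.ofHom (algebraMap R (R ⊗[k] A))))
    (h2 : u₁ ≫ Spec.map (CommRingCat.ofHom ((Algebra.TensorProduct.includeRight : A →ₐ[k] R ⊗[k] A) : A →+* R ⊗[k] A)) =
      u₂ ≫ Spec.map (CommRingCat.ofHom ((Algebra.TensorProduct.includeRight : A →ₐ[k] R ⊗[k] A) : A →+* R ⊗[k] A))) : u₁ = u₂ := by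
  rw [← cancel_mono (pullbackSpecIso k R A).inv]
  refine pullback.hom_ext ?_ ?_
  · rw [Category.assoc, Category.assoc, pullbackSpecIso_inv_fst', h1]
  · rw [Category.assoc, Category.assoc, pullbackSpecIso_inv_snd]; exact h2

theorem geo2 (hG : G.IsAlgebraic) (R : Type u) [CommRing R] [Algebra k R] [Algebra.FiniteType k R] :
    CompactSpace ↥(pullback (strOf k R) G.str) ∧ QuasiSeparatedSpace ↥(pullback (strOf k R) G.str) := by
  have h1 : LocallyOfFiniteType G.str := hG.1
  have h2 : QuasiCompact G.str := hG.2
  have : QuasiCompact (pullback.fst (strOf k R) G.str) := inferInstance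
  have : LocallyOfFiniteType (pullback.fst (strOf k R) G.str) := inferInstance
  refine ⟨?_, ?_⟩
  · exact QuasiCompact.compactSpace_of_compactSpace (pullback.fst (strOf k R) G.str)
  · have : IsNoetherianRing R := Algebra.FiniteType.isNoetherianRing k R
    have : IsLocallyNoetherian (Spec (.of R)) := inferInstance
    have := LocallyOfFiniteType.isLocallyNoetherian (pullback.fst (strOf k R) G.str)
    infer_instance

theorem GroupHom.map_inj [Mono ι.hom] {T : Scheme.{u}} {s : T ⟶ Spk k} {η η' : H.Pt s} (h : ι.map η = ι.map η') : η = η' :=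
  Pt.ext ((cancel_mono ι.hom).1 (congrArg Subtype.val h))

theorem loc_exists [Mono ι.hom] (D : QData G H ι) (hG : G.IsAlgebraic) {R : Type u} [CommRing R] [Algebra k R] [Algebra.FiniteType k R]
    (v : X.Pt (strOf k R)) (p : Ideal R) [p.IsPrime] :
    ∃ r : R, r ∉ p ∧ ∀ {T : Scheme.{u}} (t : T ⟶ Spec (.of R)), IsUnit (t.appTop (fnS r)) → ∃ w : EqFr Λ T, w.x = t ≫ v.1 := by
  obtain ⟨i1, i2⟩ := geo2 hG R
  obtain ⟨πB, j1, j2, j3, j4⟩ := geo1 D R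
  let sP := pullback.fst (strOf k R) G.str ≫ strOf k R
  let gP : G.Pt sP := G.mkPt (pullback.snd (strOf k R) G.str) pullback.condition.symm
  obtain ⟨S, z, a, hf, hsj, ha, hgen⟩ := exists_affine_cover_gen L (α.ac gP⁻¹ (v.pull (pullback.fst (strOf k R) G.str) (rfl : _ = sP))).1
  have hqc : QuasiCompact z := inferInstance
  obtain ⟨c, hc⟩ := Spec.map_surjective (R := CommRingCat.of (R ⊗[k] D.A)) (S := S) (z ≫ πB)
  letI : Algebra (R ⊗[k] D.A) S := c.hom.toAlgebra
  have hc' : Spec.map (CommRingCat.ofHom (algebraMap (R ⊗[k] D.A) S)) = z ≫ πB := hc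
  have ff : Module.FaithfullyFlat (R ⊗[k] D.A) S := by
    refine (flat_and_surjective_SpecMap_iff c).1 ?_
    rw [hc]; exact ⟨inferInstance, inferInstance⟩
  let tz : Spec S ⟶ Spec (.of R) := z ≫ pullback.fst _ _
  let sz : Spec S ⟶ Spk k := z ≫ sP
  have hz : tz ≫ strOf k R = sz := Category.assoc _ _ _
  let gz : G.Pt sz := gP.pull z rfl
  have hcz : tz ≫ strOf k R = gz.1 ≫ G.str := hz.trans gz.2.symm
  have ez : pullback.lift tz gz.1 hcz = z := pullback.hom_ext (pullback.lift_fst _ _ _) (pullback.lift_snd _ _ _)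
  have hp1 : ∀ {T : Scheme.{u}} {u₁ u₂ : T ⟶ Spec S} (_ : u₁ ≫ z ≫ πB = u₂ ≫ z ≫ πB), u₁ ≫ tz = u₂ ≫ tz := by
    intro T u₁ u₂ h
    have := congrArg (· ≫ Spec.map (CommRingCat.ofHom (algebraMap R (R ⊗[k] D.A)))) h
    simpa only [Category.assoc, j3] using this
  have hp2 : ∀ {T : Scheme.{u}} {u₁ u₂ : T ⟶ Spec S} (_ : u₁ ≫ z ≫ πB = u₂ ≫ z ≫ πB), (u₁ ≫ gz.1) ≫ D.p = (u₂ ≫ gz.1) ≫ D.p := by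
    intro T u₁ u₂ h
    have := congrArg (· ≫ Spec.map (CommRingCat.ofHom ((Algebra.TensorProduct.includeRight : D.A →ₐ[k] R ⊗[k] D.A) : D.A →+* R ⊗[k] D.A))) h
    simp only [Category.assoc, j4] at this
    exact (Category.assoc _ _ _).trans ((congrArg (u₁ ≫ ·) (Category.assoc _ _ _)).trans (this.trans
      ((congrArg (u₂ ≫ ·) (Category.assoc _ _ _)).symm.trans (Category.assoc _ _ _).symm)))
  have haS : a ≫ L.totOver.str = sz := by
    refine (Category.assoc _ _ _).symm.trans ((congrArg (· ≫ X.str) ha).trans ((Category.assoc _ _ _).trans ?_))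
    exact congrArg (z ≫ ·) (α.ac gP⁻¹ (v.pull (pullback.fst (strOf k R) G.str) (rfl : _ = sP))).2
  let aP : L.totOver.Pt sz := L.totOver.mkPt a haS
  have ba : base aP = α.ac gz⁻¹ (v.pull tz hz) := by
    have : base aP = (α.ac gP⁻¹ (v.pull (pullback.fst (strOf k R) G.str) (rfl : _ = sP))).pull z rfl := Pt.ext ha
    rw [this, ActionOver.pull_ac, GroupSchemeOver.pull_inv, Pt.pull_pull]
  have hbase : ∀ {T : Scheme.{u}} {s' : T ⟶ Spk k} (u₁ u₂ : T ⟶ Spec S) (h₁ : u₁ ≫ sz = s') (h₂ : u₂ ≫ sz = s') (_ : u₁ ≫ tz = u₂ ≫ tz)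
      (η : H.Pt s') (_ : gz.pull u₁ h₁ * ι.map η = gz.pull u₂ h₂), base (Λ.la η (aP.pull u₂ h₂)) = base (aP.pull u₁ h₁) := by
    intro T s' u₁ u₂ h₁ h₂ ht η he
    rw [base_la, base_pull, base_pull, ba, ActionOver.pull_ac, ActionOver.pull_ac, GroupSchemeOver.pull_inv, GroupSchemeOver.pull_inv, ← he,
      mul_inv_rev, ActionOver.mul_ac, ActionOver.res_ac, ← ActionOver.mul_ac, mul_inv_cancel, ActionOver.one_ac]
    congr 1
    rw [Pt.pull_pull, Pt.pull_pull]
    exact Pt.ext (congrArg (· ≫ v.1) ht.symm)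
  have hex : ∀ {T : Scheme.{u}} {s' : T ⟶ Spk k} (u₁ u₂ : T ⟶ Spec S) (h₁ : u₁ ≫ sz = s') (h₂ : u₂ ≫ sz = s') (_ : u₁ ≫ z ≫ πB = u₂ ≫ z ≫ πB),
      ∃ η : H.Pt s', gz.pull u₁ h₁ * ι.map η = gz.pull u₂ h₂ :=
    fun u₁ u₂ h₁ h₂ h => (D.coset _ _).1 (hp2 h)
  have hgu : ∀ {T : Scheme.{u}} {s' : T ⟶ Spk k} (u : T ⟶ Spec S) (h : u ≫ sz = s'), L.IsGen (aP.pull u h).1 :=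
    fun u h => hgen.pull u
  have hs2 : ∀ {T : Scheme.{u}} {u₁ u₂ : T ⟶ Spec S} (_ : u₁ ≫ z ≫ πB = u₂ ≫ z ≫ πB), u₂ ≫ sz = u₁ ≫ sz := by
    intro T u₁ u₂ h
    rw [← hz, ← Category.assoc, ← hp1 h, Category.assoc]
  have hΘex : ∀ {T : Scheme.{u}} (u₁ u₂ : T ⟶ Spec S) (_ : u₁ ≫ z ≫ πB = u₂ ≫ z ≫ πB), ∃ f : Γ(T, ⊤),
      ∀ {s' : T ⟶ Spk k} (h₁ : u₁ ≫ sz = s') (h₂ : u₂ ≫ sz = s') (η : H.Pt s') (_ : gz.pull u₁ h₁ * ι.map η = gz.pull u₂ h₂),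
        Λ.la η (aP.pull u₂ h₂) = sm f (aP.pull u₁ h₁) := by
    intro T u₁ u₂ h
    obtain ⟨η, hη⟩ := hex u₁ u₂ rfl (hs2 h) h
    obtain ⟨f, hf⟩ := (hgu u₁ rfl).exists_smul (congrArg Subtype.val (hbase u₁ u₂ rfl (hs2 h) (hp1 h) η hη))
    refine ⟨f, fun {s'} h₁ h₂ η' hη' => ?_⟩
    subst h₁
    have : η' = η := GroupHom.map_inj (mul_left_cancel (G := G.Pt (u₁ ≫ sz)) (hη'.trans hη.symm))
    rw [this]
    exact Pt.ext hf.symm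
  let Θ : ∀ {T : Scheme.{u}} (u₁ u₂ : T ⟶ Spec S) (_ : u₁ ≫ Spec.map (CommRingCat.ofHom (algebraMap (R ⊗[k] D.A) S)) = u₂ ≫ Spec.map (CommRingCat.ofHom (algebraMap (R ⊗[k] D.A) S))), Γ(T, ⊤) :=
    fun u₁ u₂ h => (hΘex u₁ u₂ (by rw [hc'] at h; exact h)).choose
  have hΘ : ∀ {T : Scheme.{u}} (u₁ u₂ : T ⟶ Spec S) (h) {s' : T ⟶ Spk k} (h₁ : u₁ ≫ sz = s') (h₂ : u₂ ≫ sz = s') (η : H.Pt s') (_ : gz.pull u₁ h₁ * ι.map η = gz.pull u₂ h₂),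
        Λ.la η (aP.pull u₂ h₂) = sm (Θ u₁ u₂ h) (aP.pull u₁ h₁) :=
    fun u₁ u₂ h => (hΘex u₁ u₂ (by rw [hc'] at h; exact h)).choose_spec
  have hcc : ∀ {T : Scheme.{u}} {u₁ u₂ : T ⟶ Spec S} (_ : u₁ ≫ Spec.map (CommRingCat.ofHom (algebraMap (R ⊗[k] D.A) S)) = u₂ ≫ Spec.map (CommRingCat.ofHom (algebraMap (R ⊗[k] D.A) S))),
     u₁ ≫ z ≫ πB = u₂ ≫ z ≫ πB := by
    intro T u₁ u₂ h; rw [hc'] at h; exact h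
  have hinj : ∀ {T : Scheme.{u}} {s' : T ⟶ Spk k} (u : T ⟶ Spec S) (h : u ≫ sz = s') {f f' : Γ(T, ⊤)} (_ : sm f (aP.pull u h) = sm f' (aP.pull u h)), f = f' :=
    fun {T s'} u h {f f'} he => (hgu u h).smul_inj (congrArg Subtype.val he)
  have hnat : ∀ {T T' : Scheme.{u}} (t : T' ⟶ T) (u₁ u₂ : T ⟶ Spec S) (h h'), t.appTop (Θ u₁ u₂ h) = Θ (t ≫ u₁) (t ≫ u₂) h' := by
    intro T T' t u₁ u₂ h h'
    obtain ⟨η, hη⟩ := hex u₁ u₂ rfl (hs2 (hcc h)) (hcc h)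
    have k1 : (t ≫ u₁) ≫ sz = t ≫ u₁ ≫ sz := Category.assoc _ _ _
    have k2 : (t ≫ u₂) ≫ sz = t ≫ u₁ ≫ sz := by rw [Category.assoc, hs2 (hcc h)]
    refine hinj (t ≫ u₁) k1 ?_
    rw [← hΘ _ _ h' k1 k2 (η.pull t rfl) (by
      rw [← Pt.pull_pull u₁ rfl t rfl, ← Pt.pull_pull u₂ (hs2 (hcc h)) t rfl, ← hη, GroupSchemeOver.pull_mul, GroupHom.pull_map]),
      ← Pt.pull_pull u₂ (hs2 (hcc h)) t rfl, ← pull_la, hΘ u₁ u₂ h rfl (hs2 (hcc h)) η hη, pull_sm, Pt.pull_pull]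
  have hself : ∀ {T : Scheme.{u}} (u : T ⟶ Spec S) (h), Θ u u h = 1 := by
    intro T u h
    refine hinj u rfl ?_
    rw [← hΘ u u h rfl rfl 1 (by rw [GroupHom.map_one, mul_one]), Λ.one_la]
    exact Pt.ext (L.one_smul _).symm
  have hmul : ∀ {T : Scheme.{u}} (u₁ u₂ u₃ : T ⟶ Spec S) (h h' h''), Θ u₁ u₂ h * Θ u₂ u₃ h' = Θ u₁ u₃ h'' := by
    intro T u₁ u₂ u₃ h h' h''
    obtain ⟨η, hη⟩ := hex u₁ u₂ rfl (hs2 (hcc h)) (hcc h)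
    obtain ⟨η', hη'⟩ := hex u₂ u₃ (hs2 (hcc h)) (hs2 (hcc h'')) (hcc h')
    refine hinj u₁ rfl ?_
    rw [← hΘ u₁ u₃ h'' rfl (hs2 (hcc h'')) (η * η') (by rw [GroupHom.map_mul, ← mul_assoc, hη, hη']), Λ.mul_la,
      hΘ u₂ u₃ h' (hs2 (hcc h)) (hs2 (hcc h'')) η' hη', la_sm, hΘ u₁ u₂ h rfl (hs2 (hcc h)) η hη, sm_sm, mul_comm]
  obtain ⟨f, r, hr, hfu, hfe⟩ := cocycle_triv (R := R) (C := R ⊗[k] D.A) (S := S) Θ hnat hself hmul p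
  have hfl : Flat (pullback.lift tz gz.1 hcz) := by rw [ez]; exact hf
  have hsl : Surjective (pullback.lift tz gz.1 hcz) := by rw [ez]; exact hsj
  have hql : QuasiCompact (pullback.lift tz gz.1 hcz) := by rw [ez]; exact hqc
  obtain ⟨w, w1, w2, w3, w4⟩ := locA Λ v tz hz gz hcz (sm f aP) ((base_sm _ _).trans ba) (by
    intro T s' u₁ u₂ h₁ h₂ ht η hη
    have hh : u₁ ≫ Spec.map (CommRingCat.ofHom (algebraMap (R ⊗[k] D.A) S)) = u₂ ≫ Spec.map (CommRingCat.ofHom (algebraMap (R ⊗[k] D.A) S)) := by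
      rw [hc']
      refine geo3 ?_ ?_
      · simpa only [Category.assoc, j3] using ht
      · simp only [Category.assoc, j4]
        have := (D.coset _ _).2 ⟨η, hη⟩
        exact ((congrArg (u₁ ≫ ·) (Category.assoc _ _ _).symm).trans (Category.assoc _ _ _).symm).trans (this.trans
          ((Category.assoc _ _ _).trans (congrArg (u₂ ≫ ·) (Category.assoc _ _ _))))
    rw [pull_sm, pull_sm, la_sm, hΘ u₁ u₂ hh h₁ h₂ η hη, sm_sm, mul_comm]
    exact congrArg (fun q => sm q _) (hfe u₁ u₂ hh).symm)
  refine ⟨r, hr, fun {T} t ht => ?_⟩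
  refine ⟨⟨t ≫ v.1, fun {T' s'} t' g h => w (t' ≫ t) g (by rw [← h, Category.assoc, Category.assoc, Category.assoc, v.2]), ?_, ?_, ?_, ?_⟩, rfl⟩
  · intro T' s' t' g h
    rw [w1]
    congr 1
  · intro T' s' t' g h
    obtain ⟨T'', c, u, hc1, hc2, hc3⟩ := w4 (t' ≫ t) g (by rw [← h, Category.assoc, Category.assoc, Category.assoc, v.2])
    refine isGen_of_surjective L c _ ?_
    have hcv := congrArg (L.IsGen) hc3
    refine hcv.mpr ?_
    have e1 : u ≫ (sm f aP).1 = L.smul (u.appTop f) (u ≫ a) := L.smul_natural _ _ _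
    rw [e1]
    refine (hgen.pull u).smul_unit (hfu u ?_)
    have e2 : u ≫ Spec.map (CommRingCat.ofHom (algebraMap (R ⊗[k] D.A) S)) ≫ Spec.map (CommRingCat.ofHom (algebraMap R (R ⊗[k] D.A))) = (c ≫ t') ≫ t := by
      rw [hc', Category.assoc, j3, hc2, Category.assoc]
    rw [e2, Scheme.Hom.comp_appTop]
    exact ht.map ((c ≫ t').appTop).hom
  · intro T' T'' s' s'' t'' ht'' t' g h h'
    rw [w2 t'' ht'' _ _ _ (by rw [← h']; simp only [Category.assoc, v.2])]
    congr 1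
  · intro T' s' t' g η h
    exact w3 _ _ _ _
end
end

section
open scoped TensorProduct
noncomputable section
variable {k : Type u} [Field k]
open SchemeOver LinearizationData
variable {G H : GroupSchemeOver k} {ι : GroupHom H G} {X : SchemeOver k} {α : ActionOver G X}
  {L : LineBundle X.carrier} (Λ : LinearizationData (α.res ι) L)

theorem fnS_basicOpen {S : Type u} [CommRing S] (f : S) : (Spec (.of S)).basicOpen (fnS f) = PrimeSpectrum.basicOpen f := by
  rw [basicOpen_eq_of_affine']
  congr 1
  simp [fnS]

theorem frSys_loc [Mono ι.hom] (D : QData G H ι) (hG : G.IsAlgebraic) (hX : LocallyOfFiniteType X.str) (x : X.carrier) :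
    ∃ (U : X.carrier.Opens) (w : EqFr Λ U.toScheme), x ∈ U ∧ w.x = U.ι := by
  obtain ⟨V, hV, hx, -⟩ := exists_isAffineOpen_mem_and_subset (X := X.carrier) (x := x) (U := ⊤) trivial
  let a : Spec (.of Γ(X.carrier, V)) ⟶ Spk k := hV.fromSpec ≫ X.str
  letI : Algebra k Γ(X.carrier, V) := algOf a
  have ha : strOf k Γ(X.carrier, V) = a := strOf_algOf a
  have hft : LocallyOfFiniteType (strOf k Γ(X.carrier, V)) := by
    rw [ha]; infer_instance
  haveI : Algebra.FiniteType k Γ(X.carrier, V) := by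
    have := (HasRingHomProperty.Spec_iff (P := @LocallyOfFiniteType)).1 hft
    exact this
  obtain ⟨r, hr, h⟩ := loc_exists Λ D hG (X.mkPt (s := strOf k Γ(X.carrier, V)) hV.fromSpec ha.symm) (hV.primeIdealOf ⟨x, hx⟩).asIdeal
  have hxr : x ∈ X.carrier.basicOpen r := by
    have e : hV.fromSpec (hV.primeIdealOf ⟨x, hx⟩) = x := hV.fromSpec_primeIdealOf ⟨x, hx⟩
    have h2 : hV.primeIdealOf ⟨x, hx⟩ ∈ hV.fromSpec ⁻¹ᵁ X.carrier.basicOpen r := by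
      rw [hV.fromSpec_preimage_basicOpen]
      exact hr
    exact e ▸ (show hV.fromSpec (hV.primeIdealOf ⟨x, hx⟩) ∈ X.carrier.basicOpen r from h2)
  let U := X.carrier.basicOpen r
  have hUV : U ≤ V := X.carrier.basicOpen_le r
  have hrg : Set.range U.ι ⊆ Set.range hV.fromSpec := by
    rw [hV.range_fromSpec, Scheme.Opens.range_ι]
    exact hUV
  let t : U.toScheme ⟶ Spec (.of Γ(X.carrier, V)) := IsOpenImmersion.lift hV.fromSpec U.ι hrg
  have ht : t ≫ hV.fromSpec = U.ι := IsOpenImmersion.lift_fac _ _ _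
  have hu : IsUnit (t.appTop (fnS r)) := by
    refine U.toScheme.toLocallyRingedSpace.toRingedSpace.isUnit_of_isUnit_germ ⊤ _ fun y hy => ?_
    refine (U.toScheme.mem_basicOpen_top _ y).1 ?_
    rw [← Scheme.preimage_basicOpen_top, fnS_basicOpen, ← hV.fromSpec_preimage_basicOpen]
    change hV.fromSpec (t y) ∈ X.carrier.basicOpen r
    rw [← Scheme.Hom.comp_apply, ht]
    exact y.2
  obtain ⟨w, hw⟩ := h t hu
  exact ⟨U, w, hxr, hw.trans ht⟩

@[reducible] def frSys [Mono ι.hom] (D : QData G H ι) (hG : G.IsAlgebraic) (hX : LocallyOfFiniteType X.str) (c0 : ℕ) : FrameSys X.carrier where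
  Fr := EqFr Λ
  pt w := w.x
  pull t w := w.pull t
  pt_pull t w := rfl
  pull_comp s t w := EqFr.pull_pull s t w
  pull_id w := EqFr.pull_id w
  c w w' := EqFr.cc D c0 w w'
  c_nat t w w' h := EqFr.cc_nat c0 t w w' h.symm
  c_self w := EqFr.cc_self c0 w
  c_mul w w' w'' h h' := EqFr.cc_mul c0 w w' w'' h h'
  loc x := frSys_loc Λ D hG hX x
end
end

section
open scoped TensorProduct
noncomputable section
variable {k : Type u} [Field k]
open SchemeOver LinearizationData
variable {G H : GroupSchemeOver k} {ι : GroupHom H G} {X : SchemeOver k} {α : ActionOver G X}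
  {L : LineBundle X.carrier} {Λ : LinearizationData (α.res ι) L}

theorem tau_inv_x {T T' : Scheme.{u}} {s : T ⟶ Spk k} (g : G.Pt s) (x : X.Pt s) (t : T' ⟶ T) (w : EqFr Λ T')
    (h : w.x = t ≫ (α.ac g x).1) (hs : w.x ≫ X.str = t ≫ s) :
    (w.tau (g.pull t rfl : G.Pt (t ≫ s))⁻¹ hs).x = t ≫ x.1 := by
  rw [EqFr.tau_x]
  have e : X.mkPt w.x hs = α.ac (g.pull t rfl : G.Pt (t ≫ s)) (x.pull t rfl) :=
    Pt.ext (h.trans (congrArg Subtype.val (α.pull_ac t rfl g x)))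
  rw [e, ← ActionOver.mul_ac, inv_mul_cancel, ActionOver.one_ac]
  rfl

theorem tau_congr {T : Scheme.{u}} {s s' : T ⟶ Spk k} (e : s = s') {g : G.Pt s} {g' : G.Pt s'} (hg : g.1 = g'.1) {w w' : EqFr Λ T} (hw : w = w') (hs hs') :
    w.tau g hs = w'.tau g' hs' := by
  subst e hw
  rw [Pt.ext hg]

variable [Mono ι.hom] {D : QData G H ι} {hG : G.IsAlgebraic} {hX : LocallyOfFiniteType X.str} {c0 : ℕ}

/-- action on points of the norm bundle -/
def actPt {T : Scheme.{u}} {s : T ⟶ Spk k} (g : G.Pt s) (b : (frSys Λ D hG hX c0).HPt T) (hs : b.x ≫ X.str = s) :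
    (frSys Λ D hG hX c0).HPt T where
  x := (α.ac g (X.mkPt b.x hs)).1
  val {T'} t w h :=
    have hs' : w.x ≫ X.str = t ≫ s := by
      rw [show w.x = _ from h, Category.assoc]; exact congrArg (t ≫ ·) (α.ac g (X.mkPt b.x hs)).2
    b.val t (w.tau (g.pull t rfl : G.Pt (t ≫ s))⁻¹ hs') (tau_inv_x g (X.mkPt b.x hs) t w h hs')
  nat {T' T''} s₁ t w h h' := by
    have hs' : w.x ≫ X.str = t ≫ s := by
      rw [show w.x = _ from h, Category.assoc]; exact congrArg (t ≫ ·) (α.ac g (X.mkPt b.x hs)).2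
    have hs1 : (w.pull s₁).x ≫ X.str = s₁ ≫ t ≫ s := (Category.assoc _ _ _).trans (congrArg (s₁ ≫ ·) hs')
    have e := EqFr.pull_tau s₁ rfl (g.pull t rfl : G.Pt (t ≫ s))⁻¹ w hs' hs1
    have e2 := tau_inv_x g (X.mkPt b.x hs) t w h hs'
    have e3 : ((w.tau (g.pull t rfl : G.Pt (t ≫ s))⁻¹ hs').pull s₁).x = (s₁ ≫ t) ≫ b.x :=
      (congrArg (s₁ ≫ ·) e2).trans (Category.assoc _ _ _).symm
    refine Eq.trans ?_ (b.nat s₁ t (w.tau (g.pull t rfl : G.Pt (t ≫ s))⁻¹ hs') e2 e3)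
    refine b.val_congr rfl ?_ _ _
    refine Eq.trans ?_ e.symm
    refine tau_congr (Category.assoc _ _ _) ?_ rfl _ _
    rw [GroupSchemeOver.pull_inv, GroupSchemeOver.inv_val, GroupSchemeOver.inv_val, Pt.pull_pull]
    rfl
  homog {T'} t w w' h h' := by
    have hs' : w.x ≫ X.str = t ≫ s := by
      rw [show w.x = _ from h, Category.assoc]; exact congrArg (t ≫ ·) (α.ac g (X.mkPt b.x hs)).2
    have hs'' : w'.x ≫ X.str = t ≫ s := by
      rw [show w'.x = _ from h', Category.assoc]; exact congrArg (t ≫ ·) (α.ac g (X.mkPt b.x hs)).2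
    refine (b.homog t _ (w'.tau (g.pull t rfl : G.Pt (t ≫ s))⁻¹ hs'') _ (tau_inv_x g (X.mkPt b.x hs) t w' h' hs'')).trans ?_
    congr 1
    exact EqFr.cc_tau c0 _ w w' (h'.trans h.symm) hs' hs''

theorem actPt_val {T : Scheme.{u}} {s : T ⟶ Spk k} (g : G.Pt s) (b : (frSys Λ D hG hX c0).HPt T) (hs : b.x ≫ X.str = s)
    {T' : Scheme.{u}} (t : T' ⟶ T) (w : EqFr Λ T') (h) (hs') (h') :
    (actPt g b hs).val t w h = b.val t (w.tau (g.pull t rfl : G.Pt (t ≫ s))⁻¹ hs') h' := rfl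

theorem actPt_congr {T : Scheme.{u}} {s s' : T ⟶ Spk k} (e : s = s') {g : G.Pt s} {g' : G.Pt s'} (hg : g.1 = g'.1) {b b' : (frSys Λ D hG hX c0).HPt T}
   (hb : b = b') (hs hs') : actPt g b hs = actPt g' b' hs' := by
  subst e hb
  rw [Pt.ext hg]

theorem pull_actPt {T T' : Scheme.{u}} {s : T ⟶ Spk k} {s' : T' ⟶ Spk k} (f : T' ⟶ T) (hf : f ≫ s = s') (g : G.Pt s) (b : (frSys Λ D hG hX c0).HPt T) (hs : b.x ≫ X.str = s) (hs') :
    (actPt g b hs).pull f = actPt (g.pull f hf : G.Pt s') (b.pull f) hs' := by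
  subst hf
  refine FrameSys.HPt.ext' (congrArg Subtype.val (α.pull_ac f rfl g (X.mkPt b.x hs))) fun {T''} t w h h' => ?_
  refine b.val_congr rfl ?_ _ _
  refine tau_congr (Category.assoc _ _ _) ?_ rfl _ _
  rw [GroupSchemeOver.inv_val, GroupSchemeOver.inv_val, Pt.pull_pull]
  rfl

theorem mul_actPt {T : Scheme.{u}} {s : T ⟶ Spk k} (g g' : G.Pt s) (b : (frSys Λ D hG hX c0).HPt T) (hs : b.x ≫ X.str = s) (hs') :
    actPt (g * g') b hs = actPt g (actPt g' b hs) hs' := by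
  refine FrameSys.HPt.ext' (congrArg Subtype.val (α.mul_ac g g' (X.mkPt b.x hs))) fun {T''} t w h h' => ?_
  refine b.val_congr rfl ?_ _ _
  refine Eq.trans ?_ (EqFr.tau_mul _ _ _ _ _).symm
  rw [GroupSchemeOver.pull_mul, mul_inv_rev]

theorem one_actPt {T : Scheme.{u}} {s : T ⟶ Spk k} (b : (frSys Λ D hG hX c0).HPt T) (hs : b.x ≫ X.str = s) :
    actPt 1 b hs = b := by
  refine FrameSys.HPt.ext' (congrArg Subtype.val (α.one_ac (X.mkPt b.x hs))) fun {T''} t w h h' => ?_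
  refine b.val_congr rfl ?_ _ _
  rw [GroupSchemeOver.pull_one, inv_one, EqFr.tau_one]

open FrameSys

variable (Λ D hG hX c0) in
theorem lactD_aux {T : Scheme.{u}} (g : T ⟶ G.carrier) (e : T ⟶ (frSys Λ D hG hX c0).tot)
    (h : g ≫ G.str = (e ≫ (frSys Λ D hG hX c0).proj) ≫ X.str) : ((frSys Λ D hG hX c0).pts T e).x ≫ X.str = g ≫ G.str := by
  rw [h]; exact congrArg (· ≫ X.str) ((frSys Λ D hG hX c0).comp_proj e).symm

variable (Λ D hG hX c0) in
def lactD {T : Scheme.{u}} (g : T ⟶ G.carrier) (e : T ⟶ (frSys Λ D hG hX c0).tot)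
    (h : g ≫ G.str = (e ≫ (frSys Λ D hG hX c0).proj) ≫ X.str) : T ⟶ (frSys Λ D hG hX c0).tot :=
  ((frSys Λ D hG hX c0).pts T).symm (actPt (s := g ≫ G.str) (G.mkPt g rfl) ((frSys Λ D hG hX c0).pts T e) (lactD_aux Λ D hG hX c0 g e h))

theorem pts_lactD {T : Scheme.{u}} (g : T ⟶ G.carrier) (e : T ⟶ (frSys Λ D hG hX c0).tot) (h) :
    (frSys Λ D hG hX c0).pts T (lactD Λ D hG hX c0 g e h) = actPt (s := g ≫ G.str) (G.mkPt g rfl) ((frSys Λ D hG hX c0).pts T e) (lactD_aux Λ D hG hX c0 g e h) :=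
  Equiv.apply_symm_apply _ _

theorem lactD_nat {T' T : Scheme.{u}} (f : T' ⟶ T) (g : T ⟶ G.carrier) (e : T ⟶ (frSys Λ D hG hX c0).tot) (h h') :
    f ≫ lactD Λ D hG hX c0 g e h = lactD Λ D hG hX c0 (f ≫ g) (f ≫ e) h' := by
  apply ((frSys Λ D hG hX c0).pts T').injective
  have hs := lactD_aux Λ D hG hX c0 g e h
  rw [FrameSys.pts_comp, pts_lactD, pts_lactD]
  refine (pull_actPt f rfl (G.mkPt (s := g ≫ G.str) g rfl) ((frSys Λ D hG hX c0).pts T e) hs ((Category.assoc _ _ _).trans (congrArg (f ≫ ·) hs))).trans ?_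
  have e1 := FrameSys.pts_comp (frSys Λ D hG hX c0) f e
  have e2 : ((frSys Λ D hG hX c0).pts T' (f ≫ e)).x ≫ X.str = (f ≫ g) ≫ G.str := lactD_aux Λ D hG hX c0 (f ≫ g) (f ≫ e) h'
  exact actPt_congr (g := (G.mkPt (s := g ≫ G.str) g rfl).pull f rfl) (g' := G.mkPt (f ≫ g) rfl) (Category.assoc _ _ _).symm rfl e1.symm _ e2

theorem lactD_mul {T : Scheme.{u}} (g g' : T ⟶ G.carrier) (e : T ⟶ (frSys Λ D hG hX c0).tot) (h₁ h₂ h₃ h₄) :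
    lactD Λ D hG hX c0 (G.mul g g' h₁) e h₂ = lactD Λ D hG hX c0 g (lactD Λ D hG hX c0 g' e h₃) h₄ := by
  apply ((frSys Λ D hG hX c0).pts T).injective
  have hs' := lactD_aux Λ D hG hX c0 g' e h₃
  have hs : ((frSys Λ D hG hX c0).pts T e).x ≫ X.str = g ≫ G.str := hs'.trans h₁.symm
  have hs2 : (actPt (s := g ≫ G.str) (G.mkPt g' h₁.symm) ((frSys Λ D hG hX c0).pts T e) hs).x ≫ X.str = g ≫ G.str :=
    (α.ac (s := g ≫ G.str) (G.mkPt g' h₁.symm) (X.mkPt ((frSys Λ D hG hX c0).pts T e).x hs)).2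
  rw [pts_lactD, pts_lactD]
  refine Eq.trans ?_ ((mul_actPt (s := g ≫ G.str) (G.mkPt g rfl) (G.mkPt g' h₁.symm) ((frSys Λ D hG hX c0).pts T e) hs hs2).trans ?_)
  · exact actPt_congr (G.mul_str _ _ _) rfl rfl _ _
  · refine actPt_congr rfl rfl ?_ _ _
    rw [pts_lactD]
    exact actPt_congr h₁ rfl rfl _ _

theorem lactD_add {T : Scheme.{u}} (g : T ⟶ G.carrier) (a b : T ⟶ (frSys Λ D hG hX c0).tot) (h₁ h₂ h₃ h₄ h₅) :
    lactD Λ D hG hX c0 g ((frSys Λ D hG hX c0).addT a b h₁) h₂ = (frSys Λ D hG hX c0).addT (lactD Λ D hG hX c0 g a h₃) (lactD Λ D hG hX c0 g b h₄) h₅ := by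
  apply ((frSys Λ D hG hX c0).pts T).injective
  have hsa := lactD_aux Λ D hG hX c0 g a h₃
  have hab := (frSys Λ D hG hX c0).proj_eq_iff.1 h₁
  have hsb := lactD_aux Λ D hG hX c0 g b h₄
  have hx : (actPt (s := g ≫ G.str) (G.mkPt g rfl) ((frSys Λ D hG hX c0).pts T a) hsa).x = (actPt (s := g ≫ G.str) (G.mkPt g rfl) ((frSys Λ D hG hX c0).pts T b) hsb).x :=
    congrArg (fun z => (α.ac (s := g ≫ G.str) (G.mkPt g rfl) z).1) (mkPt_congr hab _ _)
  rw [pts_lactD]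
  refine Eq.trans ?_ (((frSys Λ D hG hX c0).pts_addT (lactD Λ D hG hX c0 g a h₃) (lactD Λ D hG hX c0 g b h₄) h₅).symm)
  refine Eq.trans ?_ (HPt.addPt_congr (pts_lactD g a h₃).symm (pts_lactD g b h₄).symm hx _)
  refine (actPt_congr rfl rfl ((frSys Λ D hG hX c0).pts_addT a b h₁) _ hsa).trans ?_
  exact HPt.ext' rfl fun t w h h' => rfl

theorem lactD_smul {T : Scheme.{u}} (g : T ⟶ G.carrier) (f : Γ(T, ⊤)) (a : T ⟶ (frSys Λ D hG hX c0).tot) (h₁ h₂) :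
    lactD Λ D hG hX c0 g ((frSys Λ D hG hX c0).smulT f a) h₁ = (frSys Λ D hG hX c0).smulT f (lactD Λ D hG hX c0 g a h₂) := by
  apply ((frSys Λ D hG hX c0).pts T).injective
  have hsa := lactD_aux Λ D hG hX c0 g a h₂
  rw [pts_lactD]
  refine Eq.trans ?_ (((frSys Λ D hG hX c0).pts_smulT f (lactD Λ D hG hX c0 g a h₂)).symm)
  rw [pts_lactD]
  refine (actPt_congr rfl rfl ((frSys Λ D hG hX c0).pts_smulT f a) _ hsa).trans ?_
  exact HPt.ext' rfl fun t w h h' => rfl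

theorem lactD_one {T : Scheme.{u}} (e : T ⟶ (frSys Λ D hG hX c0).tot) (h) :
   lactD Λ D hG hX c0 (((e ≫ (frSys Λ D hG hX c0).proj) ≫ X.str) ≫ G.one) e h = e := by
  apply ((frSys Λ D hG hX c0).pts T).injective
  rw [pts_lactD]
  refine Eq.trans ?_ (one_actPt ((frSys Λ D hG hX c0).pts T e) rfl)
  refine actPt_congr ?_ ?_ rfl _ _
  · rw [h]; exact congrArg (· ≫ X.str) (FrameSys.comp_proj _ e)
  · exact congrArg (fun z => (z ≫ X.str) ≫ G.one) (FrameSys.comp_proj _ e)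

theorem lactD_π {T : Scheme.{u}} (g : T ⟶ G.carrier) (e : T ⟶ (frSys Λ D hG hX c0).tot) (h h') :
    lactD Λ D hG hX c0 g e h ≫ (frSys Λ D hG hX c0).proj = α.act g (e ≫ (frSys Λ D hG hX c0).proj) h' := by
  rw [FrameSys.comp_proj, pts_lactD]
  exact α.act_congr rfl (FrameSys.comp_proj _ e).symm _ _

def linDef : LinearizationData α (frSys Λ D hG hX c0).bdl where
  lact g e h := lactD Λ D hG hX c0 g e h
  lact_π g e h h' := lactD_π g e h h'
  lact_natural f g e h h' := lactD_nat f g e h h'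
  one_lact e h := lactD_one e h
  mul_lact g g' e h₁ h₂ h₃ h₄ := lactD_mul g g' e h₁ h₂ h₃ h₄
  lact_add g a b h₁ h₂ h₃ h₄ h₅ := lactD_add g a b h₁ h₂ h₃ h₄ h₅
  lact_smul g f a h₁ h₂ := lactD_smul g f a h₁ h₂
end
end

section
open scoped TensorProduct
noncomputable section
variable {k : Type u} [Field k]
open SchemeOver LinearizationData
variable {G H : GroupSchemeOver k} {ι : GroupHom H G}

/-- points of the group lifting the closed points of the quotient -/
structure PtFam (D : QData G H ι) where
  ev : D.A →ₐ[k] k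
  ev_eq : Spec.map (CommRingCat.ofHom (ev : D.A →+* k)) = G.one ≫ D.p
  E : PrimeSpectrum D.A → Type u
  [fld : ∀ p, Field (E p)]
  [alg : ∀ p, Algebra k (E p)]
  [fin : ∀ p, Module.Finite k (E p)]
  i : ∀ p, D.A →ₐ[k] E p
  ker : ∀ p, RingHom.ker (i p) = p.asIdeal
  ε : ∀ p, G.Pt (strOf k (E p))
  ε_eq : ∀ p, (ε p).1 ≫ D.p = Spec.map (CommRingCat.ofHom (i p : D.A →+* E p))

attribute [instance] PtFam.fld PtFam.alg PtFam.fin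

theorem exists_pt (D : QData G H ι) (hG : G.IsAlgebraic) (P : PrimeSpectrum D.A) :
    ∃ (E : Type u) (_ : Field E) (_ : Algebra k E) (_ : Module.Finite k E) (i : D.A →ₐ[k] E) (_ : RingHom.ker i = P.asIdeal)
      (ε : G.Pt (strOf k E)), ε.1 ≫ D.p = Spec.map (CommRingCat.ofHom (i : D.A →+* E)) := by
  obtain ⟨g, hg⟩ := D.surj.surj P
  obtain ⟨V, hV, hx, -⟩ := exists_isAffineOpen_mem_and_subset (X := G.carrier) (x := g) (U := ⊤) trivial
  let a : Spec (.of Γ(G.carrier, V)) ⟶ Spk k := hV.fromSpec ≫ G.str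
  letI : Algebra k Γ(G.carrier, V) := algOf a
  have ha : strOf k Γ(G.carrier, V) = a := strOf_algOf a
  haveI := hG.1
  have hft : LocallyOfFiniteType (strOf k Γ(G.carrier, V)) := by
    rw [ha]; infer_instance
  haveI : Algebra.FiniteType k Γ(G.carrier, V) := by
    have := (HasRingHomProperty.Spec_iff (P := @LocallyOfFiniteType)).1 hft
    exact this
  let b : Spec (.of Γ(G.carrier, V)) ⟶ Spec (.of D.A) := hV.fromSpec ≫ D.p
  have hb : Spec.map (CommRingCat.ofHom (Spec.preimage b).hom) = b := Spec.map_preimage b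
  obtain ⟨j, hj⟩ := exists_algHom (k := k) (Spec.preimage b).hom (by
    rw [hb, ha, Category.assoc]; exact congrArg (hV.fromSpec ≫ ·) D.p_str)
  have hjb : Spec.map (CommRingCat.ofHom (j : D.A →+* Γ(G.carrier, V))) = b := by rw [hj, hb]
  have hlt : P.asIdeal.map (j : D.A →+* Γ(G.carrier, V)) ≠ ⊤ := by
    intro h
    have e : hV.fromSpec (hV.primeIdealOf ⟨g, hx⟩) = g := hV.fromSpec_primeIdealOf ⟨g, hx⟩
    have e2 : b (hV.primeIdealOf ⟨g, hx⟩) = P := by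
      exact (congrArg D.p e : D.p (hV.fromSpec (hV.primeIdealOf ⟨g, hx⟩)) = D.p g).trans hg
    rw [← hjb] at e2
    have e3 : (hV.primeIdealOf ⟨g, hx⟩).asIdeal.comap (j : D.A →+* Γ(G.carrier, V)) = P.asIdeal :=
      congrArg PrimeSpectrum.asIdeal e2
    have := Ideal.map_le_iff_le_comap.2 e3.ge
    rw [h, top_le_iff] at this
    exact (hV.primeIdealOf ⟨g, hx⟩).isPrime.ne_top this
  obtain ⟨m, hm, hle⟩ := Ideal.exists_le_maximal _ hlt
  letI : Field (Γ(G.carrier, V) ⧸ m) := Ideal.Quotient.field m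
  haveI : Algebra.FiniteType k (Γ(G.carrier, V) ⧸ m) := Algebra.FiniteType.of_surjective (Ideal.Quotient.mkₐ k m) (Ideal.Quotient.mkₐ_surjective k m)
  haveI hfin : Module.Finite k (Γ(G.carrier, V) ⧸ m) := finite_of_finite_type_of_isJacobsonRing k _
  let i : D.A →ₐ[k] (Γ(G.carrier, V) ⧸ m) := (Ideal.Quotient.mkₐ k m).comp j
  have hi : Spec.map (CommRingCat.ofHom (i : D.A →+* _)) = Spec.map (CommRingCat.ofHom (Ideal.Quotient.mk m)) ≫ b := by
    rw [← hjb, ← Spec.map_comp]; rfl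
  refine ⟨Γ(G.carrier, V) ⧸ m, inferInstance, inferInstance, hfin, i, ?_, G.mkPt (Spec.map (CommRingCat.ofHom (Ideal.Quotient.mk m)) ≫ hV.fromSpec) ?_, ?_⟩
  · haveI : IsArtinianRing D.A := IsArtinianRing.of_finite k D.A
    haveI : P.asIdeal.IsMaximal := inferInstance
    refine (Ideal.IsMaximal.eq_of_le this (RingHom.ker_ne_top _) ?_).symm
    intro z hz
    rw [RingHom.mem_ker]
    exact Ideal.Quotient.eq_zero_iff_mem.2 (hle (Ideal.mem_map_of_mem _ hz))
  · rw [Category.assoc]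
    exact (congrArg (_ ≫ ·) ha.symm).trans (spec_algHom (Ideal.Quotient.mkₐ k m))
  · rw [hi]; exact Category.assoc _ _ _

theorem exists_ptFam (D : QData G H ι) (hG : G.IsAlgebraic) : Nonempty (PtFam D) := by
  choose E f1 f2 f3 i h ε hε using exists_pt D hG
  let b : Spec (.of k) ⟶ Spec (.of D.A) := G.one ≫ D.p
  have hb : Spec.map (CommRingCat.ofHom (Spec.preimage b).hom) = b := Spec.map_preimage b
  obtain ⟨j, hj⟩ := exists_algHom (k := k) (Spec.preimage b).hom (by
    rw [hb, Category.assoc]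
    refine (congrArg (G.one ≫ ·) D.p_str).trans (G.one_str.trans ?_)
    exact (Spec.map_id _).symm)
  exact ⟨{ ev := j, ev_eq := by rw [hj, hb], E := E, fld := f1, alg := f2, fin := f3, i := i, ker := h, ε := ε, ε_eq := hε }⟩
end
end

section
open scoped TensorProduct
noncomputable section
variable {k : Type u} [Field k]
open SchemeOver LinearizationData EqFr

section
variable {A E : Type u} [CommRing A] [Algebra k A] [CommRing E] [Algebra k E]
variable {T : Scheme.{u}} (s : T ⟶ Spk k)

/-- change of the second factor -/
def prodE.snd (ψ : A →ₐ[k] E) : prodE E s ⟶ prodE A s :=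
  prodE.lift (pullback.fst s (strOf k E)) (pullback.snd _ _ ≫ Spec.map (CommRingCat.ofHom (ψ : A →+* E))) (by
    rw [Category.assoc, spec_algHom, pullback.condition])

theorem strOf_self : strOf k k = 𝟙 _ := Spec.map_id _

/-- section given by a rational point of the second factor -/
def prodE.sec (ev : A →ₐ[k] k) : T ⟶ prodE A s :=
  prodE.lift (𝟙 T) (s ≫ Spec.map (CommRingCat.ofHom (ev : A →+* k))) (by
    rw [Category.assoc, spec_algHom, strOf_self, Category.comp_id, Category.id_comp])

variable {s}
theorem evE_snd (ψ : A →ₐ[k] E) {R : Type u} [CommRing R] [Algebra k R] (t : Spec (.of R) ⟶ T) (h : t ≫ s = strOf k R) (r : Γ(prodE A s, ⊤)) :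
    evE t h ((prodE.snd s ψ).appTop r) = Algebra.TensorProduct.map (AlgHom.id R R) ψ (evE t h r) := by
  have h1 : uni E t h ≫ prodE.snd s ψ = Spec.map (CommRingCat.ofHom ((Algebra.TensorProduct.map (AlgHom.id R R) ψ : R ⊗[k] A →ₐ[R] R ⊗[k] E) : R ⊗[k] A →+* R ⊗[k] E)) ≫ uni A t h := by
    have a1 : uni E t h ≫ pullback.fst s (strOf k E) = Spec.map (CommRingCat.ofHom (algebraMap R (R ⊗[k] E))) ≫ t := pullback.lift_fst _ _ _
    have a2 : uni E t h ≫ pullback.snd s (strOf k E) = (Spec.map (CommRingCat.ofHom ((Algebra.TensorProduct.includeRight : E →ₐ[k] R ⊗[k] E) : E →+* R ⊗[k] E))) := pullback.lift_snd _ _ _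
    have b1 : uni A t h ≫ pullback.fst s (strOf k A) = Spec.map (CommRingCat.ofHom (algebraMap R (R ⊗[k] A))) ≫ t := pullback.lift_fst _ _ _
    have b2 : uni A t h ≫ pullback.snd s (strOf k A) = (Spec.map (CommRingCat.ofHom ((Algebra.TensorProduct.includeRight : A →ₐ[k] R ⊗[k] A) : A →+* R ⊗[k] A))) := pullback.lift_snd _ _ _
    have c1 : prodE.snd s ψ ≫ pullback.fst s (strOf k A) = pullback.fst _ _ := pullback.lift_fst _ _ _
    have c2 : prodE.snd s ψ ≫ pullback.snd s (strOf k A) = pullback.snd _ _ ≫ Spec.map (CommRingCat.ofHom (ψ : A →+* E)) := pullback.lift_snd _ _ _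
    refine pullback.hom_ext ?_ ?_
    · rw [Category.assoc, Category.assoc, c1, a1, b1, ← Category.assoc, ← Spec.map_comp]
      congr 2
      ext x
      exact ((Algebra.TensorProduct.map (AlgHom.id R R) ψ : R ⊗[k] A →ₐ[R] R ⊗[k] E).commutes x).symm
    · rw [Category.assoc, Category.assoc, c2, b2, ← Category.assoc, a2, ← Spec.map_comp, ← Spec.map_comp]
      refine congrArg Spec.map (CommRingCat.hom_ext (RingHom.ext fun x => ?_))
      simp
  have h2 := evalAt_appTop (R := .of (R ⊗[k] E)) (uni E t h) (prodE.snd s ψ) r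
  rw [h1] at h2
  exact h2.trans (evalAt_comp (CommRingCat.ofHom ((Algebra.TensorProduct.map (AlgHom.id R R) ψ : R ⊗[k] A →ₐ[R] R ⊗[k] E) : R ⊗[k] A →+* R ⊗[k] E)) (uni A t h) r)

theorem evalAt_sec (ev : A →ₐ[k] k) {R : Type u} [CommRing R] [Algebra k R] (t : Spec (.of R) ⟶ T) (h : t ≫ s = strOf k R) (r : Γ(prodE A s, ⊤)) :
    evalAt t ((prodE.sec s ev).appTop r) = (Algebra.TensorProduct.lift (AlgHom.id R R) ((Algebra.ofId k R).comp ev) (fun _ _ => Commute.all _ _)) (evE t h r) := by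
  let φ : R ⊗[k] A →ₐ[R] R := Algebra.TensorProduct.lift (AlgHom.id R R) ((Algebra.ofId k R).comp ev) (fun _ _ => Commute.all _ _)
  have h1 : t ≫ prodE.sec s ev = Spec.map (CommRingCat.ofHom (φ : R ⊗[k] A →+* R)) ≫ uni A t h := by
    have b1 : uni A t h ≫ pullback.fst s (strOf k A) = Spec.map (CommRingCat.ofHom (algebraMap R (R ⊗[k] A))) ≫ t := pullback.lift_fst _ _ _
    have b2 : uni A t h ≫ pullback.snd s (strOf k A) = (Spec.map (CommRingCat.ofHom ((Algebra.TensorProduct.includeRight : A →ₐ[k] R ⊗[k] A) : A →+* R ⊗[k] A))) := pullback.lift_snd _ _ _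
    have c1 : prodE.sec s ev ≫ pullback.fst s (strOf k A) = 𝟙 _ := pullback.lift_fst _ _ _
    have c2 : prodE.sec s ev ≫ pullback.snd s (strOf k A) = s ≫ Spec.map (CommRingCat.ofHom (ev : A →+* k)) := pullback.lift_snd _ _ _
    refine pullback.hom_ext ?_ ?_
    · rw [Category.assoc, Category.assoc, c1, b1, ← Category.assoc, ← Spec.map_comp, Category.comp_id]
      have : CommRingCat.ofHom (algebraMap R (R ⊗[k] A)) ≫ CommRingCat.ofHom (φ : R ⊗[k] A →+* R) = 𝟙 _ := by
        ext x
        exact φ.commutes x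
      rw [this, Spec.map_id, Category.id_comp]
    · rw [Category.assoc, Category.assoc, c2, b2, ← Category.assoc, h, ← Spec.map_comp, ← Spec.map_comp]
      congr 1
      ext x
      simp [φ, Algebra.ofId_apply]
  have h2 := evalAt_appTop (R := .of R) t (prodE.sec s ev) r
  rw [h1] at h2
  exact h2.trans (evalAt_comp (CommRingCat.ofHom (φ : R ⊗[k] A →+* R)) (uni A t h) r)
end

variable {G H : GroupSchemeOver k} {ι : GroupHom H G}

/-- the norm to a power splits along the closed points -/
def PtFam.IsSplit {D : QData G H ι} (P : PtFam D) (c : ℕ) (l : List (PrimeSpectrum D.A)) : Prop :=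
  ∀ (R : Type u) [CommRing R] [Algebra k R] (u : R ⊗[k] D.A), Algebra.norm R u ^ c = (Algebra.TensorProduct.lift (AlgHom.id R R) ((Algebra.ofId k R).comp P.ev) (fun _ _ => Commute.all _ _) u)^c * (l.map fun p => Algebra.norm R (Algebra.TensorProduct.map (AlgHom.id R R) (P.i p) u)).prod

theorem PtFam.exists_split {D : QData G H ι} (P : PtFam D) : ∃ c l, 0 < c ∧ P.IsSplit c l := 
  norm_pow_eq P.ev P.E P.i P.ker

theorem gN_split {D : QData G H ι} {P : PtFam D} {c : ℕ} {l : List (PrimeSpectrum D.A)} (hs : P.IsSplit c l)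
    {T : Scheme.{u}} (s : T ⟶ Spk k) (r : Γ(prodE D.A s, ⊤)) :
    gN s r ^ c = ((prodE.sec s P.ev).appTop r) ^ c * (l.map fun p => gN s ((prodE.snd s (P.i p)).appTop r)).prod := by
  refine global_ext' s fun R _ _ t h => ?_
  show evalHom t _ = evalHom t _
  rw [map_mul, map_pow, map_pow, map_list_prod, List.map_map]
  have h1 : evalHom t (gN s r) = Algebra.norm R (evE t h r) := evalAt_gN r t h
  have h2 := evalAt_sec P.ev t h r
  have h3 : (⇑(evalHom t) ∘ fun p => gN s ((prodE.snd s (P.i p)).appTop r)) = fun p => Algebra.norm R (Algebra.TensorProduct.map (AlgHom.id R R) (P.i p) (evE t h r)) := by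
    funext p
    refine (evalAt_gN _ t h).trans ?_
    rw [evE_snd]
  rw [h3, h1]
  refine (hs R _).trans ?_
  rw [← h2]; rfl

variable {X : SchemeOver k} {α : ActionOver G X} {L : LineBundle X.carrier}
variable {Λ : LinearizationData (α.res ι) L} 

/-- first-factor projection of a product -/
abbrev fstE (E : Type u) [CommRing E] [Algebra k E] {T : Scheme.{u}} (s : T ⟶ Spk k) : prodE E s ⟶ T := pullback.fst _ _
/-- the universal point of the group over a product -/
def PtFam.epsP {D : QData G H ι} (P : PtFam D) (p : PrimeSpectrum D.A) {T : Scheme.{u}} (s : T ⟶ Spk k) : G.Pt (fstE (P.E p) s ≫ s) :=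
  (P.ε p).pull (pullback.snd _ _) pullback.condition.symm

theorem cc_split {D : QData G H ι} {P : PtFam D} {c : ℕ} {l : List (PrimeSpectrum D.A)} (hsp : P.IsSplit c l)
    {T : Scheme.{u}} {w w' : EqFr Λ T} (hx : w'.x = w.x) {s : T ⟶ Spk k} (hs : w.x ≫ X.str = s) (h1 h1') 
    (h2 : ∀ p, (fstE (P.E p) s ≫ w.x) ≫ X.str = fstE (P.E p) s ≫ s) (h2' : ∀ p, (fstE (P.E p) s ≫ w'.x) ≫ X.str = fstE (P.E p) s ≫ s) :
    cc D c w w' = L.ratio (w.w (s' := s) (𝟙 T) 1 h1).1 (w'.w (s' := s) (𝟙 T) 1 h1').1 ^ c *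
      (l.map fun p => gN s (L.ratio (w.w (fstE (P.E p) s) (P.epsP p s) (h2 p)).1 (w'.w (fstE (P.E p) s) (P.epsP p s) (h2' p)).1)).prod := by
  obtain ⟨r, hr⟩ := exists_isRatio D w w' hx s hs
  rw [cc_eq c hx hs hr, gN_split hsp]
  congr 1
  · congr 1
    refine Eq.trans ?_ (hr (𝟙 T) 1 h1 h1' ?_)
    · congr 3
      refine prodE.lift_congr rfl ?_ _ _
      rw [GroupSchemeOver.one_val, Category.assoc, P.ev_eq]
    · rw [GroupSchemeOver.one_val, Category.assoc, Category.assoc, D.p_str, G.one_str]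
      simp
  · congr 2
    funext p
    congr 1
    refine Eq.trans ?_ (hr (fstE (P.E p) s) (P.epsP p s) (h2 p) (h2' p) ?_)
    · congr 3
      refine prodE.lift_congr rfl ?_ _ _
      refine (congrArg (_ ≫ ·) (P.ε_eq p).symm).trans ?_
      exact (Category.assoc _ _ _).symm
    · rw [Category.assoc, D.p_str]
      exact (P.epsP p s).2.symm
end
end

section
open scoped TensorProduct
noncomputable section

theorem isAffineOpen_of_local {X : Scheme.{u}} (D U : X.Opens) (hU : IsAffineOpen U) (hDU : D ≤ U)
    (h : ∀ x : X, ∃ V : X.Opens, x ∈ V ∧ ∃ f : Γ(V.toScheme, ⊤), V.ι ⁻¹ᵁ D = V.toScheme.basicOpen f) : IsAffineOpen D := by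
  have h1 : IsAffineHom D.ι := by
    refine isAffineHom_of_forall_exists_isAffineOpen _ fun x => ?_
    obtain ⟨V, hxV, f, hf⟩ := h x
    obtain ⟨W, hW, hxW, hWV'⟩ := exists_isAffineOpen_mem_and_subset (X := X) (x := x) (U := V) hxV
    have hWV : W ≤ V := hWV'
    refine ⟨W, hxW, hW, ?_⟩
    haveI : IsAffine W.toScheme := hW
    have hb := (isAffineOpen_top W.toScheme).basicOpen ((X.homOfLE hWV).appTop f)
    have e1 : W.toScheme.basicOpen ((X.homOfLE hWV).appTop f) = W.ι ⁻¹ᵁ D := by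
      rw [← Scheme.preimage_basicOpen_top, ← hf, ← Scheme.Hom.comp_preimage, X.homOfLE_ι]
    rw [e1] at hb
    have hc := hb.image_of_isOpenImmersion W.ι
    rw [← Scheme.Hom.isAffineOpen_iff_of_isOpenImmersion D.ι]
    have e2 : D.ι ''ᵁ D.ι ⁻¹ᵁ W = W.ι ''ᵁ W.ι ⁻¹ᵁ D := by
      rw [Scheme.Hom.image_preimage_eq_opensRange_inf, Scheme.Hom.image_preimage_eq_opensRange_inf, Scheme.Opens.opensRange_ι, Scheme.Opens.opensRange_ι, inf_comm]
    rw [e2]; exact hc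
  have h2 := hU.preimage D.ι
  rw [← Scheme.Hom.isAffineOpen_iff_of_isOpenImmersion D.ι, Scheme.Hom.image_preimage_eq_opensRange_inf, Scheme.Opens.opensRange_ι, inf_eq_left.2 hDU] at h2
  exact h2

/-- A homogeneous function of degree `m` on local generators -/
structure HSec {X : Scheme.{u}} (L : LineBundle X) (m : ℕ) : Type (u+1) where
  φ : ∀ {T : Scheme.{u}} (_ : T ⟶ L.tot), Γ(T, ⊤)
  nat : ∀ {T T' : Scheme.{u}} (t : T' ⟶ T) (v : T ⟶ L.tot), L.IsGen v → φ (t ≫ v) = t.appTop (φ v)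
  homog : ∀ {T : Scheme.{u}} (v v' : T ⟶ L.tot), L.IsGen v → L.IsGen v' → v' ≫ L.π = v ≫ L.π → φ v = L.ratio v v' ^ m * φ v'

def HSec.IsLocus {X : Scheme.{u}} {L : LineBundle X} {m : ℕ} (σ : HSec L m) (U : X.Opens) : Prop :=
  ∀ {T : Scheme.{u}} (v : T ⟶ L.tot), L.IsGen v → ∀ t : T, (v ≫ L.π) t ∈ U ↔ t ∈ T.basicOpen (σ.φ v)

def HSec.pow {X : Scheme.{u}} {L : LineBundle X} {m : ℕ} (σ : HSec L m) (n : ℕ) {m' : ℕ} (h : m' = m * n) : HSec L m' where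
  φ v := σ.φ v ^ n
  nat t v hv := by rw [σ.nat t v hv, map_pow]
  homog v v' hv hv' e := by rw [σ.homog v v' hv hv' e, mul_pow, h, pow_mul]

theorem HSec.pow_isLocus {X : Scheme.{u}} {L : LineBundle X} {m : ℕ} (σ : HSec L m) (n : ℕ) (hn : 0 < n) {m' : ℕ} (h : m' = m * n) {U : X.Opens}
    (hU : σ.IsLocus U) : (σ.pow n h).IsLocus U := by
  intro T v hv t
  rw [hU v hv t]
  show _ ↔ t ∈ T.basicOpen (σ.φ v ^ n)
  rw [Scheme.basicOpen_pow _ _ hn]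

theorem exists_hsec {X : Scheme.{u}} {L : LineBundle X} (hL : IsAmple L) (x : X) :
    ∃ (m : ℕ) (_ : 0 < m) (σ : HSec L m) (U : X.Opens), IsAffineOpen U ∧ x ∈ U ∧ σ.IsLocus U := by
  obtain ⟨m, hm, N, hN, s, hs, U, hU, hx, hUs⟩ := hL.2.2 x
  obtain ⟨P⟩ := exists_powMap L m N hN
  have hπ : ∀ {T : Scheme.{u}} (v : T ⟶ L.tot), (v ≫ L.π ≫ s) ≫ N.π = P.pw v ≫ N.π := fun v => by
    rw [P.pw_π, Category.assoc, Category.assoc, hs, Category.comp_id]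
  refine ⟨m, hm, ⟨fun v => N.ratio (P.pw v) (v ≫ L.π ≫ s), ?_, ?_⟩, U, hU, hx, ?_⟩
  · intro T T' t v hv
    rw [P.pw_nat, Category.assoc]
    exact (P.pw_gen v hv).ratio_natural (hπ v) t
  · intro T v v' hv hv' e
    have e1 : v' ≫ L.π ≫ s = v ≫ L.π ≫ s := by rw [← Category.assoc, e, Category.assoc]
    have e2 : P.pw v' ≫ N.π = P.pw v ≫ N.π := by rw [P.pw_π, P.pw_π, e]
    have e3 : N.ratio (P.pw v) (P.pw v') = L.ratio v v' ^ m := by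
      refine (P.pw_gen v hv).ratio_eq ?_
      rw [← P.pw_smul, hv.smul_ratio e]
    rw [← e3]
    refine Eq.trans ?_ ((P.pw_gen v hv).ratio_mul (P.pw_gen v' hv') e2 (hπ v')).symm
    rw [e1]
  · intro T v hv t
    have := vanish_iff N s hs (v ≫ L.π) (P.pw v) (P.pw_π v) (P.pw_gen v hv) (N.ratio (P.pw v) (v ≫ L.π ≫ s))
      (by rw [(P.pw_gen v hv).smul_ratio (hπ v), Category.assoc]) t
    refine Iff.trans ?_ this
    exact Set.ext_iff.1 hUs _

theorem exists_hsecs {X : Scheme.{u}} {L : LineBundle X} (hL : IsAmple L) :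
    ∃ (n m : ℕ) (_ : 0 < m) (σ : Fin n → HSec L m) (U : Fin n → X.Opens), (∀ j, IsAffineOpen (U j)) ∧ (∀ x, ∃ j, x ∈ U j) ∧ ∀ j, (σ j).IsLocus (U j) := by
  choose m hm σ U hU hx hl using exists_hsec hL
  haveI := hL.1
  obtain ⟨F, hF⟩ := isCompact_univ.elim_finite_subcover (fun x : X => (U x : Set X)) (fun x => (U x).isOpen) (fun x _ => Set.mem_iUnion.2 ⟨x, hx x⟩)
  let e := F.equivFin
  have hd : ∀ j, m (e.symm j) ∣ ∏ x ∈ F, m x := fun j => Finset.dvd_prod_of_mem _ (e.symm j).2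
  have hpos : 0 < ∏ x ∈ F, m x := Finset.prod_pos fun x _ => hm x
  refine ⟨F.card, ∏ x ∈ F, m x, hpos, fun j => (σ (e.symm j)).pow _ (Nat.mul_div_cancel' (hd j)).symm, fun j => U (e.symm j), fun j => hU _, ?_, ?_⟩
  · intro x
    obtain ⟨y, hy, hxy⟩ := Set.mem_iUnion₂.1 (hF (Set.mem_univ x))
    exact ⟨e ⟨y, hy⟩, by dsimp only; rw [Equiv.symm_apply_apply]; exact hxy⟩
  · intro j
    exact HSec.pow_isLocus _ _ (Nat.div_pos (Nat.le_of_dvd hpos (hd j)) (hm _)) _ (hl _)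
end
end

section
open scoped TensorProduct
noncomputable section
variable {k : Type u} [Field k]
open SchemeOver LinearizationData EqFr
variable {G H : GroupSchemeOver k} {ι : GroupHom H G}
variable {X : SchemeOver k} {α : ActionOver G X} {L : LineBundle X.carrier}
variable {Λ : LinearizationData (α.res ι) L} 

theorem bigH1 {T : Scheme.{u}} {x : T ⟶ X.carrier} {s : T ⟶ Spk k} (hs : x ≫ X.str = s) : (𝟙 T ≫ x) ≫ X.str = s := by
  rw [Category.id_comp, hs]
theorem bigH2 {T T' : Scheme.{u}} {x : T ⟶ X.carrier} {s : T ⟶ Spk k} (hs : x ≫ X.str = s) (t : T' ⟶ T) : (t ≫ x) ≫ X.str = t ≫ s := by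
  rw [Category.assoc, hs]

variable {D : QData G H ι} (P : PtFam D) {n m : ℕ} (σ : Fin n → HSec L m)

/-- the local contribution at a closed point of the quotient -/
def ptVal (p : PrimeSpectrum D.A) (d : ℕ) {T : Scheme.{u}} (w : EqFr Λ T) (s : T ⟶ Spk k) (hs : w.x ≫ X.str = s) : Γ(T, ⊤) :=
  (pnormOp k (P.E p) n d).gl s (fun j => (σ j).φ (w.w (fstE (P.E p) s) (P.epsP p s) (bigH2 hs _)).1)

theorem ptVal_nat (p : PrimeSpectrum D.A) (d : ℕ) {T T' : Scheme.{u}} (t : T' ⟶ T) (w : EqFr Λ T) (s : T ⟶ Spk k) (hs : w.x ≫ X.str = s)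
    (s' : T' ⟶ Spk k) (hs' : t ≫ s = s') (h) : 
    ptVal P σ p d (w.pull t) s' h = t.appTop (ptVal P σ p d w s hs) := by
  refine Eq.trans ?_ (NatOp.gl_nat _ t hs' _)
  rw [ptVal]
  congr 1
  funext j
  rw [← (σ j).nat _ _ (w.w_gen _ _ _)]
  congr 1
  have e1 : prodE.map (P.E p) t hs' ≫ fstE (P.E p) s = fstE (P.E p) s' ≫ t := pullback.lift_fst _ _ _
  have e2 : prodE.map (P.E p) t hs' ≫ pullback.snd s (strOf k (P.E p)) = pullback.snd _ _ := pullback.lift_snd _ _ _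
  have e3 : prodE.map (P.E p) t hs' ≫ fstE (P.E p) s ≫ s = fstE (P.E p) s' ≫ s' := by
    rw [← Category.assoc, e1, Category.assoc, hs']
  have e4 : ((prodE.map (P.E p) t hs' ≫ fstE (P.E p) s) ≫ w.x) ≫ X.str = fstE (P.E p) s' ≫ s' := by
    rw [Category.assoc, Category.assoc, hs, e3]
  have := w.w_nat (prodE.map (P.E p) t hs') e3 (fstE (P.E p) s) (P.epsP p s) (bigH2 hs _) e4
  refine Eq.trans ?_ (congrArg Subtype.val this).symm
  refine congrArg Subtype.val (w.w_congr e1.symm ?_ _ _)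
  refine Subtype.ext ?_
  refine (congrArg (· ≫ (P.ε p).1) e2.symm).trans ?_
  exact Category.assoc _ _ _

theorem gN_pow {E : Type u} [CommRing E] [Algebra k E] [Module.Finite k E] {T : Scheme.{u}} {s : T ⟶ Spk k} (f : Γ(prodE E s, ⊤)) (n : ℕ) : gN s (f ^ n) = gN s f ^ n := by
  induction n with
  | zero => rw [pow_zero, pow_zero, gN_one]
  | succ n ih => rw [pow_succ, gN_mul, ih, pow_succ]

theorem ptVal_homog (p : PrimeSpectrum D.A) (d : ℕ) {T : Scheme.{u}} (w w' : EqFr Λ T) (hx : w'.x = w.x) (s : T ⟶ Spk k) (hs : w.x ≫ X.str = s) (hs') : 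
    ptVal P σ p d w s hs = gN s (L.ratio (w.w (fstE (P.E p) s) (P.epsP p s) (bigH2 hs _)).1 (w'.w (fstE (P.E p) s) (P.epsP p s) (bigH2 hs' _)).1) ^ m *
      ptVal P σ p d w' s hs' := by
  rw [← gN_pow]
  refine Eq.trans ?_ (gpN_smul _ _)
  rw [ptVal]
  congr 1
  funext j
  exact (σ j).homog _ _ (w.w_gen _ _ _) (w'.w_gen _ _ _) (w.w_π_eq w' hx _ _ _ _)

variable (c : ℕ) (l : List (PrimeSpectrum D.A)) (j0 : Fin n) (d : PrimeSpectrum D.A → ℕ)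
/-- the norm-type section evaluated on an equivariant frame -/
def bigVal {T : Scheme.{u}} (w : EqFr Λ T) (s : T ⟶ Spk k) (hs : w.x ≫ X.str = s) : Γ(T, ⊤) :=
  (σ j0).φ (w.w (𝟙 T) 1 (bigH1 hs)).1 ^ c * (l.map fun p => ptVal P σ p (d p) w s hs).prod

theorem bigVal_nat {T T' : Scheme.{u}} (t : T' ⟶ T) (w : EqFr Λ T) (s : T ⟶ Spk k) (hs : w.x ≫ X.str = s)
    (s' : T' ⟶ Spk k) (hs' : t ≫ s = s') (h) : 
    bigVal P σ c l j0 d (w.pull t) s' h = t.appTop (bigVal P σ c l j0 d w s hs) := by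
  rw [bigVal, bigVal, map_mul, map_pow, map_list_prod, List.map_map]
  congr 1
  · congr 1
    rw [← (σ j0).nat _ _ (w.w_gen _ _ _)]
    congr 1
    have := w.w_nat t hs' (𝟙 T) 1 (bigH1 hs) (by rw [Category.comp_id, Category.assoc, hs, hs'])
    refine Eq.trans ?_ (congrArg Subtype.val this).symm
    refine congrArg Subtype.val (w.w_congr ?_ ?_ _ _)
    · rw [Category.id_comp, Category.comp_id]
    · exact (GroupSchemeOver.pull_one _ _).symm
  · congr 2
    funext p
    exact ptVal_nat P σ p (d p) t w s hs s' hs' h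

variable {c l}
theorem bigVal_homog (hsp : P.IsSplit c l) {T : Scheme.{u}} (w w' : EqFr Λ T) (hx : w'.x = w.x) (s : T ⟶ Spk k) (hs : w.x ≫ X.str = s) (hs') : 
    bigVal P σ c l j0 d w s hs = cc D c w w' ^ m * bigVal P σ c l j0 d w' s hs' := by
  rw [cc_split hsp hx hs (bigH1 hs) (bigH1 hs') (fun p => bigH2 hs _) (fun p => bigH2 hs' _)]
  rw [bigVal, bigVal, mul_pow, mul_mul_mul_comm]
  congr 1
  · rw [(σ j0).homog _ _ (w.w_gen _ _ _) (w'.w_gen _ _ _) (w.w_π_eq w' hx (𝟙 T) 1 (bigH1 hs) (bigH1 hs')), mul_pow]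
    rw [← pow_mul, ← pow_mul, mul_comm m c]
  · have hp := map_list_prod (powMonoidHom m : Γ(T, ⊤) →* Γ(T, ⊤)) (l.map fun p => gN s (L.ratio (w.w (fstE (P.E p) s) (P.epsP p s) (bigH2 hs _)).1 (w'.w (fstE (P.E p) s) (P.epsP p s) (bigH2 hs' _)).1))
    refine Eq.trans ?_ (congrArg (· * _) hp.symm)
    rw [List.map_map, ← List.prod_map_mul]
    congr 2
    funext p
    exact ptVal_homog P σ p (d p) w w' hx s hs hs'

variable [Mono ι.hom] (hG : G.IsAlgebraic) (hX : LocallyOfFiniteType X.str)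

/-- the section of the power of the norm bundle -/
def bigPt (hsp : P.IsSplit c l) : ((frSys Λ D hG hX c).pow m).HPt X.carrier where
  x := 𝟙 X.carrier
  val t w h := bigVal P σ c l j0 d w (w.x ≫ X.str) rfl
  nat t' t w h h' := bigVal_nat P σ c l j0 d t' w _ rfl _ (Category.assoc _ _ _).symm rfl
  homog t w w' h h' := by
    have hx : w'.x = w.x := h'.trans h.symm
    refine (bigVal_homog P σ j0 d hsp w w' hx _ rfl (by rw [hx])).trans ?_
    have e : ∀ (s : _) (hs : w'.x ≫ X.str = s), bigVal P σ c l j0 d w' s hs = bigVal P σ c l j0 d w' (w'.x ≫ X.str) rfl := by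
      rintro s rfl; rfl
    exact congrArg (cc D c w w' ^ m * ·) (e _ _)
end
end

section
open scoped TensorProduct
noncomputable section

theorem FrameSys.sec_π {X : Scheme.{u}} (F : FrameSys X) (b : F.HPt X) (hb : b.x = 𝟙 X) : (F.pts X).symm b ≫ F.bdl.π = 𝟙 X := by
  refine (F.comp_proj _).trans ?_
  rw [Equiv.apply_symm_apply, hb]

theorem FrameSys.sec_locus {X : Scheme.{u}} (F : FrameSys X) (b : F.HPt X) (hb : b.x = 𝟙 X) {T : Scheme.{u}} (w : F.Fr T)
    (h : F.pt w = F.pt w ≫ b.x) (t : T) :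
    ((F.pts X).symm b) (F.pt w t) ≠ F.bdl.zero (F.pt w t) ↔ t ∈ T.basicOpen (b.val (F.pt w) w h) := by
  refine vanish_iff F.bdl _ (F.sec_π b hb) (F.pt w) (F.gen w) (F.gen_π w) (F.isGen_gen w) _ ?_ t
  apply (F.pts T).injective
  refine (F.pts_smul_gen w _).trans ?_
  have h1 : F.pts T (F.pt w ≫ (F.pts X).symm b) = b.pull (F.pt w) := by
    rw [FrameSys.pts_comp, Equiv.apply_symm_apply]
  refine Eq.trans ?_ h1.symm
  have h2 : F.pt w = 𝟙 T ≫ (b.pull (F.pt w)).x := by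
    rw [FrameSys.HPt.pull_x, Category.id_comp]; exact h
  refine Eq.trans ?_ (FrameSys.HPt.eq_ofFr (b.pull (F.pt w)) w h2).symm
  rw [FrameSys.HPt.pull_val]
  congr 1

theorem exists_field_pt {T : Scheme.{u}} (x : T) : ∃ (K : Type u) (_ : Field K) (t : Spec (.of K) ⟶ T), ∀ z, t z = x :=
  ⟨T.residueField x, inferInstance, T.fromSpecResidueField x, fun z => Scheme.fromSpecResidueField_apply x z⟩

variable {k : Type u} [Field k]
open SchemeOver LinearizationData EqFr
variable {G H : GroupSchemeOver k} {ι : GroupHom H G}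
variable {X : SchemeOver k} {α : ActionOver G X} {L : LineBundle X.carrier}
variable {Λ : LinearizationData (α.res ι) L} 
variable {D : QData G H ι} (P : PtFam D) {n m : ℕ} (σ : Fin n → HSec L m)

theorem exists_d (U : Fin n → X.carrier.Opens) (hU : ∀ x, ∃ j, x ∈ U j) (hl : ∀ j, (σ j).IsLocus (U j))
    {K : Type u} [Field K] {T : Scheme.{u}} (t : Spec (.of K) ⟶ T) (w : EqFr Λ T) (s : T ⟶ Spk k) (hs : w.x ≫ X.str = s) (p : PrimeSpectrum D.A) :
    ∃ d, evalAt t (ptVal P σ p d w s hs) ≠ 0 := by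
  letI : Algebra k K := algOf (t ≫ s)
  have ht : t ≫ s = strOf k K := (strOf_algOf (t ≫ s)).symm
  obtain ⟨d, hd⟩ := pNorm_ne_zero (k := k) (fun j => evE t ht ((σ j).φ (w.w (fstE (P.E p) s) (P.epsP p s) (bigH2 hs _)).1)) (by
    by_contra hne
    obtain ⟨q, hq, hle⟩ := Ideal.exists_le_maximal _ hne
    let y : Spec (.of (K ⊗[k] P.E p)) := (⟨q, hq.isPrime⟩ : PrimeSpectrum (K ⊗[k] P.E p))
    obtain ⟨j, hj⟩ := hU (((w.w (fstE (P.E p) s) (P.epsP p s) (bigH2 hs _)).1 ≫ L.π) (uni (P.E p) t ht y))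
    have h1 := (hl j _ (w.w_gen _ _ _) _).1 hj
    have h2 := (mem_basicOpen_evalAt (uni (P.E p) t ht) _ y).1 h1
    exact h2 (hle (Ideal.subset_span ⟨j, rfl⟩)))
  refine ⟨d, ?_⟩
  rw [ptVal, NatOp.evalAt_gl _ _ t ht]
  exact hd

theorem w_one_π {T : Scheme.{u}} (w : EqFr Λ T) {s : T ⟶ Spk k} (h) : (w.w (s' := s) (𝟙 T) 1 h).1 ≫ L.π = w.x := by
  have := w.w_base (𝟙 T) 1 h
  rw [inv_one, ActionOver.one_ac] at this
  exact (congrArg Subtype.val this).trans (Category.id_comp _)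

variable {c : ℕ} {l : List (PrimeSpectrum D.A)}
variable [Mono ι.hom] (hG : G.IsAlgebraic) (hX : LocallyOfFiniteType X.str)

theorem frSys_ample (hL : IsAmple L) (hc : 0 < c) (hsp : P.IsSplit c l) : IsAmple (frSys Λ D hG hX c).bdl := by
  obtain ⟨n, m, hm, σ, U, hUa, hU, hl⟩ := exists_hsecs hL
  refine ⟨hL.1, hL.2.1, fun x0 => ?_⟩
  obtain ⟨j0, hj0⟩ := hU x0
  obtain ⟨V, w0, hxV, hw0⟩ := (frSys Λ D hG hX c).loc x0
  obtain ⟨z0, hz0⟩ : ∃ z0 : V.toScheme, V.ι z0 = x0 := ⟨⟨x0, hxV⟩, rfl⟩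
  obtain ⟨K, _, t0, hpt⟩ := exists_field_pt (T := V.toScheme) z0
  choose d hd using exists_d P σ U hU hl t0 w0 (w0.x ≫ X.str) rfl
  let b := bigPt (Λ := Λ) P σ j0 d hG hX hsp
  have hloc : ∀ {T : Scheme.{u}} (w : EqFr Λ T) (t : T), (((frSys Λ D hG hX c).pow m).pts X.carrier).symm b (w.x t) ≠ ((frSys Λ D hG hX c).pow m).bdl.zero (w.x t) ↔
      t ∈ T.basicOpen (bigVal P σ c l j0 d w (w.x ≫ X.str) rfl) := fun w t =>
    FrameSys.sec_locus ((frSys Λ D hG hX c).pow m) b rfl w (Category.comp_id _).symm t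
  let S : Set X.carrier := {y | (((frSys Λ D hG hX c).pow m).pts X.carrier).symm b y ≠ ((frSys Λ D hG hX c).pow m).bdl.zero y}
  have hfr : ∀ x : X.carrier, ∃ (V : X.carrier.Opens) (_ : x ∈ V) (f : Γ(V.toScheme, ⊤)), ∀ t : V.toScheme, V.ι t ∈ S ↔ t ∈ V.toScheme.basicOpen f := by
    intro x
    obtain ⟨V, w, hxV, hw⟩ := (frSys Λ D hG hX c).loc x
    have hw : w.x = V.ι := hw
    refine ⟨V, hxV, bigVal P σ c l j0 d w (w.x ≫ X.str) rfl, fun t => ?_⟩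
    rw [← hw]
    exact hloc w t
  have hSo : IsOpen S := by
    rw [isOpen_iff_forall_mem_open]
    intro x hx
    obtain ⟨V, hxV, f, hf⟩ := hfr x
    refine ⟨(V.ι ''ᵁ V.toScheme.basicOpen f : X.carrier.Opens), ?_, (V.ι ''ᵁ V.toScheme.basicOpen f).isOpen, ⟨⟨x, hxV⟩, (hf ⟨x, hxV⟩).1 hx, rfl⟩⟩
    rintro _ ⟨y, hy, rfl⟩
    exact (hf y).2 hy
  let S' : X.carrier.Opens := ⟨S, hSo⟩
  have hSU : S' ≤ U j0 := by
    intro x hx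
    obtain ⟨V, w, hxV, hw⟩ := (frSys Λ D hG hX c).loc x
    have hw : w.x = V.ι := hw
    have hx1 : w.x ⟨x, hxV⟩ = x := by rw [hw]; rfl
    have hx2 := (hloc w ⟨x, hxV⟩).1 (by rw [hx1]; exact hx)
    rw [bigVal, Scheme.basicOpen_mul, Scheme.basicOpen_pow _ _ hc] at hx2
    have := (hl j0 _ (w.w_gen _ _ _) _).2 hx2.1
    rw [w_one_π, hx1] at this
    exact this
  refine ⟨m, hm, ((frSys Λ D hG hX c).pow m).bdl, FrameSys.isTensorPow_pow _ m, (((frSys Λ D hG hX c).pow m).pts X.carrier).symm b,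
    FrameSys.sec_π _ b rfl, S', ?_, ?_, rfl⟩
  · refine isAffineOpen_of_local S' (U j0) (hUa j0) hSU fun x => ?_
    obtain ⟨V, hxV, f, hf⟩ := hfr x
    exact ⟨V, hxV, f, TopologicalSpace.Opens.ext (Set.ext hf)⟩
  · have hw : w0.x = V.ι := hw0
    have hx1 : w0.x z0 = x0 := by rw [hw]; exact hz0
    show x0 ∈ S
    rw [← hx1]
    refine (hloc w0 z0).2 ?_
    let z : Spec (.of K) := (⊥ : PrimeSpectrum K)
    have key : ∀ f : Γ(V.toScheme, ⊤), z0 ∈ V.toScheme.basicOpen f ↔ evalHom t0 f ≠ 0 := fun f => by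
      rw [← hpt z]; exact mem_basicOpen_field (K := K) t0 f z
    rw [key]
    rw [bigVal, map_mul, map_pow, map_list_prod, List.map_map]
    refine mul_ne_zero (pow_ne_zero _ ?_) ?_
    · rw [← key, ← hl j0 _ (w0.w_gen _ _ _), w_one_π, hx1]
      exact hj0
    · refine List.prod_ne_zero ?_
      intro h0
      obtain ⟨p, -, hp⟩ := List.mem_map.1 h0
      exact hd p hp
end
end

/-- Let `k` be a field, `G` an algebraic group over `k`, `H ⊆ G` a subgroup
scheme with `G/H` finite, and `X` a `G`-scheme of finite type over `k`. If `X` admits an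
ample `H`-linearized line bundle, then it admits an ample `G`-linearized line bundle. -/
theorem ample_G_linearized_of_ample_H_linearized
    {k : Type u} [Field k] (G H : GroupSchemeOver k) (hGalg : G.IsAlgebraic)
    (hHalg : H.IsAlgebraic) (ι : GroupHom H G) (hι : IsClosedImmersion ι.hom)
    (Q : SchemeOver k) (q : G.carrier ⟶ Q.carrier) (hq : IsCosetQuotient G H ι Q q)
    (hQfin : IsFinite Q.str)
    (X : SchemeOver k) (hXft : X.IsFiniteType) (α : ActionOver G X)
    (hH : ∃ L : LineBundle X.carrier, IsAmple L ∧ (α.res ι).IsLinearized L) :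
    ∃ L' : LineBundle X.carrier, IsAmple L' ∧ α.IsLinearized L' := by
  obtain ⟨L, hL, ⟨Λ⟩⟩ := hH
  haveI := hι
  haveI : Mono ι.hom := inferInstance
  obtain ⟨D⟩ := exists_qdata G H hGalg ι Q q hq hQfin
  obtain ⟨P⟩ := exists_ptFam D hGalg
  obtain ⟨c, l, hc, hsp⟩ := P.exists_split
  have hX : LocallyOfFiniteType X.str := hXft.1
  exact ⟨(frSys Λ D hGalg hX c).bdl, frSys_ample P hGalg hX hL hc hsp, ⟨linDef⟩⟩
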